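/- arXiv:2011.01366 — 2 statements merged into one kernel-verified Lean document; each statement's English description precedes it below -/
import Mathlib

section
/- There is a constant c such that for every d ≥ 2 and every primitive permutation group Γ ≤ Sym(Ω) on a finite set Ω of size n that belongs to the class Γ̂_d, it holds that |Γ| ≤ n^{c·d}. -/
/-- The factor group `H / K` (for `K ≤ H` subgroups of an ambient group) is isomorphic to a
subgroup of the symmetric group `S_d`. -/
def FactorEmbedsInSym (d : ℕ) {G : Type*} [Group G] (H K : Subgroup G) : Prop :=
  ∃ f : ↥H →* Equiv.Perm (Fin d), f.ker = K.subgroupOf H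

/-- `c : Fin (n+1) → Subgroup G` is a composition series of `G`. -/
def IsCompositionSeries {G : Type*} [Group G] {n : ℕ} (c : Fin (n + 1) → Subgroup G) : Prop :=
  c 0 = ⊤ ∧ c (Fin.last n) = ⊥ ∧
    ∀ i : Fin n,
      c i.succ < c i.castSucc ∧
      ((c i.succ).subgroupOf (c i.castSucc)).Normal ∧
      ∀ N : Subgroup ↥(c i.castSucc), N.Normal →
        (c i.succ).subgroupOf (c i.castSucc) ≤ N →
        N = (c i.succ).subgroupOf (c i.castSucc) ∨ N = ⊤

/-- The class `Γ̂_d`: all composition factors of `G` are isomorphic to a subgroup of `S_d`. -/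
def InGammaHat (d : ℕ) (G : Type*) [Group G] : Prop :=
  ∀ (n : ℕ) (c : Fin (n + 1) → Subgroup G), IsCompositionSeries c →
    ∀ i : Fin n, FactorEmbedsInSym d (c i.castSucc) (c i.succ)

/-- A permutation group `Γ ≤ Sym(Ω)` is transitive: the orbit of some point is all of `Ω`. -/
def IsTransitivePermGroup {Ω : Type*} (Γ : Subgroup (Equiv.Perm Ω)) : Prop :=
  ∃ α : Ω, ∀ β : Ω, ∃ γ ∈ Γ, γ α = β

/-- `B` is a block of `Γ ≤ Sym(Ω)`: every `γ ∈ Γ` maps `B` either to itself or to a set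
disjoint from `B`. -/
def IsBlockOf {Ω : Type*} (Γ : Subgroup (Equiv.Perm Ω)) (B : Set Ω) : Prop :=
  ∀ γ ∈ Γ, (⇑γ) '' B = B ∨ Disjoint ((⇑γ) '' B) B

/-- A permutation group is primitive: it is transitive and all of its blocks are trivial
(the whole domain or singletons; the empty set is excluded by definition of a block). -/
def IsPrimitivePermGroup {Ω : Type*} (Γ : Subgroup (Equiv.Perm Ω)) : Prop :=
  IsTransitivePermGroup Γ ∧
    ∀ B : Set Ω, B.Nonempty → IsBlockOf Γ B → B = Set.univ ∨ ∃ α, B = {α}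

/-- Every nontrivial section `H / K` of `G` has a proper subgroup of index at most `d`. -/
def SectionsHaveSmallIndex (d : ℕ) (G : Type*) [Group G] : Prop :=
  ∀ H K : Subgroup G, K < H → (∀ h ∈ H, ∀ k ∈ K, h * k * h⁻¹ ∈ K) →
    ∃ L : Subgroup G, K ≤ L ∧ L < H ∧ L.relIndex H ≤ d

lemma Subgroup.mem_sup_iff_of_conj_mem {G : Type*} [Group G] {K L : Subgroup G}
    (h : ∀ l ∈ L, ∀ k ∈ K, l * k * l⁻¹ ∈ K) {x : G} :
    x ∈ K ⊔ L ↔ ∃ k ∈ K, ∃ l ∈ L, x = k * l := by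
  constructor
  · intro hx
    let S : Subgroup G :=
      { carrier := {x | ∃ k ∈ K, ∃ l ∈ L, x = k * l}
        one_mem' := ⟨1, K.one_mem, 1, L.one_mem, by simp⟩
        mul_mem' := by
          rintro _ _ ⟨k, hk, l, hl, rfl⟩ ⟨k', hk', l', hl', rfl⟩
          exact ⟨k * (l * k' * l⁻¹), K.mul_mem hk (h l hl k' hk'), l * l', L.mul_mem hl hl',
            by group⟩
        inv_mem' := by
          rintro _ ⟨k, hk, l, hl, rfl⟩
          refine ⟨l⁻¹ * k⁻¹ * l⁻¹⁻¹, h _ (L.inv_mem hl) _ (K.inv_mem hk), l⁻¹, L.inv_mem hl,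
            by group⟩ }
    have hS : K ⊔ L ≤ S := sup_le (fun k hk => ⟨k, hk, 1, L.one_mem, by simp⟩)
      (fun l hl => ⟨1, K.one_mem, l, hl, by simp⟩)
    exact hS hx
  · rintro ⟨k, hk, l, hl, rfl⟩
    exact Subgroup.mul_mem_sup hk hl

lemma Subgroup.relIndex_le_relIndex_of_forall_exists {G : Type*} [Group G] [Finite G]
    {L H L' M : Subgroup G} (hMH : M ≤ H) (hL : L' ⊓ M ≤ L)
    (h : ∀ x ∈ H, ∃ m ∈ M, m⁻¹ * x ∈ L) : L.relIndex H ≤ L'.relIndex M := by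
  rw [Subgroup.relIndex, Subgroup.relIndex, Subgroup.index, Subgroup.index]
  let f : (M ⧸ L'.subgroupOf M) → (H ⧸ L.subgroupOf H) :=
    Quotient.map' (fun m => ⟨m, hMH m.2⟩) (by
      intro a b hab
      rw [QuotientGroup.leftRel_apply, Subgroup.mem_subgroupOf] at hab ⊢
      exact hL ⟨hab, (a⁻¹ * b).2⟩)
  apply Nat.card_le_card_of_surjective f
  intro q
  obtain ⟨x, rfl⟩ := QuotientGroup.mk_surjective q
  obtain ⟨m, hm, hx⟩ := h x x.2
  refine ⟨QuotientGroup.mk ⟨m, hm⟩, ?_⟩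
  apply QuotientGroup.eq.2
  rw [Subgroup.mem_subgroupOf]
  exact hx

lemma Subgroup.exists_index_le_of_ker_le {H : Type*} [Group H] [Finite H] {d : ℕ}
    (f : H →* Equiv.Perm (Fin d)) (K : Subgroup H) [K.Normal] (hK : K ≠ ⊤) (hf : f.ker ≤ K) :
    ∃ L : Subgroup H, K ≤ L ∧ L ≠ ⊤ ∧ L.index ≤ d := by
  let S : ℕ → Subgroup H := fun j =>
    { carrier := {h | ∀ i : Fin d, (i : ℕ) < j → f h i = i}
      one_mem' := by simp
      mul_mem' := by
        intro a b ha hb i hi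
        rw [map_mul, Equiv.Perm.mul_apply, hb i hi, ha i hi]
      inv_mem' := by
        intro a ha i hi
        rw [map_inv, Equiv.Perm.inv_eq_iff_eq, ha i hi] }
  have hmemS : ∀ j h, h ∈ S j ↔ ∀ i : Fin d, (i : ℕ) < j → f h i = i := fun j h => Iff.rfl
  have hex : ∃ j, K ⊔ S j ≠ ⊤ := by
    refine ⟨d, ?_⟩
    have : S d ≤ K := by
      intro h hh
      apply hf
      rw [MonoidHom.mem_ker]
      ext i
      rw [(hmemS d h).1 hh i i.2]; rfl
    rwa [sup_eq_left.2 this]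
  classical
  obtain ⟨j, hj, hmin⟩ : ∃ j, K ⊔ S j ≠ ⊤ ∧ ∀ i < j, K ⊔ S i = ⊤ :=
    ⟨Nat.find hex, Nat.find_spec hex, fun i hi => not_not.1 (Nat.find_min hex hi)⟩
  have hj0 : j ≠ 0 := by
    rintro rfl
    apply hj
    have : S 0 = ⊤ := by
      ext h; simp [hmemS]
    rw [this, sup_top_eq]
  obtain ⟨i, rfl⟩ := Nat.exists_eq_succ_of_ne_zero hj0
  have hi := hmin i (Nat.lt_succ_self i)
  refine ⟨K ⊔ S (i + 1), le_sup_left, hj, ?_⟩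
  have hid : i < d := by
    by_contra hcon
    apply hj
    rw [← hi]
    congr 1
    ext h
    simp only [hmemS]
    exact ⟨fun hh k _ => hh k (by omega), fun hh k _ => hh k (by omega)⟩
  have h1 : (K ⊔ S (i + 1)).relIndex ⊤ ≤ (S (i + 1)).relIndex (S i) := by
    apply Subgroup.relIndex_le_relIndex_of_forall_exists le_top
      (inf_le_left.trans le_sup_right)
    intro x _
    have hx : x⁻¹ ∈ K ⊔ S i := by rw [hi]; trivial
    obtain ⟨k, hk, s, hs, hxks⟩ := (Subgroup.mem_sup_iff_of_conj_mem
      (fun l _ k hk => Subgroup.Normal.conj_mem inferInstance k hk l)).1 hx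
    refine ⟨s⁻¹, (S i).inv_mem hs, ?_⟩
    apply le_sup_left (a := K)
    have : x = s⁻¹ * k⁻¹ := by
      rw [← inv_inv x, hxks]; group
    rw [this]
    have := Subgroup.Normal.conj_mem (H := K) inferInstance k⁻¹ (K.inv_mem hk) 1
    simpa using this
  rw [Subgroup.relIndex_top_right] at h1
  refine h1.trans ?_
  rw [Subgroup.relIndex, Subgroup.index]
  let p : Fin d := ⟨i, hid⟩
  let g : (S i ⧸ (S (i + 1)).subgroupOf (S i)) → Fin d :=
    Quotient.lift (fun s : S i => f s p) (by
      intro a b hab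
      have hab : a⁻¹ * b ∈ (S (i + 1)).subgroupOf (S i) := by
        rw [← QuotientGroup.leftRel_apply]; exact hab
      rw [Subgroup.mem_subgroupOf, hmemS] at hab
      have := hab p (Nat.lt_succ_self i)
      simp only [Subgroup.coe_mul, Subgroup.coe_inv, map_mul, map_inv, Equiv.Perm.mul_apply,
        Equiv.Perm.inv_eq_iff_eq] at this
      exact this.symm)
  have := Nat.card_le_card_of_injective g (by
    intro a b
    obtain ⟨a, rfl⟩ := QuotientGroup.mk_surjective a
    obtain ⟨b, rfl⟩ := QuotientGroup.mk_surjective b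
    intro hab
    have hab : f a p = f b p := hab
    apply QuotientGroup.eq.2
    rw [Subgroup.mem_subgroupOf, hmemS]
    intro k hk
    simp only [Subgroup.coe_mul, Subgroup.coe_inv, map_mul, map_inv, Equiv.Perm.mul_apply,
      Equiv.Perm.inv_eq_iff_eq]
    rcases Nat.lt_succ_iff_lt_or_eq.1 hk with hk | hk
    · rw [(hmemS _ _).1 a.2 k hk, (hmemS _ _).1 b.2 k hk]
    · have : k = p := Fin.ext hk
      rw [this, hab])
  simpa using this

/-- The section property passes from the two ends of a normal series of length two. -/
lemma sections_small_index_extension {G : Type*} [Group G] [Finite G] {d : ℕ} {A B : Subgroup G}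
    (hBA : B ≤ A) (f : A →* Equiv.Perm (Fin d)) (hf : f.ker = B.subgroupOf A)
    (hB : ∀ H K : Subgroup G, H ≤ B → K < H → (∀ h ∈ H, ∀ k ∈ K, h * k * h⁻¹ ∈ K) →
      ∃ L : Subgroup G, K ≤ L ∧ L < H ∧ L.relIndex H ≤ d) :
    ∀ H K : Subgroup G, H ≤ A → K < H → (∀ h ∈ H, ∀ k ∈ K, h * k * h⁻¹ ∈ K) →
      ∃ L : Subgroup G, K ≤ L ∧ L < H ∧ L.relIndex H ≤ d := by
  intro H K hHA hKH hK
  have hconjB : ∀ a ∈ A, ∀ b ∈ B, a * b * a⁻¹ ∈ B := by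
    intro a ha b hb
    have hn : (B.subgroupOf A).Normal := hf ▸ f.normal_ker
    have := hn.conj_mem ⟨b, hBA hb⟩ (by simpa [Subgroup.mem_subgroupOf] using hb) ⟨a, ha⟩
    simpa [Subgroup.mem_subgroupOf] using this
  by_cases hcase : K ⊔ (H ⊓ B) = H
  · have hlt : K ⊓ B < H ⊓ B := by
      refine lt_of_le_of_ne (inf_le_inf_right _ hKH.le) ?_
      intro heq
      apply hKH.ne
      rw [← hcase, ← heq]
      exact (sup_eq_left.2 inf_le_left).symm
    obtain ⟨L, hL1, hL2, hL3⟩ := hB (H ⊓ B) (K ⊓ B) inf_le_right hlt (by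
      intro h hh k hk
      exact ⟨hK h hh.1 k hk.1, hconjB h (hHA hh.1) k hk.2⟩)
    have hconj : ∀ l ∈ L, ∀ k ∈ K, l * k * l⁻¹ ∈ K := fun l hl => hK l (hL2.le hl).1
    refine ⟨K ⊔ L, le_sup_left, lt_of_le_of_ne (sup_le hKH.le (hL2.le.trans inf_le_left)) ?_, ?_⟩
    · intro heq
      apply hL2.not_ge
      intro b hb
      have hb' : b ∈ K ⊔ L := by rw [heq]; exact hb.1
      obtain ⟨k, hk, l, hl, rfl⟩ := (Subgroup.mem_sup_iff_of_conj_mem hconj).1 hb'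
      have : k ∈ K ⊓ B := ⟨hk, by
        have := B.mul_mem hb.2 (B.inv_mem (hL2.le hl).2)
        simpa using this⟩
      exact L.mul_mem (hL1 this) hl
    · refine le_trans ?_ hL3
      apply Subgroup.relIndex_le_relIndex_of_forall_exists inf_le_left
        (inf_le_left.trans le_sup_right)
      intro x hx
      rw [← hcase] at hx
      obtain ⟨k, hk, s, hs, rfl⟩ := (Subgroup.mem_sup_iff_of_conj_mem
        (fun l hl => hK l (show l ∈ H ⊓ B from hl).1)).1 hx
      refine ⟨s, hs, Subgroup.mem_sup_left ?_⟩
      have := hK s⁻¹ (H.inv_mem hs.1) k hk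
      simpa [mul_assoc] using this
  · have hlt : K ⊔ (H ⊓ B) < H := lt_of_le_of_ne (sup_le hKH.le inf_le_left) hcase
    have hn : ((K ⊔ (H ⊓ B)).subgroupOf H).Normal := by
      constructor
      rintro ⟨n, hnH⟩ hn ⟨g, hg⟩
      rw [Subgroup.mem_subgroupOf] at hn ⊢
      have hn : n ∈ K ⊔ (H ⊓ B) := hn
      obtain ⟨k, hk, s, hs, rfl⟩ := (Subgroup.mem_sup_iff_of_conj_mem
        (fun l hl => hK l (show l ∈ H ⊓ B from hl).1)).1 hn
      have : g * (k * s) * g⁻¹ = (g * k * g⁻¹) * (g * s * g⁻¹) := by group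
      change g * (k * s) * g⁻¹ ∈ _
      rw [this]
      exact Subgroup.mul_mem_sup (hK g hg k hk)
        ⟨H.mul_mem (H.mul_mem hg hs.1) (H.inv_mem hg), hconjB g (hHA hg) s hs.2⟩
    obtain ⟨L, hL1, hL2, hL3⟩ := Subgroup.exists_index_le_of_ker_le
      (f.comp (Subgroup.inclusion hHA)) ((K ⊔ (H ⊓ B)).subgroupOf H)
      (fun h => hlt.not_ge (Subgroup.subgroupOf_eq_top.1 h)) (by
        intro x hx
        rw [MonoidHom.mem_ker, MonoidHom.comp_apply, ← MonoidHom.mem_ker, hf,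
          Subgroup.mem_subgroupOf] at hx
        exact Subgroup.mem_sup_right (S := K) ⟨x.2, hx⟩)
    refine ⟨L.map H.subtype, ?_, ?_, ?_⟩
    · intro k hk
      exact ⟨⟨k, hKH.le hk⟩, hL1 (Subgroup.mem_sup_left (T := H ⊓ B) hk), rfl⟩
    · refine lt_of_le_of_ne (Subgroup.map_subtype_le L) ?_
      intro heq
      apply hL2
      rw [eq_top_iff]
      intro x _
      have : (x : G) ∈ L.map H.subtype := by rw [heq]; exact x.2
      simpa using this
    · rw [Subgroup.relIndex, Subgroup.subgroupOf, Subgroup.comap_map_eq_self_of_injective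
        H.subtype_injective]
      exact hL3

lemma exists_compositionSeries_from {G : Type*} [Group G] [Finite G] (A : Subgroup G) :
    ∃ (n : ℕ) (c : Fin (n + 1) → Subgroup G), c 0 = A ∧ c (Fin.last n) = ⊥ ∧
      ∀ i : Fin n,
        c i.succ < c i.castSucc ∧
        ((c i.succ).subgroupOf (c i.castSucc)).Normal ∧
        ∀ N : Subgroup ↥(c i.castSucc), N.Normal →
          (c i.succ).subgroupOf (c i.castSucc) ≤ N →
          N = (c i.succ).subgroupOf (c i.castSucc) ∨ N = ⊤ := by
  induction A using WellFoundedLT.induction with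
  | ind A ih =>
  by_cases hA : A = ⊥
  · exact ⟨0, fun _ => A, rfl, hA, fun i => i.elim0⟩
  · have hfin : {K : Subgroup G | K < A ∧ (K.subgroupOf A).Normal}.Finite := Set.toFinite _
    have hne : {K : Subgroup G | K < A ∧ (K.subgroupOf A).Normal}.Nonempty :=
      ⟨⊥, bot_lt_iff_ne_bot.2 hA, by rw [Subgroup.bot_subgroupOf]; infer_instance⟩
    obtain ⟨K, ⟨hKA, hKn⟩, hKmax⟩ := hfin.exists_maximal hne
    obtain ⟨n, c, hc0, hcl, hc⟩ := ih K hKA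
    refine ⟨n + 1, Fin.cons A c, by simp, ?_, ?_⟩
    · rw [← Fin.succ_last, Fin.cons_succ, hcl]
    · intro i
      refine Fin.cases ?_ (fun i => ?_) i
      · have h0 : (Fin.cons A c : Fin (n + 1 + 1) → Subgroup G) (Fin.castSucc 0) = A := rfl
        have h1 : (Fin.cons A c : Fin (n + 1 + 1) → Subgroup G) (Fin.succ 0) = K := by
          rw [Fin.cons_succ, hc0]
        rw [h0, h1]
        refine ⟨hKA, hKn, ?_⟩
        intro N hN hle
        by_cases hNt : N = ⊤
        · exact Or.inr hNt
        left
        have hNA : N.map A.subtype < A := by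
          refine lt_of_le_of_ne (Subgroup.map_subtype_le N) ?_
          intro heq
          apply hNt
          rw [eq_top_iff]
          intro x _
          have : (x : G) ∈ N.map A.subtype := by rw [heq]; exact x.2
          simpa using this
        have hsub : (N.map A.subtype).subgroupOf A = N := by
          rw [Subgroup.subgroupOf, Subgroup.comap_map_eq_self_of_injective A.subtype_injective]
        have hKN : K ≤ N.map A.subtype := by
          intro k hk
          exact ⟨⟨k, hKA.le hk⟩, hle hk, rfl⟩
        have := hKmax ⟨hNA, by rw [hsub]; exact hN⟩ hKN
        rw [← le_antisymm this hKN, hsub]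
      · exact hc i

theorem InGammaHat.sectionsHaveSmallIndex {G : Type*} [Group G] [Finite G] {d : ℕ}
    (h : InGammaHat d G) : SectionsHaveSmallIndex d G := by
  obtain ⟨n, c, hc0, hcl, hc⟩ := exists_compositionSeries_from (⊤ : Subgroup G)
  have hfac := h n c ⟨hc0, hcl, hc⟩
  have key : ∀ i : Fin (n + 1), ∀ H K : Subgroup G, H ≤ c i → K < H →
      (∀ h ∈ H, ∀ k ∈ K, h * k * h⁻¹ ∈ K) →
      ∃ L : Subgroup G, K ≤ L ∧ L < H ∧ L.relIndex H ≤ d := by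
    intro i
    induction i using Fin.reverseInduction with
    | last =>
      intro H K hH hK
      rw [hcl, le_bot_iff] at hH
      exact absurd (hH ▸ hK) not_lt_bot
    | cast i ih =>
      obtain ⟨f, hf⟩ := hfac i
      exact sections_small_index_extension (hc i).1.le f hf ih
  intro H K hK hn
  exact key 0 H K (by rw [hc0]; exact le_top) hK hn

namespace SectionsHaveSmallIndex

variable {G G' : Type*} [Group G] [Group G'] {d : ℕ}

lemma of_injective (h : SectionsHaveSmallIndex d G') (f : G →* G') (hf : Function.Injective f) :
    SectionsHaveSmallIndex d G := by
  intro H K hKH hK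
  obtain ⟨L, hL1, hL2, hL3⟩ := h (H.map f) (K.map f)
    ((Subgroup.map_lt_map_iff_of_injective hf).2 hKH) (by
      rintro _ ⟨h, hh, rfl⟩ _ ⟨k, hk, rfl⟩
      exact ⟨h * k * h⁻¹, hK h hh k hk, by simp⟩)
  have hL : (L.comap f).map f = L := by
    rw [Subgroup.map_comap_eq, inf_eq_right]
    exact hL2.le.trans (Subgroup.map_le_range f H)
  refine ⟨L.comap f, Subgroup.map_le_iff_le_comap.1 hL1, ?_, ?_⟩
  · rw [← Subgroup.map_lt_map_iff_of_injective hf, hL]; exact hL2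
  · rw [Subgroup.relIndex_comap]; exact hL3

lemma of_surjective (h : SectionsHaveSmallIndex d G) (f : G →* G') (hf : Function.Surjective f) :
    SectionsHaveSmallIndex d G' := by
  intro H K hKH hK
  obtain ⟨L, hL1, hL2, hL3⟩ := h (H.comap f) (K.comap f)
    ((Subgroup.comap_lt_comap_of_surjective hf).2 hKH) (by
      intro h hh k hk
      rw [Subgroup.mem_comap] at *
      simpa using hK _ hh _ hk)
  have hker : f.ker ≤ L := le_trans (by
    intro x hx
    rw [Subgroup.mem_comap, (MonoidHom.mem_ker).1 hx]; exact K.one_mem) hL1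
  have hL : (L.map f).comap f = L := by
    rw [Subgroup.comap_map_eq, sup_eq_left]; exact hker
  refine ⟨L.map f, ?_, ?_, ?_⟩
  · rw [← Subgroup.comap_le_comap_of_surjective hf, hL]; exact hL1
  · rw [← Subgroup.comap_lt_comap_of_surjective hf, hL]; exact hL2
  · rw [← hL, Subgroup.relIndex_comap, Subgroup.map_comap_eq_self_of_surjective hf] at hL3
    exact hL3

lemma exists_index_le (h : SectionsHaveSmallIndex d G) [Nontrivial G] :
    ∃ L : Subgroup G, L ≠ ⊤ ∧ L.index ≤ d := by
  obtain ⟨L, -, hL2, hL3⟩ := h ⊤ ⊥ bot_lt_top (by simp)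
  exact ⟨L, hL2.ne, by rwa [Subgroup.relIndex_top_right] at hL3⟩

lemma prime_le [Finite G] (h : SectionsHaveSmallIndex d G) {p : ℕ} (hp : p.Prime)
    (hdvd : p ∣ Nat.card G) : p ≤ d := by
  have := Fact.mk hp
  obtain ⟨x, hx⟩ := exists_prime_orderOf_dvd_card' p hdvd
  have hne : x ≠ 1 := by
    rintro rfl
    rw [orderOf_one] at hx
    exact hp.one_lt.ne hx
  obtain ⟨L, -, hL2, hL3⟩ := h (Subgroup.zpowers x) ⊥
    (bot_lt_iff_ne_bot.2 (by rwa [Ne, Subgroup.zpowers_eq_bot])) (by simp)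
  have h1 : L.relIndex (Subgroup.zpowers x) ∣ p := by
    have := Subgroup.relIndex_dvd_card L (Subgroup.zpowers x)
    rwa [Nat.card_zpowers, hx] at this
  rcases (Nat.dvd_prime hp).1 h1 with h2 | h2
  · exact absurd (Subgroup.relIndex_eq_one.1 h2) hL2.not_ge
  · omega

end SectionsHaveSmallIndex

/-- The order of a group acting on `m` points, all of whose prime divisors are at most `d`. -/
lemma card_le_of_dvd_factorial {n m d : ℕ} (hm : 1 ≤ m) (h : n ∣ m.factorial)
    (hp : ∀ p, p.Prime → p ∣ n → p ≤ d) : n ≤ 2 ^ (d * (m - 1)) := by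
  have hn : n ≠ 0 := ne_zero_of_dvd_ne_zero (Nat.factorial_ne_zero m) h
  have hprod : n = ∏ p ∈ n.primeFactors, p ^ n.factorization p :=
    (Nat.prod_factorization_pow_eq_self hn).symm
  have hle : ∀ p ∈ n.primeFactors, p ^ n.factorization p ≤ 2 ^ (m - 1) := by
    intro p hpn
    have hpp := Nat.prime_of_mem_primeFactors hpn
    have := Fact.mk hpp
    have h1 : n.factorization p ≤ padicValNat p m.factorial := by
      rw [← Nat.factorization_def _ hpp]
      exact (Nat.factorization_le_iff_dvd hn (Nat.factorial_ne_zero m)).2 h p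
    have h2 : (p - 1) * padicValNat p m.factorial ≤ m - 1 := by
      rw [sub_one_mul_padicValNat_factorial]
      have : 1 ≤ (p.digits m).sum := by
        by_contra hcon
        have h0 : (p.digits m).sum = 0 := by omega
        have h3 := Nat.getLast_digit_ne_zero p (show m ≠ 0 by omega)
        exact h3 (List.sum_eq_zero_iff.1 h0 _ (List.getLast_mem _))
      omega
    have h5 : p ≤ 2 ^ (p - 1) := by
      have := Nat.lt_two_pow_self (n := p - 1)
      omega
    calc p ^ n.factorization p ≤ p ^ padicValNat p m.factorial :=
          Nat.pow_le_pow_right hpp.pos h1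
      _ ≤ (2 ^ (p - 1)) ^ padicValNat p m.factorial := Nat.pow_le_pow_left h5 _
      _ = 2 ^ ((p - 1) * padicValNat p m.factorial) := by rw [pow_mul]
      _ ≤ 2 ^ (m - 1) := Nat.pow_le_pow_right two_pos h2
  have hcard : n.primeFactors.card ≤ d := by
    have : n.primeFactors ⊆ Finset.Icc 1 d := by
      intro p hpn
      have hpp := Nat.prime_of_mem_primeFactors hpn
      exact Finset.mem_Icc.2 ⟨hpp.one_le, hp p hpp (Nat.dvd_of_mem_primeFactors hpn)⟩
    simpa using Finset.card_le_card this
  calc n = ∏ p ∈ n.primeFactors, p ^ n.factorization p := hprod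
    _ ≤ ∏ p ∈ n.primeFactors, 2 ^ (m - 1) := Finset.prod_le_prod' hle
    _ = 2 ^ ((m - 1) * n.primeFactors.card) := by rw [Finset.prod_const, ← pow_mul]
    _ ≤ 2 ^ (d * (m - 1)) := Nat.pow_le_pow_right two_pos (by
      rw [mul_comm]; exact Nat.mul_le_mul_right _ hcard)

lemma SectionsHaveSmallIndex.card_range_perm_le {G X : Type*} [Group G] [Finite G] [Finite X]
    [Nonempty X] {d : ℕ} (h : SectionsHaveSmallIndex d G) (f : G →* Equiv.Perm X) :
    Nat.card f.range ≤ 2 ^ (d * (Nat.card X - 1)) := by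
  apply card_le_of_dvd_factorial Nat.card_pos
  · rw [← Nat.card_perm]
    exact Subgroup.card_subgroup_dvd_card _
  · intro p hp hdvd
    exact (h.of_surjective f.rangeRestrict f.rangeRestrict_surjective).prime_le hp hdvd

lemma Subgroup.card_le_factorial_of_normalCore_eq_bot {T : Type*} [Group T] [Finite T]
    (K : Subgroup T) (hK : K.normalCore = ⊥) : Nat.card T ∣ K.index.factorial := by
  have hinj : Function.Injective (MulAction.toPermHom T (T ⧸ K)) := by
    rw [← MonoidHom.ker_eq_bot_iff, ← Subgroup.normalCore_eq_ker, hK]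
  rw [Subgroup.index, ← Nat.card_perm]
  exact Subgroup.card_dvd_of_injective _ hinj

lemma Subgroup.normalCore_eq_bot_of_ne_top {T : Type*} [Group T] [IsSimpleGroup T]
    {K : Subgroup T} (hK : K ≠ ⊤) : K.normalCore = ⊥ := by
  rcases IsSimpleGroup.eq_bot_or_eq_top_of_normal K.normalCore inferInstance with h | h
  · exact h
  · exact absurd (top_le_iff.1 (h ▸ K.normalCore_le)) hK

open Pointwise in
/-- The stabilizer of a core-free subgroup in the automorphism group acts faithfully on cosets. -/
lemma card_stabilizer_mulAut_le {T : Type*} [Group T] [Finite T] (K : Subgroup T)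
    (hK : K.normalCore = ⊥) :
    Nat.card (MulAction.stabilizer (MulAut T) K) ≤ K.index.factorial := by
  have hst : ∀ σ ∈ MulAction.stabilizer (MulAut T) K, ∀ t, σ t ∈ K ↔ t ∈ K := by
    intro σ hσ t
    have hσ : σ • K = K := hσ
    constructor
    · intro h
      rw [← hσ] at h
      obtain ⟨k, hk, hkt⟩ := h
      have : k = t := σ.injective hkt
      rwa [← this]
    · intro h
      rw [← hσ]
      exact ⟨t, h, rfl⟩
  let f : MulAction.stabilizer (MulAut T) K → ((T ⧸ K) → (T ⧸ K)) := fun σ =>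
    Quotient.map' (fun t => σ.1 t) (by
      intro a b hab
      rw [QuotientGroup.leftRel_apply] at hab ⊢
      rw [← map_inv, ← map_mul]
      exact (hst _ σ.2 _).2 hab)
  have hf : ∀ σ t, f σ (QuotientGroup.mk t) = QuotientGroup.mk (σ.1 t) := fun _ _ => rfl
  have hbij : ∀ σ, Function.Bijective (f σ) := by
    intro σ
    rw [← Finite.surjective_iff_bijective]
    intro q
    obtain ⟨t, rfl⟩ := QuotientGroup.mk_surjective q
    exact ⟨QuotientGroup.mk (σ.1.symm t), by rw [hf]; simp⟩
  rw [Subgroup.index, ← Nat.card_perm]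
  apply Nat.card_le_card_of_injective
    (fun σ => Equiv.ofBijective (f σ) (hbij σ) : _ → Equiv.Perm (T ⧸ K))
  intro σ τ hστ
  have hfe : ∀ t, (QuotientGroup.mk (σ.1 t) : T ⧸ K) = QuotientGroup.mk (τ.1 t) := by
    intro t
    rw [← hf, ← hf]
    exact congrFun (congrArg (fun e : Equiv.Perm (T ⧸ K) => (e : T ⧸ K → T ⧸ K)) hστ)
      (QuotientGroup.mk t)
  apply Subtype.ext
  ext t
  have hmem : (σ.1 t)⁻¹ * τ.1 t ∈ K.normalCore := by
    intro g
    obtain ⟨s, hs⟩ := σ.1.surjective g⁻¹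
    have h1 := QuotientGroup.eq.1 (hfe (t * s))
    have h2 := QuotientGroup.eq.1 (hfe s)
    have h3 := K.mul_mem h1 (K.inv_mem h2)
    rw [map_mul, map_mul, hs] at h3
    have h4 : ((σ.1 t) * g⁻¹)⁻¹ * (τ.1 t * τ.1 s) * (g⁻¹⁻¹ * τ.1 s)⁻¹ =
        g * ((σ.1 t)⁻¹ * τ.1 t) * g⁻¹ := by group
    rwa [h4] at h3
  rw [hK, Subgroup.mem_bot, inv_mul_eq_one] at hmem
  exact hmem

lemma card_le_finrank_of_iSupIndep {F A V ι : Type*} [Field F] [Ring A] [Algebra F A]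
    [AddCommGroup V] [Module F V] [Module A V] [IsScalarTower F A V] [Module.Finite F V]
    [Finite ι] (p : ι → Submodule A V) (hp : iSupIndep p) (hne : ∀ i, p i ≠ ⊥) :
    Nat.card ι ≤ Module.finrank F V := by
  have := Fintype.ofFinite ι
  choose v hv hv0 using fun i => Submodule.exists_mem_ne_zero_of_ne_bot (hne i)
  have hli : LinearIndependent F v := by
    rw [linearIndependent_iff']
    intro s g hg i hi
    rw [iSupIndep_iff_finsetSum_eq_zero_imp_eq_zero] at hp
    have := hp s (fun i => g i • v i) (fun i _ => by
      show g i • v i ∈ p i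
      rw [← algebraMap_smul A (g i) (v i)]
      exact (p i).smul_mem _ (hv i)) hg i hi
    exact (smul_eq_zero.1 this).resolve_right (hv0 i)
  rw [Nat.card_eq_fintype_card]
  exact hli.fintype_card_le_finrank

lemma Module.exists_simple_projection {R M : Type*} [Ring R] [AddCommGroup M] [Module R M]
    [IsSemisimpleModule R M] {y : M} (hy : y ≠ 0) :
    ∃ S : Submodule R M, IsSimpleModule R S ∧ ∃ π : M →ₗ[R] S, π y ≠ 0 := by
  have hj := IsSemisimpleModule.jacobson_eq_bot R M
  have hy' : y ∉ Module.jacobson R M := by rw [hj]; simpa using hy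
  rw [Module.jacobson, Submodule.mem_sInf] at hy'
  push Not at hy'
  obtain ⟨M', hM', hyM⟩ := hy'
  obtain ⟨S, hS⟩ := exists_isCompl M'
  refine ⟨S, isSimpleModule_iff_isAtom.2 (hS.symm.isAtom_iff_isCoatom.2 hM'),
    Submodule.projectionOnto S M' hS.symm, ?_⟩
  rw [Ne, Submodule.projectionOnto_apply_eq_zero_iff]
  exact hyM

lemma simple_card_mulAut_le_aux {T : Type*} [Group T] [Finite T] {ℓ e : ℕ} [Fact ℓ.Prime]
    (hl : ¬ ℓ ∣ Nat.card T) (H : Subgroup T) (hH : H ≠ ⊤) (he : H.index = e) :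
    ∃ (S : Submodule (MonoidAlgebra (ZMod ℓ) T) (MonoidAlgebra (ZMod ℓ) T)) (v : S),
      IsSimpleModule (MonoidAlgebra (ZMod ℓ) T) S ∧ Nat.card S ≤ ℓ ^ e ∧
      (∀ t ∈ H, MonoidAlgebra.of (ZMod ℓ) T t • v = v) ∧
      ∃ t, MonoidAlgebra.of (ZMod ℓ) T t • v ≠ v := by
  have : NeZero (Nat.card T : ZMod ℓ) := ⟨by rwa [Ne, ZMod.natCast_eq_zero_iff]⟩
  have := Fintype.ofFinite T
  classical
  let R := MonoidAlgebra (ZMod ℓ) T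
  let ε : R := ∑ h : H, MonoidAlgebra.of (ZMod ℓ) T h
  have hε : ∀ t ∈ H, MonoidAlgebra.of (ZMod ℓ) T t * ε = ε := by
    intro t ht
    simp only [ε]
    rw [Finset.mul_sum]
    refine Fintype.sum_equiv (Equiv.mulLeft (⟨t, ht⟩ : H)) _ _ ?_
    intro x
    simp
  obtain ⟨t, ht⟩ : ∃ t, t ∉ H := by
    by_contra! hcon
    exact hH ((Subgroup.eq_top_iff' H).2 hcon)
  have hy : MonoidAlgebra.of (ZMod ℓ) T t * ε - ε ≠ 0 := by
    intro h0
    have h1 : (MonoidAlgebra.of (ZMod ℓ) T t * ε).coeff t = ε.coeff t := by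
      rw [sub_eq_zero.1 h0]
    have h2 : (MonoidAlgebra.of (ZMod ℓ) T t * ε).coeff t = 1 := by
      simp only [ε]
      rw [Finset.mul_sum, MonoidAlgebra.coeff_sum, Finsupp.finsetSum_apply,
        Finset.sum_eq_single (1 : H)]
      · simp [MonoidAlgebra.of_apply]
      · intro h _ hne
        rw [← map_mul, MonoidAlgebra.of_apply, MonoidAlgebra.coeff_single, Finsupp.single_apply, if_neg]
        intro h3
        exact hne (Subtype.ext (by simpa using h3))
      · simp
    have h3 : ε.coeff t = 0 := by
      simp only [ε]
      rw [MonoidAlgebra.coeff_sum, Finsupp.finsetSum_apply]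
      apply Finset.sum_eq_zero
      intro h _
      rw [MonoidAlgebra.of_apply, MonoidAlgebra.coeff_single, Finsupp.single_apply, if_neg]
      rintro rfl
      exact ht h.2
    rw [h2, h3] at h1
    exact one_ne_zero h1
  obtain ⟨S, hS, π, hπ⟩ := Module.exists_simple_projection (R := R) hy
  refine ⟨S, π ε, hS, ?_, ?_, t, ?_⟩
  · let φ : ((T ⧸ H) → ZMod ℓ) → S := fun a => ∑ q, MonoidAlgebra.single q.out (a q) • π ε
    have hv : π ε ≠ 0 := by
      intro h0
      apply hπ
      rw [map_sub, ← smul_eq_mul, map_smul, h0, smul_zero, sub_zero]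
    have hφ : Function.Surjective φ := by
      intro s
      obtain ⟨r, rfl⟩ := IsSimpleModule.toSpanSingleton_surjective R hv s
      rw [LinearMap.toSpanSingleton_apply]
      induction r using MonoidAlgebra.induction_linear with
      | zero => exact ⟨0, by simp [φ]⟩
      | add x y hx hy =>
        obtain ⟨a, ha⟩ := hx
        obtain ⟨b, hb⟩ := hy
        refine ⟨a + b, ?_⟩
        rw [add_smul, ← ha, ← hb]
        simp only [φ]
        rw [← Finset.sum_add_distrib]
        refine Finset.sum_congr rfl fun q _ => ?_
        rw [Pi.add_apply, MonoidAlgebra.single_add, add_smul]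
      | single t a =>
        refine ⟨Pi.single (QuotientGroup.mk t) a, ?_⟩
        simp only [φ]
        rw [Finset.sum_eq_single (QuotientGroup.mk t : T ⧸ H)]
        · rw [Pi.single_eq_same]
          have h1 : t⁻¹ * (QuotientGroup.mk t : T ⧸ H).out ∈ H := by
            rw [← QuotientGroup.eq, QuotientGroup.out_eq']
          have h2 : MonoidAlgebra.single (QuotientGroup.mk t : T ⧸ H).out a =
              MonoidAlgebra.single t a *
                MonoidAlgebra.of (ZMod ℓ) T (t⁻¹ * (QuotientGroup.mk t : T ⧸ H).out) := by
            rw [MonoidAlgebra.of_apply, MonoidAlgebra.single_mul_single, mul_one,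
              mul_inv_cancel_left]
          rw [h2, mul_smul, ← map_smul, smul_eq_mul, hε _ h1]
        · intro q _ hq
          rw [Pi.single_eq_of_ne hq, MonoidAlgebra.single_zero, zero_smul]
        · simp
    have := Nat.card_le_card_of_surjective φ hφ
    rwa [Nat.card_fun, Nat.card_zmod, ← Subgroup.index, he] at this
  · intro s hs
    rw [← map_smul, smul_eq_mul, hε s hs]
  · rw [map_sub, ← smul_eq_mul, map_smul, sub_ne_zero] at hπ
    exact hπ

open Pointwise in
lemma simple_card_mulAut_le {T : Type*} [Group T] [Finite T] [IsSimpleGroup T] {e : ℕ}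
    (H : Subgroup T) (hH : H ≠ ⊤) (he : H.index = e) : Nat.card (MulAut T) ≤ e ^ (4 * e) := by
  have he0 : e ≠ 0 := by
    rw [← he]; exact Subgroup.index_ne_zero_of_finite
  have he1 : e ≠ 1 := by
    rw [← he, Ne, Subgroup.index_eq_one]; exact hH
  obtain ⟨ℓ, hℓ, hℓ1, hℓ2⟩ := Nat.exists_prime_lt_and_le_two_mul e he0
  have := Fact.mk hℓ
  have hTdvd : Nat.card T ∣ e.factorial :=
    he ▸ H.card_le_factorial_of_normalCore_eq_bot (Subgroup.normalCore_eq_bot_of_ne_top hH)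
  have hl : ¬ ℓ ∣ Nat.card T := fun h => by
    have := (hℓ.dvd_factorial).1 (h.trans hTdvd)
    omega
  have : NeZero (Nat.card T : ZMod ℓ) := ⟨by rwa [Ne, ZMod.natCast_eq_zero_iff]⟩
  have := Fintype.ofFinite T
  classical
  let R := MonoidAlgebra (ZMod ℓ) T
  have : Finite R := Finite.of_equiv _ (MonoidAlgebra.coeffEquiv (R := ZMod ℓ) (M := T)).symm
  obtain ⟨S, v, hS, hScard, hv, t, ht⟩ := simple_card_mulAut_le_aux hl H hH he
  let stab : R → Subgroup T := fun w =>
    { carrier := {t | MonoidAlgebra.of (ZMod ℓ) T t * w = w}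
      one_mem' := by
        show _ * _ = _
        rw [map_one, one_mul]
      mul_mem' := by
        intro a b ha hb
        show _ * _ = _
        rw [map_mul, mul_assoc, show _ * w = w from hb, show _ * w = w from ha]
      inv_mem' := by
        intro a ha
        have ha : MonoidAlgebra.of (ZMod ℓ) T a * w = w := ha
        show _ * _ = _
        conv_lhs => rw [← ha]
        rw [← mul_assoc, ← map_mul, inv_mul_cancel, map_one, one_mul] }
  have hstab : ∀ w t, t ∈ stab w ↔ MonoidAlgebra.of (ZMod ℓ) T t * w = w := fun _ _ => Iff.rfl
  set K := stab v.1 with hK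
  have hHK : H ≤ K := fun h hh => (hstab _ _).2 (congrArg Subtype.val (hv h hh))
  have hKt : K ≠ ⊤ := by
    intro h
    apply ht
    have : t ∈ K := by rw [h]; trivial
    exact Subtype.ext ((hstab _ _).1 this)
  have hKe : K.index ≤ e := by
    rw [← he]
    exact Nat.le_of_dvd (Nat.pos_of_ne_zero (he ▸ he0)) (Subgroup.index_dvd_of_le hHK)
  -- the isotypic components that contain a small simple submodule
  let C : Set (Submodule R R) := {c | ∃ S : Submodule R R, IsSimpleModule R S ∧
    Nat.card S ≤ ℓ ^ e ∧ c = isotypicComponent R R S}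
  have hC : C ⊆ isotypicComponents R R := by
    rintro _ ⟨S, hS, -, rfl⟩
    exact ⟨S, hS, rfl⟩
  choose rep hrep1 hrep2 hrep3 using fun c : C => c.2
  have hCcard : Nat.card C ≤ Nat.card T := by
    have hind : iSupIndep (fun c : C => (c : Submodule R R)) :=
      ((sSupIndep_iff _).1 ((sSupIndep_isotypicComponents R R).mono hC))
    have := card_le_finrank_of_iSupIndep (F := ZMod ℓ) _ hind
      (fun c => (bot_lt_isotypicComponents (hC c.2)).ne')
    refine this.trans (le_of_eq ?_)
    rw [(MonoidAlgebra.coeffLinearEquiv (ZMod ℓ)).finrank_eq, Module.finrank_finsupp_self,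
      Nat.card_eq_fintype_card]
  have horb : Nat.card (MulAction.orbit (MulAut T) K) ≤ Nat.card T * ℓ ^ e := by
    let g : (Σ c : C, rep c) → Subgroup T := fun x => stab x.2.1
    have hsub : MulAction.orbit (MulAut T) K ⊆ Set.range g := by
      rintro _ ⟨σ, rfl⟩
      let E : R ≃+* R := MonoidAlgebra.mapDomainRingEquiv (ZMod ℓ) (σ : T ≃* T)
      have hE : ∀ t, E (MonoidAlgebra.of (ZMod ℓ) T t) = MonoidAlgebra.of (ZMod ℓ) T (σ t) := by
        intro t
        exact MonoidAlgebra.mapDomainRingEquiv_single _ _ _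
      have := RingHomInvPair.of_ringEquiv E
      have := RingHomInvPair.symm (E : R →+* R) (E.symm : R →+* R)
      let S' : Submodule R R := Submodule.orderIsoMapComap E.toSemilinearEquiv S
      have hS' : IsSimpleModule R S' :=
        isSimpleModule_iff_isAtom.2 ((OrderIso.isAtom_iff _ _).2 (isSimpleModule_iff_isAtom.1 hS))
      have hmem : ∀ x, x ∈ S' ↔ ∃ y ∈ S, E y = x := fun x => Iff.rfl
      have hcard : Nat.card S' ≤ ℓ ^ e := by
        refine le_trans (Nat.card_le_card_of_surjective
          (fun y : S => (⟨E y, (hmem _).2 ⟨y, y.2, rfl⟩⟩ : S')) ?_) hScard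
        rintro ⟨x, hx⟩
        obtain ⟨y, hy, rfl⟩ := (hmem x).1 hx
        exact ⟨⟨y, hy⟩, rfl⟩
      let c : C := ⟨isotypicComponent R R S', S', hS', hcard, rfl⟩
      have := hrep1 c
      have hle : S' ≤ isotypicComponent R R (rep c) := by
        rw [← hrep3 c]
        exact S'.le_isotypicComponent
      obtain ⟨φ⟩ := isIsotypicOfType_submodule_iff.1
        (IsIsotypicOfType.isotypicComponent R R (rep c)) _ hle
      let u : S' := ⟨E v, (hmem _).2 ⟨v, v.2, rfl⟩⟩
      refine ⟨⟨c, φ u⟩, ?_⟩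
      have h1 : ∀ t, t ∈ stab (φ u).1 ↔ σ⁻¹ t ∈ K := by
        intro t
        have h2 : MonoidAlgebra.of (ZMod ℓ) T t * (φ u).1 = (φ u).1 ↔
            MonoidAlgebra.of (ZMod ℓ) T t • u = u := by
          rw [← φ.injective.eq_iff, map_smul, Subtype.ext_iff]
          rfl
        rw [hstab, hK, hstab, h2, ← E.injective.eq_iff, map_mul, hE, Subtype.ext_iff]
        have : σ (σ⁻¹ t) = t := σ.apply_symm_apply t
        rw [this]
        rfl
      ext t
      rw [Subgroup.mem_pointwise_smul_iff_inv_smul_mem]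
      exact h1 t
    have hfin : Finite (Σ c : C, rep c) := inferInstance
    calc Nat.card (MulAction.orbit (MulAut T) K) ≤ Nat.card (Set.range g) :=
          Nat.card_mono (Set.toFinite _) hsub
      _ ≤ Nat.card (Σ c : C, rep c) := Finite.card_range_le g
      _ = ∑ᶠ c : C, Nat.card (rep c) := by
          have := Fintype.ofFinite C
          rw [Nat.card_sigma, finsum_eq_sum_of_fintype]
      _ ≤ Nat.card C * ℓ ^ e := by
          have := Fintype.ofFinite C
          rw [finsum_eq_sum_of_fintype, Nat.card_eq_fintype_card (α := C), ← smul_eq_mul]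
          exact Finset.sum_le_card_nsmul _ _ _ fun c _ => hrep2 c
      _ ≤ _ := Nat.mul_le_mul_right _ hCcard
  have hst := card_stabilizer_mulAut_le K (Subgroup.normalCore_eq_bot_of_ne_top hKt)
  have hmul : Nat.card (MulAut T) = Nat.card (MulAction.orbit (MulAut T) K) *
      Nat.card (MulAction.stabilizer (MulAut T) K) := by
    have := Fintype.ofFinite (MulAut T)
    simp only [Nat.card_eq_fintype_card]
    exact (MulAction.card_orbit_mul_card_stabilizer_eq_card_group _ _).symm
  have hf : e.factorial ≤ e ^ e := Nat.factorial_le_pow e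
  calc Nat.card (MulAut T) ≤ (Nat.card T * ℓ ^ e) * K.index.factorial := by
        rw [hmul]; exact Nat.mul_le_mul horb hst
    _ ≤ (e ^ e * (2 * e) ^ e) * e ^ e := by
        gcongr
        · exact (Nat.le_of_dvd (Nat.factorial_pos e) hTdvd).trans hf
        · exact (Nat.factorial_le hKe).trans hf
    _ ≤ (e ^ e * (e * e) ^ e) * e ^ e := by
        gcongr
        omega
    _ = e ^ (4 * e) := by
        rw [mul_pow]; ring

section SimpleDecomposition

open scoped Pointwise

lemma Subgroup.mem_toConjAct_smul_iff {G : Type*} [Group G] {g x : G} {T : Subgroup G} :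
    x ∈ (ConjAct.toConjAct g • T) ↔ g⁻¹ * x * g ∈ T := by
  rw [Subgroup.mem_pointwise_smul_iff_inv_smul_mem, ← ConjAct.toConjAct_inv,
    ConjAct.toConjAct_smul, inv_inv]

/-- A family of pairwise commuting nonabelian simple subgroups, permuted transitively by
conjugation, that generates `N`. -/
structure IsSimpleDecomposition {G : Type*} [Group G] (N : Subgroup G) (𝒯 : Set (Subgroup G)) :
    Prop where
  nonempty : 𝒯.Nonempty
  le : ∀ T ∈ 𝒯, T ≤ N
  conj_mem : ∀ T ∈ 𝒯, ∀ g : G, (ConjAct.toConjAct g • T) ∈ 𝒯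
  exists_conj : ∀ T ∈ 𝒯, ∀ T' ∈ 𝒯, ∃ g : G, T' = (ConjAct.toConjAct g • T)
  commute : ∀ T ∈ 𝒯, ∀ T' ∈ 𝒯, T ≠ T' → ∀ x ∈ T, ∀ y ∈ T', x * y = y * x
  sSup_eq : sSup 𝒯 = N
  isSimpleGroup : ∀ T ∈ 𝒯, IsSimpleGroup T
  nonabelian : ∀ T ∈ 𝒯, ∃ x ∈ T, ∃ y ∈ T, x * y ≠ y * x

lemma exists_isSimpleDecomposition {G : Type*} [Group G] [Finite G] (N : Subgroup G) [N.Normal]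
    (hmin : ∀ K : Subgroup G, K.Normal → K ≤ N → K ≠ ⊥ → K = N)
    (hab : ∃ x ∈ N, ∃ y ∈ N, x * y ≠ y * x) :
    ∃ 𝒯 : Set (Subgroup G), IsSimpleDecomposition N 𝒯 := by
  have hNbot : N ≠ ⊥ := by
    rintro rfl
    obtain ⟨x, hx, y, hy, h⟩ := hab
    rw [Subgroup.mem_bot] at hx hy
    exact h (by rw [hx, hy])
  let P : Set (Subgroup G) := {T | T ≠ ⊥ ∧ T ≤ N ∧ N ≤ Subgroup.normalizer (T : Set G)}
  have hNP : N ∈ P := ⟨hNbot, le_rfl, Subgroup.le_normalizer⟩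
  obtain ⟨T, hT⟩ := (Set.toFinite P).exists_minimal ⟨N, hNP⟩
  have hPconj : ∀ S ∈ P, ∀ g : G, ConjAct.toConjAct g • S ∈ P := by
    rintro S ⟨h1, h2, h3⟩ g
    refine ⟨?_, ?_, ?_⟩
    · intro h
      apply h1
      rw [eq_bot_iff]
      intro x hx
      have : g * x * g⁻¹ ∈ ConjAct.toConjAct g • S :=
        Subgroup.mem_toConjAct_smul_iff.2 (by simpa [mul_assoc] using hx)
      rw [h, Subgroup.mem_bot] at this
      rw [Subgroup.mem_bot]
      simpa using this
    · intro x hx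
      have := h2 (Subgroup.mem_toConjAct_smul_iff.1 hx)
      have := ‹N.Normal›.conj_mem _ this g
      simpa [mul_assoc] using this
    · rw [Subgroup.le_normalizer_iff] at h3 ⊢
      intro n hn x hx
      rw [Subgroup.mem_toConjAct_smul_iff] at hx ⊢
      have := h3 (g⁻¹ * n * g) (by simpa using ‹N.Normal›.conj_mem n hn g⁻¹) _ hx
      simpa [mul_assoc] using this
  have hminconj : ∀ g : G, ∀ S ∈ P, S ≤ ConjAct.toConjAct g • T → S = ConjAct.toConjAct g • T := by
    intro g S hS hle
    have h1 : ConjAct.toConjAct g⁻¹ • S ≤ T := by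
      intro x hx
      rw [Subgroup.mem_toConjAct_smul_iff] at hx
      have := Subgroup.mem_toConjAct_smul_iff.1 (hle hx)
      simpa [mul_assoc] using this
    have h2 := hT.2 (hPconj S hS g⁻¹) h1
    apply le_antisymm hle
    intro x hx
    rw [Subgroup.mem_toConjAct_smul_iff] at hx
    have := Subgroup.mem_toConjAct_smul_iff.1 (h2 hx)
    simpa [mul_assoc] using this
  let 𝒯 : Set (Subgroup G) := {S | ∃ g : G, S = ConjAct.toConjAct g • T}
  have hTT : T ∈ 𝒯 := ⟨1, by simp⟩
  have h𝒯P : ∀ S ∈ 𝒯, S ∈ P := by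
    rintro _ ⟨g, rfl⟩
    exact hPconj T hT.1 g
  have h𝒯min : ∀ S ∈ 𝒯, ∀ K ∈ P, K ≤ S → K = S := by
    rintro _ ⟨g, rfl⟩ K hK hle
    exact hminconj g K hK hle
  have hconj : ∀ S ∈ 𝒯, ∀ g : G, ConjAct.toConjAct g • S ∈ 𝒯 := by
    rintro _ ⟨h, rfl⟩ g
    exact ⟨g * h, by rw [← mul_smul, map_mul]⟩
  have hcomm : ∀ S ∈ 𝒯, ∀ S' ∈ 𝒯, S ≠ S' → ∀ x ∈ S, ∀ y ∈ S', x * y = y * x := by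
    intro S hS S' hS' hne x hx y hy
    obtain ⟨-, hS1, hS2⟩ := h𝒯P S hS
    obtain ⟨-, hS1', hS2'⟩ := h𝒯P S' hS'
    rw [Subgroup.le_normalizer_iff] at hS2 hS2'
    have hbot : S ⊓ S' = ⊥ := by
      by_contra hcon
      have hP : S ⊓ S' ∈ P := by
        refine ⟨hcon, inf_le_left.trans hS1, ?_⟩
        rw [Subgroup.le_normalizer_iff]
        intro n hn z hz
        exact ⟨hS2 n hn z hz.1, hS2' n hn z hz.2⟩
      exact hne ((h𝒯min S hS _ hP inf_le_left).symm.trans (h𝒯min S' hS' _ hP inf_le_right))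
    have : x * y * x⁻¹ * y⁻¹ ∈ S ⊓ S' := by
      constructor
      · have := hS2 y (hS1' hy) x⁻¹ (S.inv_mem hx)
        have := S.mul_mem hx this
        simpa [mul_assoc] using this
      · exact S'.mul_mem (hS2' x (hS1 hx) y hy) (S'.inv_mem hy)
    rw [hbot, Subgroup.mem_bot, mul_inv_eq_one, mul_inv_eq_iff_eq_mul] at this
    exact this
  have hsup : sSup 𝒯 = N := by
    apply hmin
    · constructor
      intro n hn g
      have : sSup 𝒯 ≤ (sSup 𝒯).comap (MulAut.conj g).toMonoidHom := by
        apply sSup_le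
        intro S hS x hx
        rw [Subgroup.mem_comap]
        apply (le_sSup (hconj S hS g) : _ ≤ sSup 𝒯)
        rw [Subgroup.mem_toConjAct_smul_iff]
        simpa [mul_assoc] using hx
      exact this hn
    · exact sSup_le fun S hS => (h𝒯P S hS).2.1
    · intro h
      apply hT.1.1
      rw [eq_bot_iff, ← h]
      exact le_sSup hTT
  have hnonab : ∃ x ∈ T, ∃ y ∈ T, x * y ≠ y * x := by
    by_contra! hcon
    have h1 : ∀ S ∈ 𝒯, ∀ x ∈ S, ∀ y ∈ S, x * y = y * x := by
      rintro _ ⟨g, rfl⟩ x hx y hy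
      rw [Subgroup.mem_toConjAct_smul_iff] at hx hy
      have h2 := hcon _ hx _ hy
      have h3 : g * (g⁻¹ * x * g * (g⁻¹ * y * g)) * g⁻¹ =
        g * (g⁻¹ * y * g * (g⁻¹ * x * g)) * g⁻¹ := by rw [h2]
      simpa [mul_assoc] using h3
    have h2 : ∀ S ∈ 𝒯, S ≤ Subgroup.centralizer (N : Set G) := by
      intro S hS
      rw [Subgroup.le_centralizer_iff]
      rw [← hsup]
      apply sSup_le
      intro S' hS' y hy
      rw [Subgroup.mem_centralizer_iff]
      intro x hx
      by_cases hSS : S = S'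
      · subst hSS
        exact h1 S hS x hx y hy
      · exact hcomm S hS S' hS' hSS x hx y hy
    have h3 : N ≤ Subgroup.centralizer (N : Set G) := by
      conv_lhs => rw [← hsup]
      exact sSup_le h2
    obtain ⟨x, hx, y, hy, hxy⟩ := hab
    exact hxy ((Subgroup.mem_centralizer_iff.1 (h3 hy)) x hx)
  refine ⟨𝒯, ⟨⟨T, hTT⟩, fun S hS => (h𝒯P S hS).2.1, hconj, ?_, hcomm, hsup, ?_, ?_⟩⟩
  · rintro _ ⟨g, rfl⟩ _ ⟨h, rfl⟩
    exact ⟨h * g⁻¹, by rw [← mul_smul, ← map_mul, inv_mul_cancel_right]⟩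
  · intro S hS
    have hSP := h𝒯P S hS
    have : Nontrivial S := (Subgroup.nontrivial_iff_ne_bot S).2 hSP.1
    refine ⟨fun K hK => ?_⟩
    by_cases hKb : K = ⊥
    · exact Or.inl hKb
    right
    have hKS : K.map S.subtype ≤ S := Subgroup.map_subtype_le K
    have hnorm : N ≤ Subgroup.normalizer (K.map S.subtype : Set G) := by
      rw [← hsup]
      apply sSup_le
      intro S' hS'
      rw [Subgroup.le_normalizer_iff]
      intro s hs k hk
      by_cases hSS : S = S'
      · subst hSS
        obtain ⟨k, hk, rfl⟩ := hk
        exact ⟨⟨s, hs⟩ * k * ⟨s, hs⟩⁻¹, hK.conj_mem k hk ⟨s, hs⟩, rfl⟩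
      · rw [← hcomm S hS S' hS' hSS k (hKS hk) s hs, mul_inv_cancel_right]
        exact hk
    have := h𝒯min S hS (K.map S.subtype)
      ⟨by rwa [Ne, Subgroup.map_eq_bot_iff_of_injective _ S.subtype_injective],
        hKS.trans hSP.2.1, hnorm⟩ hKS
    rw [eq_top_iff]
    intro x _
    have h1 : (x : G) ∈ K.map S.subtype := by rw [this]; exact x.2
    simpa using h1
  · rintro _ ⟨g, rfl⟩
    obtain ⟨x, hx, y, hy, hxy⟩ := hnonab
    refine ⟨g * x * g⁻¹, ?_, g * y * g⁻¹, ?_, ?_⟩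
    · rw [Subgroup.mem_toConjAct_smul_iff]; simpa [mul_assoc] using hx
    · rw [Subgroup.mem_toConjAct_smul_iff]; simpa [mul_assoc] using hy
    · intro h
      apply hxy
      have h2 : g⁻¹ * (g * x * g⁻¹ * (g * y * g⁻¹)) * g =
        g⁻¹ * (g * y * g⁻¹ * (g * x * g⁻¹)) * g := by rw [h]
      simpa [mul_assoc] using h2

namespace IsSimpleDecomposition

variable {G : Type*} [Group G] {N : Subgroup G} {𝒯 : Set (Subgroup G)}

/-- The action of `G` on the simple factors. -/
noncomputable def permHom (h : IsSimpleDecomposition N 𝒯) : G →* Equiv.Perm 𝒯 :=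
  letI : MulAction (ConjAct G) 𝒯 :=
    { smul := fun g T => ⟨(g • T.1), h.conj_mem T T.2 (ConjAct.ofConjAct g)⟩
      one_smul := fun T => Subtype.ext (one_smul (ConjAct G) T.1)
      mul_smul := fun g g' T => Subtype.ext (mul_smul g g' T.1) }
  (MulAction.toPermHom (ConjAct G) 𝒯).comp ConjAct.toConjAct.toMonoidHom

lemma permHom_apply (h : IsSimpleDecomposition N 𝒯) (g : G) (T : 𝒯) :
    (h.permHom g T : Subgroup G) = (ConjAct.toConjAct g • T.1) := rfl

lemma conj_mem_of_mem_ker (h : IsSimpleDecomposition N 𝒯) {g : G} (hg : g ∈ h.permHom.ker)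
    (T : 𝒯) {x : G} (hx : x ∈ T.1) : g * x * g⁻¹ ∈ T.1 := by
  have h1 : (h.permHom g T : Subgroup G) = T := by
    rw [MonoidHom.mem_ker.1 hg]; rfl
  rw [permHom_apply] at h1
  rw [← h1, Subgroup.mem_toConjAct_smul_iff]
  simpa [mul_assoc] using hx

theorem card_le [Finite G] (h : IsSimpleDecomposition N 𝒯) {A : ℕ}
    (hA : ∀ T ∈ 𝒯, Nat.card (MulAut T) ≤ A) :
    Nat.card G ≤ Nat.card (Subgroup.centralizer (N : Set G)) *
      (Nat.card h.permHom.range * A ^ Nat.card 𝒯) := by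
  let f : h.permHom.ker →* (∀ T : 𝒯, MulAut T.1) := MonoidHom.pi fun T =>
    { toFun := fun g =>
        { toFun := fun x => ⟨g * x * g⁻¹, h.conj_mem_of_mem_ker g.2 T x.2⟩
          invFun := fun x => ⟨(g⁻¹ : h.permHom.ker) * x * ((g⁻¹ : h.permHom.ker) : G)⁻¹,
            h.conj_mem_of_mem_ker (g⁻¹).2 T x.2⟩
          left_inv := fun x => Subtype.ext (by simp [mul_assoc])
          right_inv := fun x => Subtype.ext (by simp [mul_assoc])
          map_mul' := fun x y => Subtype.ext (by simp [mul_assoc]) }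
      map_one' := by ext; simp
      map_mul' := fun g g' => by ext; simp [mul_assoc] }
  have hf : ∀ g T x, ((f g T x : T.1) : G) = g * x * g⁻¹ := fun _ _ _ => rfl
  have hker : f.ker.map h.permHom.ker.subtype ≤ Subgroup.centralizer (N : Set G) := by
    rw [Subgroup.le_centralizer_iff]
    refine h.sSup_eq.symm.le.trans (sSup_le ?_)
    intro T hT x hx
    rw [Subgroup.mem_centralizer_iff]
    rintro _ ⟨g, hg, rfl⟩
    have h1 := hf g ⟨T, hT⟩ ⟨x, hx⟩
    rw [MonoidHom.mem_ker.1 hg] at h1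
    have h1 : x = g * x * (g : G)⁻¹ := h1
    exact (eq_mul_inv_iff_mul_eq.1 h1).symm
  have h1 : Nat.card f.ker ≤ Nat.card (Subgroup.centralizer (N : Set G)) := by
    rw [Nat.card_congr (Subgroup.equivMapOfInjective f.ker _
      h.permHom.ker.subtype_injective).toEquiv]
    exact Nat.card_mono (Set.toFinite _) hker
  have := Fintype.ofFinite 𝒯
  have h2 : Nat.card f.range ≤ A ^ Nat.card 𝒯 := by
    refine (Subgroup.card_le_card_group _).trans ?_
    rw [Nat.card_pi, Nat.card_eq_fintype_card (α := 𝒯)]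
    exact Finset.prod_le_pow_card _ _ _ fun T _ => hA T T.2
  have h3 : Nat.card h.permHom.ker = Nat.card f.range * Nat.card f.ker := by
    rw [Subgroup.card_eq_card_quotient_mul_card_subgroup f.ker,
      Nat.card_congr (QuotientGroup.quotientKerEquivRange f).toEquiv]
  have h4 : Nat.card G = Nat.card h.permHom.range * Nat.card h.permHom.ker := by
    rw [Subgroup.card_eq_card_quotient_mul_card_subgroup h.permHom.ker,
      Nat.card_congr (QuotientGroup.quotientKerEquivRange h.permHom).toEquiv]
  rw [h4, h3]
  calc _ ≤ Nat.card h.permHom.range * (A ^ Nat.card 𝒯 *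
        Nat.card (Subgroup.centralizer (N : Set G))) := by gcongr
    _ = _ := by ring

end IsSimpleDecomposition

end SimpleDecomposition

section SimpleDecompositionBounds

open scoped Pointwise

lemma Subgroup.relIndex_ne_zero_of_finite {G : Type*} [Group G] [Finite G] {H K : Subgroup G} :
    H.relIndex K ≠ 0 :=
  Subgroup.index_ne_zero_of_finite

namespace IsSimpleDecomposition

variable {G : Type*} [Group G] {N : Subgroup G} {𝒯 : Set (Subgroup G)}

theorem exists_bound [Finite G] (h : IsSimpleDecomposition N 𝒯) {d : ℕ}
    (hsec : SectionsHaveSmallIndex d G) :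
    ∃ e, 2 ≤ e ∧ e ≤ d ∧ (∀ T ∈ 𝒯, ∀ P : Subgroup G, ¬ T ≤ P → e ≤ P.relIndex T) ∧
      Nat.card G ≤ Nat.card (Subgroup.centralizer (N : Set G)) *
        (2 ^ (d * (Nat.card 𝒯 - 1)) * (e ^ (4 * e)) ^ Nat.card 𝒯) := by
  classical
  obtain ⟨T₀, hT₀⟩ := h.nonempty
  have hex : ∃ e, ∃ P : Subgroup G, ∃ T ∈ 𝒯, ¬ T ≤ P ∧ P.relIndex T = e := by
    have := h.isSimpleGroup T₀ hT₀
    exact ⟨_, ⊥, T₀, hT₀, fun hle => by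
      have := (Subgroup.nontrivial_iff_ne_bot T₀).1 inferInstance
      exact this (le_bot_iff.1 hle), rfl⟩
  let e := Nat.find hex
  have hmin : ∀ T ∈ 𝒯, ∀ P : Subgroup G, ¬ T ≤ P → e ≤ P.relIndex T :=
    fun T hT P hP => Nat.find_min' hex ⟨P, T, hT, hP, rfl⟩
  obtain ⟨P₁, T₁, hT₁, hP₁, he⟩ := Nat.find_spec hex
  have heach : ∀ T ∈ 𝒯, ∃ H : Subgroup T, H ≠ ⊤ ∧ H.index = e := by
    intro T hT
    obtain ⟨g, rfl⟩ := h.exists_conj T₁ hT₁ T hT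
    refine ⟨(ConjAct.toConjAct g • P₁).subgroupOf _, ?_, ?_⟩
    · rw [Ne, Subgroup.subgroupOf_eq_top, Subgroup.pointwise_smul_le_pointwise_smul_iff]
      exact hP₁
    · exact (Subgroup.relIndex_pointwise_smul _ P₁ T₁).trans he
  refine ⟨e, ?_, ?_, hmin, ?_⟩
  · obtain ⟨H, hH, hHe⟩ := heach T₀ hT₀
    have h0 : H.index ≠ 0 := Subgroup.index_ne_zero_of_finite
    have h1 : H.index ≠ 1 := fun h1 => hH (Subgroup.index_eq_one.1 h1)
    omega
  · have := h.isSimpleGroup T₀ hT₀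
    obtain ⟨L, hL, hLd⟩ := (hsec.of_injective T₀.subtype T₀.subtype_injective).exists_index_le
    refine le_trans (hmin T₀ hT₀ (L.map T₀.subtype) ?_) (le_trans (le_of_eq ?_) hLd)
    · intro hle
      apply hL
      rw [eq_top_iff]
      intro x _
      simpa using hle x.2
    · rw [Subgroup.relIndex, Subgroup.subgroupOf,
        Subgroup.comap_map_eq_self_of_injective T₀.subtype_injective]
  · have : Finite 𝒯 := inferInstance
    have : Nonempty 𝒯 := ⟨T₀, hT₀⟩
    refine (h.card_le (A := e ^ (4 * e)) ?_).trans ?_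
    · intro T hT
      have := h.isSimpleGroup T hT
      obtain ⟨H, hH, hHe⟩ := heach T hT
      exact simple_card_mulAut_le H hH hHe
    · gcongr
      exact hsec.card_range_perm_le h.permHom

lemma conj_mem_of_mem (h : IsSimpleDecomposition N 𝒯) {T : Subgroup G} (hT : T ∈ 𝒯) {n : G}
    (hn : n ∈ N) {x : G} (hx : x ∈ T) : n * x * n⁻¹ ∈ T := by
  have h1 : N ≤ Subgroup.normalizer (T : Set G) := by
    rw [← h.sSup_eq]
    refine sSup_le fun T' hT' => Subgroup.le_normalizer_iff.2 fun t ht x hx => ?_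
    by_cases hTT : T' = T
    · subst hTT
      exact T'.mul_mem (T'.mul_mem ht hx) (T'.inv_mem ht)
    · rwa [h.commute T' hT' T hT hTT t ht x hx, mul_inv_cancel_right]
  exact Subgroup.le_normalizer_iff.1 h1 n hn x hx

lemma le_sup_centralizer (h : IsSimpleDecomposition N 𝒯) {T : Subgroup G} (hT : T ∈ 𝒯) :
    N ≤ T ⊔ (Subgroup.centralizer (T : Set G) ⊓ N) := by
  refine h.sSup_eq.symm.le.trans (sSup_le fun T' hT' => ?_)
  by_cases hTT : T' = T
  · subst hTT
    exact le_sup_left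
  · refine le_trans (b := Subgroup.centralizer (T : Set G) ⊓ N)
      (fun x hx => ⟨?_, h.le T' hT' hx⟩) le_sup_right
    exact Subgroup.mem_centralizer_iff.2 fun t ht =>
      (h.commute T' hT' T hT hTT x hx t ht).symm

lemma eq_bot_or_le (h : IsSimpleDecomposition N 𝒯) {T : Subgroup G} (hT : T ∈ 𝒯)
    {Y : Subgroup G} (hYT : Y ≤ T) (hY : ∀ t ∈ T, ∀ y ∈ Y, t * y * t⁻¹ ∈ Y) :
    Y = ⊥ ∨ T ≤ Y := by
  have := h.isSimpleGroup T hT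
  have hn : (Y.subgroupOf T).Normal := ⟨fun y hy t => hY t t.2 y hy⟩
  rcases hn.eq_bot_or_eq_top with h1 | h1
  · left
    rw [Subgroup.subgroupOf_eq_bot, disjoint_iff, inf_eq_left.2 hYT] at h1
    exact h1
  · exact Or.inr (Subgroup.subgroupOf_eq_top.1 h1)

lemma pow_card_le_relIndex [Finite G] (h : IsSimpleDecomposition N 𝒯) {e : ℕ}
    (he : ∀ T ∈ 𝒯, ∀ P : Subgroup G, ¬ T ≤ P → e ≤ P.relIndex T)
    (P : Subgroup G → Subgroup G)
    (hP : ∀ T ∈ 𝒯, Subgroup.centralizer (T : Set G) ⊓ N ≤ P T)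
    (hTP : ∀ T ∈ 𝒯, ¬ T ≤ P T) {K : Subgroup G} (hK : ∀ T ∈ 𝒯, K ≤ P T) :
    e ^ Nat.card 𝒯 ≤ K.relIndex N := by
  classical
  have key : ∀ S : Finset (Subgroup G), (∀ T ∈ S, T ∈ 𝒯) →
      e ^ S.card ≤ (⨅ T ∈ S, P T).relIndex N := by
    intro S
    induction S using Finset.induction_on with
    | empty => intro _; simp
    | insert T S hTS ih =>
      intro hS
      have hT := hS T (Finset.mem_insert_self T S)
      have hS' : ∀ T ∈ S, T ∈ 𝒯 := fun T hT => hS T (Finset.mem_insert_of_mem hT)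
      rw [Finset.iInf_insert, ← Subgroup.relIndex_inf_mul_relIndex, Finset.card_insert_of_notMem hTS,
        pow_succ, mul_comm]
      refine Nat.mul_le_mul ((he T hT _ (hTP T hT)).trans ?_) (ih hS')
      refine Subgroup.relIndex_le_of_le_right (le_inf (le_iInf₂ fun T' hT' => ?_) (h.le T hT))
        Subgroup.relIndex_ne_zero_of_finite
      refine le_trans (b := Subgroup.centralizer (T' : Set G) ⊓ N)
        (fun x hx => ⟨?_, h.le T hT hx⟩) (hP T' (hS' T' hT'))
      refine Subgroup.mem_centralizer_iff.2 fun t ht => ?_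
      refine h.commute T' (hS' T' hT') T hT ?_ t ht x hx
      rintro rfl
      exact hTS hT'
  have := Fintype.ofFinite 𝒯
  have h1 := key 𝒯.toFinset (fun T hT => by simpa using hT)
  rw [Set.toFinset_card, ← Nat.card_eq_fintype_card] at h1
  refine h1.trans (Subgroup.relIndex_le_of_le_left (le_iInf₂ fun T hT => hK T (by simpa using hT))
    Subgroup.relIndex_ne_zero_of_finite)

theorem pow_card_le_sq [Finite G] [N.Normal] (h : IsSimpleDecomposition N 𝒯) {e : ℕ}
    (he : ∀ T ∈ 𝒯, ∀ P : Subgroup G, ¬ T ≤ P → e ≤ P.relIndex T)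
    (S : Subgroup G) (hS : ∀ g : G, ∃ s ∈ S, ∃ n ∈ N, g = s * n)
    (hcore : ∀ x ∈ S, x ∈ N → (∀ n ∈ N, n⁻¹ * x * n ∈ S) → x = 1) :
    e ^ Nat.card 𝒯 ≤ S.relIndex N ^ 2 := by
  have hN := ‹N.Normal›
  let L := S ⊓ N
  have hLN : L.relIndex N = S.relIndex N := Subgroup.inf_relIndex_right S N
  let C : Subgroup G → Subgroup G := fun T => Subgroup.centralizer (T : Set G) ⊓ N
  have hpos : 1 ≤ S.relIndex N := Nat.one_le_iff_ne_zero.2 Subgroup.relIndex_ne_zero_of_finite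
  by_cases hA : ∀ T ∈ 𝒯, T ≤ L ⊔ C T
  swap
  · push Not at hA
    obtain ⟨T₀, hT₀, hA⟩ := hA
    refine le_trans (h.pow_card_le_relIndex he (fun T => L ⊔ C T) (fun T _ => le_sup_right)
      ?_ (K := L) (fun T _ => le_sup_left)) ?_
    · intro T hT hle
      apply hA
      obtain ⟨g, rfl⟩ := h.exists_conj T₀ hT₀ T hT
      obtain ⟨s, hs, n, hn, rfl⟩ := hS g
      have h1 : ∀ x, x ∈ T₀ → s * x * s⁻¹ ∈ ConjAct.toConjAct (s * n) • T₀ := by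
        intro x hx
        rw [Subgroup.mem_toConjAct_smul_iff]
        have := h.conj_mem_of_mem hT₀ (N.inv_mem hn) hx
        simpa [mul_assoc] using this
      have h2 : L ⊔ C (ConjAct.toConjAct (s * n) • T₀) ≤
          (L ⊔ C T₀).comap (MulAut.conj s⁻¹).toMonoidHom := by
        apply sup_le
        · intro l hl
          refine (le_sup_left : L ≤ _) ⟨?_, ?_⟩
          · exact S.mul_mem (S.mul_mem (S.inv_mem hs) hl.1) (S.inv_mem (S.inv_mem hs))
          · exact hN.conj_mem l hl.2 s⁻¹
        · intro l hl
          refine (le_sup_right : C T₀ ≤ _) ⟨?_, hN.conj_mem l hl.2 s⁻¹⟩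
          refine Subgroup.mem_centralizer_iff.2 fun t ht => ?_
          have h3 := Subgroup.mem_centralizer_iff.1 hl.1 _ (h1 t ht)
          have h4 : s⁻¹ * (s * t * s⁻¹ * l) * s = s⁻¹ * (l * (s * t * s⁻¹)) * s := by rw [h3]
          simpa [mul_assoc] using h4
      intro x hx
      have h3 := h2 (hle (h1 x hx))
      rw [Subgroup.mem_comap] at h3
      simpa [mul_assoc] using h3
    · rw [hLN]
      nlinarith
  · have hconjN : ∀ (R : Subgroup G), N ≤ Subgroup.normalizer (R : Set G) ↔
        ∀ n ∈ N, ∀ r ∈ R, n * r * n⁻¹ ∈ R := fun R => Subgroup.le_normalizer_iff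
    obtain ⟨R, hR, hRmax⟩ := (Set.toFinite {R : Subgroup G | R ≤ N ∧
      (∀ n ∈ N, ∀ r ∈ R, n * r * n⁻¹ ∈ R) ∧ R ⊓ L = ⊥}).exists_maximal
      ⟨⊥, bot_le, by simp, by simp⟩
    obtain ⟨hRN, hRn, hRL⟩ := hR
    have hdisj : ∀ D : Subgroup G, D ≤ N → D ⊓ L = ⊥ → Nat.card D ≤ S.relIndex N := by
      intro D hDN hDL
      rw [← hLN, ← Subgroup.relIndex_bot_left D, ← hDL, inf_comm, Subgroup.inf_relIndex_right]
      exact Subgroup.relIndex_le_of_le_right hDN Subgroup.relIndex_ne_zero_of_finite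
    have hTRL : ∀ T ∈ 𝒯, T ≤ R ⊔ L := by
      intro T hT
      have hTn : ∀ n ∈ N, ∀ t ∈ T, n * t * n⁻¹ ∈ T := fun n hn t ht => h.conj_mem_of_mem hT hn ht
      have hRT : ∀ x, x ∈ R ⊔ T ↔ ∃ r ∈ R, ∃ t ∈ T, x = r * t := fun x =>
        Subgroup.mem_sup_iff_of_conj_mem fun t ht r hr => hRn t (h.le T hT ht) r hr
      have hRTn : ∀ n ∈ N, ∀ x ∈ R ⊔ T, n * x * n⁻¹ ∈ R ⊔ T := by
        intro n hn x hx
        obtain ⟨r, hr, t, ht, rfl⟩ := (hRT x).1 hx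
        exact (hRT _).2 ⟨_, hRn n hn r hr, _, hTn n hn t ht, by simp [mul_assoc]⟩
      let X := (R ⊔ T) ⊓ L
      have hRX : ∀ x, x ∈ R ⊔ X ↔ ∃ r ∈ R, ∃ l ∈ X, x = r * l := fun x =>
        Subgroup.mem_sup_iff_of_conj_mem (L := X) fun l hl r hr => hRn l hl.2.2 r hr
      have hXn : N ≤ Subgroup.normalizer ((R ⊔ X : Subgroup G) : Set G) := by
        refine (h.le_sup_centralizer hT).trans ((sup_le (hA T hT) le_sup_right).trans ?_)
        refine sup_le ?_ ?_
        · refine Subgroup.le_normalizer_iff.2 fun l hl x hx => ?_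
          obtain ⟨r, hr, y, hy, rfl⟩ := (hRX x).1 hx
          refine (hRX _).2 ⟨_, hRn l hl.2 r hr, l * y * l⁻¹, ⟨hRTn l hl.2 y hy.1, ?_⟩,
            by simp [mul_assoc]⟩
          exact L.mul_mem (L.mul_mem hl hy.2) (L.inv_mem hl)
        · refine Subgroup.le_normalizer_iff.2 fun c hc x hx => ?_
          obtain ⟨r, hr, y, hy, rfl⟩ := (hRX x).1 hx
          obtain ⟨r', hr', t, ht, hy'⟩ := (hRT y).1 hy.1
          have hct := Subgroup.mem_centralizer_iff.1 hc.1 t ht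
          refine (hRX _).2 ⟨(c * (r * r') * c⁻¹) * r'⁻¹,
            R.mul_mem (hRn c hc.2 _ (R.mul_mem hr hr')) (R.inv_mem hr'), y, hy, ?_⟩
          rw [hy']
          calc c * (r * (r' * t)) * c⁻¹ = c * (r * r') * (t * c⁻¹) := by group
            _ = c * (r * r') * (c⁻¹ * (c * t) * c⁻¹) := by group
            _ = c * (r * r') * (c⁻¹ * (t * c) * c⁻¹) := by rw [hct]
            _ = _ := by group
      rcases h.eq_bot_or_le hT (Y := T ⊓ (R ⊔ X)) inf_le_left (fun t ht y hy =>
        ⟨hTn t (h.le T hT ht) y hy.1, Subgroup.le_normalizer_iff.1 hXn t (h.le T hT ht) y hy.2⟩)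
        with h1 | h1
      · have hX : X = ⊥ := by
          rw [eq_bot_iff]
          intro x hx
          obtain ⟨r, hr, t, ht, hx'⟩ := (hRT x).1 hx.1
          have ht1 : t ∈ T ⊓ (R ⊔ X) :=
            ⟨ht, (hRX t).2 ⟨r⁻¹, R.inv_mem hr, x, hx, by rw [hx']; group⟩⟩
          rw [h1, Subgroup.mem_bot] at ht1
          rw [ht1, mul_one] at hx'
          rw [← hRL]
          exact ⟨hx' ▸ hr, hx.2⟩
        have := hRmax (y := R ⊔ T) ⟨sup_le hRN (h.le T hT), hRTn, hX⟩ le_sup_left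
        exact le_sup_right.trans (this.trans le_sup_left)
      · exact h1.trans (inf_le_right.trans (sup_le_sup_left inf_le_right _))
    have hNRL : N ≤ R ⊔ L := h.sSup_eq.symm.le.trans (sSup_le hTRL)
    have hRLm : ∀ x, x ∈ R ⊔ L ↔ ∃ r ∈ R, ∃ l ∈ L, x = r * l := fun x =>
      Subgroup.mem_sup_iff_of_conj_mem (L := L) fun l hl r hr => hRn l hl.2 r hr
    let D := Subgroup.centralizer (R : Set G) ⊓ N
    have hDL : D ⊓ L = ⊥ := by
      rw [eq_bot_iff]
      intro x hx
      refine Subgroup.mem_bot.2 (hcore x hx.2.1 hx.2.2 fun n hn => ?_)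
      obtain ⟨r, hr, l, hl, rfl⟩ := (hRLm n).1 (hNRL hn)
      have hrx := Subgroup.mem_centralizer_iff.1 hx.1.1 r hr
      have h1 : (r * l)⁻¹ * x * (r * l) = l⁻¹ * x * l := by
        calc (r * l)⁻¹ * x * (r * l) = l⁻¹ * r⁻¹ * (x * r) * l := by group
          _ = l⁻¹ * r⁻¹ * (r * x) * l := by rw [hrx]
          _ = _ := by group
      rw [h1]
      exact S.mul_mem (S.mul_mem (S.inv_mem hl.1) hx.2.1) hl.1
    have hNRD : N ≤ R ⊔ D := by
      refine h.sSup_eq.symm.le.trans (sSup_le fun T hT => ?_)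
      have hTN := h.le T hT
      rcases h.eq_bot_or_le hT (Y := T ⊓ R) inf_le_left (fun t ht y hy =>
        ⟨h.conj_mem_of_mem hT (hTN ht) hy.1, hRn t (hTN ht) y hy.2⟩) with h1 | h1
      · refine le_trans (b := D) (fun t ht => ⟨?_, hTN ht⟩) le_sup_right
        refine Subgroup.mem_centralizer_iff.2 fun r hr => ?_
        have h2 : r * t * r⁻¹ * t⁻¹ ∈ T ⊓ R := by
          constructor
          · exact T.mul_mem (h.conj_mem_of_mem hT (hRN hr) ht) (T.inv_mem ht)
          · have := R.mul_mem hr (hRn t (hTN ht) _ (R.inv_mem hr))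
            simpa [mul_assoc] using this
        rw [h1, Subgroup.mem_bot, mul_inv_eq_one, mul_inv_eq_iff_eq_mul] at h2
        exact h2
      · exact h1.trans (inf_le_right.trans le_sup_left)
    have hRDm : ∀ x, x ∈ R ⊔ D ↔ ∃ r ∈ R, ∃ l ∈ D, x = r * l := fun x =>
      Subgroup.mem_sup_iff_of_conj_mem (L := D) fun l hl r hr => hRn l hl.2 r hr
    have hcard : Nat.card N ≤ Nat.card R * Nat.card D := by
      rw [← Nat.card_prod]
      refine Nat.card_le_card_of_surjective
        (fun p : R × D => (⟨p.1 * p.2, N.mul_mem (hRN p.1.2) p.2.2.2⟩ : N)) ?_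
      rintro ⟨x, hx⟩
      obtain ⟨r, hr, l, hl, rfl⟩ := (hRDm x).1 (hNRD hx)
      exact ⟨(⟨r, hr⟩, ⟨l, hl⟩), rfl⟩
    have h1 := h.pow_card_le_relIndex he C (fun T _ => le_rfl) (fun T hT hle => by
      obtain ⟨x, hx, y, hy, hxy⟩ := h.nonabelian T hT
      exact hxy (Subgroup.mem_centralizer_iff.1 (hle hy).1 x hx)) (K := ⊥) (fun T _ => bot_le)
    rw [Subgroup.relIndex_bot_left] at h1
    rw [sq]
    exact h1.trans (hcard.trans (Nat.mul_le_mul (hdisj R hRN hRL) (hdisj D inf_le_right hDL)))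

end IsSimpleDecomposition

end SimpleDecompositionBounds

/-- The elements of `X` preserve `U`, and `U` is minimal nonzero with this property. -/
structure ActsIrreducibly {G V : Type*} [Group G] [AddCommGroup V] [DistribMulAction G V]
    (X : Subgroup G) (U : AddSubgroup V) : Prop where
  ne_bot : U ≠ ⊥
  smul_mem : ∀ x ∈ X, ∀ u ∈ U, x • u ∈ U
  eq_of_le : ∀ W : AddSubgroup V, W ≤ U → W ≠ ⊥ → (∀ x ∈ X, ∀ w ∈ W, x • w ∈ W) → W = U

instance AddMonoid.End.instFinite {V : Type*} [AddCommGroup V] [Finite V] :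
    Finite (AddMonoid.End V) :=
  DFunLike.finite (F := V →+ V)

section Irreducible

variable {G V : Type*} [Group G] [AddCommGroup V] [DistribMulAction G V]

lemma exists_actsIrreducibly [Finite V] {X : Subgroup G} {U : AddSubgroup V} (hU : U ≠ ⊥)
    (hX : ∀ x ∈ X, ∀ u ∈ U, x • u ∈ U) : ∃ W ≤ U, ActsIrreducibly X W := by
  obtain ⟨W, ⟨hWU, hW, hWX⟩, hmin⟩ := (Set.toFinite {W : AddSubgroup V | W ≤ U ∧ W ≠ ⊥ ∧
    ∀ x ∈ X, ∀ w ∈ W, x • w ∈ W}).exists_minimal ⟨U, le_rfl, hU, hX⟩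
  exact ⟨W, hWU, hW, hWX, fun W' hle hne hinv =>
    le_antisymm hle (hmin ⟨hle.trans hWU, hne, hinv⟩ hle)⟩

lemma smul_mem_sup {X Y : Subgroup G} {U : AddSubgroup V} (hX : ∀ x ∈ X, ∀ u ∈ U, x • u ∈ U)
    (hY : ∀ x ∈ Y, ∀ u ∈ U, x • u ∈ U) : ∀ x ∈ X ⊔ Y, ∀ u ∈ U, x • u ∈ U := by
  let S : Subgroup G :=
    { carrier := {g | (∀ u ∈ U, g • u ∈ U) ∧ ∀ u ∈ U, g⁻¹ • u ∈ U}
      one_mem' := ⟨fun u hu => by simpa using hu, fun u hu => by simpa using hu⟩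
      mul_mem' := fun {a b} ha hb => ⟨fun u hu => by
        rw [mul_smul]; exact ha.1 _ (hb.1 _ hu), fun u hu => by
        rw [mul_inv_rev, mul_smul]; exact hb.2 _ (ha.2 _ hu)⟩
      inv_mem' := fun {a} ha => ⟨ha.2, fun u hu => by rw [inv_inv]; exact ha.1 u hu⟩ }
  have h1 : X ⊔ Y ≤ S := sup_le (fun x hx => ⟨hX x hx, hX _ (X.inv_mem hx)⟩)
    (fun x hx => ⟨hY x hx, hY _ (Y.inv_mem hx)⟩)
  exact fun x hx => (h1 hx).1

/-- The action of a subgroup on an invariant additive subgroup. -/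
@[reducible] def restrictAction (X : Subgroup G) (U : AddSubgroup V)
    (h : ∀ x ∈ X, ∀ u ∈ U, x • u ∈ U) : DistribMulAction X U where
  smul x u := ⟨(x : G) • (u : V), h x x.2 u u.2⟩
  one_smul u := Subtype.ext (one_smul G (u : V))
  mul_smul x y u := Subtype.ext (mul_smul (x : G) (y : G) (u : V))
  smul_zero x := Subtype.ext (smul_zero (x : G))
  smul_add x u v := Subtype.ext (smul_add (x : G) (u : V) (v : V))

/-- The action of a subgroup on an invariant additive subgroup, as a homomorphism. -/
def restrictHom (X : Subgroup G) (U : AddSubgroup V)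
    (h : ∀ x ∈ X, ∀ u ∈ U, x • u ∈ U) : X →* (AddMonoid.End U)ˣ :=
  letI := restrictAction X U h
  (DistribMulAction.toAddMonoidEnd X U).toHomUnits

lemma restrictHom_apply (X : Subgroup G) (U : AddSubgroup V)
    (h : ∀ x ∈ X, ∀ u ∈ U, x • u ∈ U) (x : X) (u : U) :
    (((restrictHom X U h x : (AddMonoid.End U)ˣ) : AddMonoid.End U) u : V) = (x : G) • (u : V) :=
  rfl

lemma smul_commute_of_irreducible [Finite V] {X : Subgroup G} {U : AddSubgroup V}
    (hU : ActsIrreducibly X U) (f g : AddMonoid.End U)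
    (hf : ∀ x (hx : x ∈ X) (u : U), (f ⟨x • u, hU.smul_mem x hx u u.2⟩ : V) = x • (f u : V))
    (hg : ∀ x (hx : x ∈ X) (u : U), (g ⟨x • u, hU.smul_mem x hx u u.2⟩ : V) = x • (g u : V)) :
    f * g = g * f := by
  let E : Subring (AddMonoid.End U) := Subring.centralizer
    (Set.range fun x : X => ((restrictHom X U hU.smul_mem x : (AddMonoid.End U)ˣ) : AddMonoid.End U))
  have hE : ∀ a : AddMonoid.End U,
      (∀ x (hx : x ∈ X) (u : U), (a ⟨x • u, hU.smul_mem x hx u u.2⟩ : V) = x • (a u : V)) →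
      a ∈ E := by
    intro a ha
    rw [Subring.mem_centralizer_iff]
    rintro _ ⟨x, rfl⟩
    ext u
    exact (ha x x.2 u).symm
  have hE' : ∀ a ∈ E, ∀ x (hx : x ∈ X) (u : U),
      (a ⟨x • u, hU.smul_mem x hx u u.2⟩ : V) = x • (a u : V) := by
    intro a ha x hx u
    rw [Subring.mem_centralizer_iff] at ha
    have := ha _ ⟨⟨x, hx⟩, rfl⟩
    exact (congrArg Subtype.val (DFunLike.congr_fun this u)).symm
  have hinj : ∀ a ∈ E, a ≠ 0 → ∀ u : U, a u = 0 → u = 0 := by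
    intro a ha ha0 u hu
    by_contra hu0
    have h1 := hU.eq_of_le ((AddMonoidHom.ker (a : U →+ U)).map U.subtype)
      (AddSubgroup.map_subtype_le _) ?_ ?_
    · apply ha0
      ext v
      have h2 : (v : V) ∈ (AddMonoidHom.ker (a : U →+ U)).map U.subtype := by rw [h1]; exact v.2
      obtain ⟨w, hw, hwv⟩ := h2
      have : w = v := Subtype.ext hwv
      subst this
      exact congrArg Subtype.val (show a w = 0 from hw)
    · intro h2
      apply hu0
      have h3 : (u : V) ∈ (AddMonoidHom.ker (a : U →+ U)).map U.subtype := ⟨u, hu, rfl⟩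
      rw [h2, AddSubgroup.mem_bot] at h3
      exact Subtype.ext h3
    · rintro x hx _ ⟨w, hw, rfl⟩
      refine ⟨⟨x • (w : V), hU.smul_mem x hx w w.2⟩, ?_, rfl⟩
      change a _ = 0
      apply Subtype.ext
      rw [hE' a ha x hx w, show a w = 0 from hw]
      exact smul_zero x
  obtain ⟨u₀, hu₀⟩ : ∃ u : U, u ≠ 0 := AddSubgroup.ne_bot_iff_exists_ne_zero.1 hU.ne_bot
  have : Nontrivial E := by
    refine ⟨0, 1, fun h => hu₀ ?_⟩
    have h1 : (0 : AddMonoid.End U) = 1 := congrArg Subtype.val h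
    exact (DFunLike.congr_fun h1 u₀).symm
  have : NoZeroDivisors E := by
    refine ⟨fun {a b} hab => ?_⟩
    by_contra! hcon
    apply hcon.2
    apply Subtype.ext
    ext u
    have h1 := hinj a.1 a.2 (fun h => hcon.1 (Subtype.ext h)) (b.1 u)
      (DFunLike.congr_fun (congrArg Subtype.val hab) u)
    exact congrArg Subtype.val h1
  have : IsDomain E := NoZeroDivisors.to_isDomain E
  have hfield := Finite.isDomain_to_isField E
  exact congrArg Subtype.val (hfield.mul_comm ⟨f, hE f hf⟩ ⟨g, hE g hg⟩)

lemma ActsIrreducibly.exists_sq_card_le [Finite V] {X Y : Subgroup G} {U : AddSubgroup V}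
    (hU : ActsIrreducibly (X ⊔ Y) U) (hXY : ∀ x ∈ X, ∀ y ∈ Y, x * y = y * x)
    (hY : ∃ a ∈ Y, ∃ b ∈ Y, ∃ u ∈ U, (a * b) • u ≠ (b * a) • u) :
    ∃ W ≤ U, ActsIrreducibly X W ∧ Nat.card W ^ 2 ≤ Nat.card U ∧
      ∀ x ∈ X, (∀ w ∈ W, x • w = w) → ∀ u ∈ U, x • u = u := by
  have hUX : ∀ x ∈ X, ∀ u ∈ U, x • u ∈ U := fun x hx =>
    hU.smul_mem x ((le_sup_left : X ≤ X ⊔ Y) hx)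
  have hUY : ∀ x ∈ Y, ∀ u ∈ U, x • u ∈ U := fun x hx =>
    hU.smul_mem x ((le_sup_right : Y ≤ X ⊔ Y) hx)
  obtain ⟨W, hWU, hW⟩ := exists_actsIrreducibly hU.ne_bot hUX
  refine ⟨W, hWU, hW, ?_, ?_⟩
  · by_cases hYW : ∀ y ∈ Y, ∀ w ∈ W, y • w ∈ W
    · exfalso
      have hWU' : W = U := hU.eq_of_le W hWU hW.ne_bot (smul_mem_sup hW.smul_mem hYW)
      subst hWU'
      obtain ⟨a, ha, b, hb, u, hu, hne⟩ := hY
      apply hne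
      have hcomm : ∀ y (hy : y ∈ Y), ∀ x (hx : x ∈ X) (u : W),
          ((((restrictHom Y W hYW ⟨y, hy⟩ : (AddMonoid.End W)ˣ) : AddMonoid.End W)
            ⟨x • u, hW.smul_mem x hx u u.2⟩ : W) : V) =
          x • ((((restrictHom Y W hYW ⟨y, hy⟩ : (AddMonoid.End W)ˣ) : AddMonoid.End W) u : W) : V) := by
        intro y hy x hx u
        rw [restrictHom_apply, restrictHom_apply]
        simp only [smul_smul]
        rw [hXY x hx y hy]
      have h1 := smul_commute_of_irreducible hW _ _ (hcomm a ha) (hcomm b hb)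
      have h2 := congrArg Subtype.val (DFunLike.congr_fun h1 ⟨u, hu⟩)
      rw [mul_smul, mul_smul]
      exact h2
    · push Not at hYW
      obtain ⟨y, hy, w₀, hw₀, hyw⟩ := hYW
      have hcond : ∀ w ∈ W, y • w ∈ W → w = 0 := by
        intro w hw hyw'
        by_contra hw0
        apply hyw
        let W' : AddSubgroup V := W ⊓ W.comap (DistribSMul.toAddMonoidHom V y)
        have h1 : W' = W := by
          refine hW.eq_of_le W' inf_le_left ?_ ?_
          · intro h
            have : w ∈ W' := ⟨hw, hyw'⟩
            rw [h, AddSubgroup.mem_bot] at this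
            exact hw0 this
          · rintro x hx v ⟨hv, hv'⟩
            refine ⟨hW.smul_mem x hx v hv, ?_⟩
            change y • x • v ∈ W
            rw [smul_smul, ← hXY x hx y hy, mul_smul]
            exact hW.smul_mem x hx _ hv'
        have h2 : w₀ ∈ W' := h1 ▸ hw₀
        exact h2.2
      rw [sq, ← Nat.card_prod]
      refine Nat.card_le_card_of_injective
        (fun p : W × W => (⟨p.1 + y • p.2, U.add_mem (hWU p.1.2) (hUY y hy _ (hWU p.2.2))⟩ : U)) ?_
      rintro ⟨a, b⟩ ⟨a', b'⟩ h
      have h1 : (a : V) + y • (b : V) = a' + y • (b' : V) := congrArg Subtype.val h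
      have h2 : y • ((b : V) - b') = a' - a := by
        rw [smul_sub, sub_eq_sub_iff_add_eq_add, add_comm, h1, add_comm]
      have h3 := hcond _ (W.sub_mem b.2 b'.2) (h2 ▸ W.sub_mem a'.2 a.2)
      rw [h3, smul_zero] at h2
      exact Prod.ext (Subtype.ext (sub_eq_zero.1 h2.symm).symm) (Subtype.ext (sub_eq_zero.1 h3))
  · let Z : AddSubgroup V :=
      { carrier := {u | u ∈ U ∧ ∀ x ∈ X, (∀ w ∈ W, x • w = w) → x • u = u}
        zero_mem' := ⟨U.zero_mem, fun x _ _ => smul_zero x⟩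
        add_mem' := fun {a b} ha hb => ⟨U.add_mem ha.1 hb.1, fun x hx h => by
          rw [smul_add, ha.2 x hx h, hb.2 x hx h]⟩
        neg_mem' := fun {a} ha => ⟨U.neg_mem ha.1, fun x hx h => by
          rw [smul_neg, ha.2 x hx h]⟩ }
    have hZU : Z = U := by
      refine hU.eq_of_le Z (fun z hz => hz.1) ?_ (smul_mem_sup ?_ ?_)
      · intro h
        apply hW.ne_bot
        rw [eq_bot_iff, ← h]
        exact fun w hw => ⟨hWU hw, fun x _ hx => hx w hw⟩
      · refine fun x₀ hx₀ z hz => ⟨hUX x₀ hx₀ z hz.1, fun x hx h => ?_⟩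
        have h1 := hz.2 (x₀⁻¹ * x * x₀) (X.mul_mem (X.mul_mem (X.inv_mem hx₀) hx) hx₀) (by
          intro w hw
          rw [mul_smul, mul_smul, h _ (hW.smul_mem x₀ hx₀ w hw), inv_smul_smul])
        rw [mul_smul, mul_smul, inv_smul_eq_iff] at h1
        exact h1
      · refine fun y hy z hz => ⟨hUY y hy z hz.1, fun x hx h => ?_⟩
        rw [smul_smul, hXY x hx y hy, mul_smul, hz.2 x hx h]
    intro x hx h u hu
    have hu' : u ∈ Z := hZU ▸ hu
    exact hu'.2 x hx h

lemma two_pow_two_pow_le_card [Finite V] (ℰ : Finset (Subgroup G)) (U : AddSubgroup V)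
    (hcomm : ∀ E ∈ ℰ, ∀ E' ∈ ℰ, E ≠ E' → ∀ x ∈ E, ∀ y ∈ E', x * y = y * x)
    (hU : ActsIrreducibly (ℰ.sup id) U)
    (hnonab : ∀ E ∈ ℰ, ∃ a ∈ E, ∃ b ∈ E, ∃ u ∈ U, (a * b) • u ≠ (b * a) • u) :
    2 ^ 2 ^ ℰ.card ≤ Nat.card U := by
  classical
  induction ℰ using Finset.induction_on generalizing U with
  | empty =>
    have : Nontrivial U := (AddSubgroup.nontrivial_iff_ne_bot U).2 hU.ne_bot
    simpa [Nat.succ_le_iff] using Finite.one_lt_card (α := U)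
  | insert E ℰ hE ih =>
    rw [Finset.sup_insert, sup_comm, id] at hU
    have hXY : ∀ x ∈ ℰ.sup id, ∀ y ∈ E, x * y = y * x := by
      have : ℰ.sup id ≤ Subgroup.centralizer (E : Set G) := by
        refine Finset.sup_le fun E' hE' x hx => Subgroup.mem_centralizer_iff.2 fun y hy => ?_
        exact hcomm E (Finset.mem_insert_self _ _) E' (Finset.mem_insert_of_mem hE')
          (fun h => hE (h ▸ hE')) y hy x hx
      exact fun x hx y hy => (Subgroup.mem_centralizer_iff.1 (this hx) y hy).symm
    obtain ⟨W, hWU, hW, hcard, htriv⟩ :=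
      hU.exists_sq_card_le hXY (hnonab E (Finset.mem_insert_self _ _))
    have h1 := ih W (fun E' hE' E'' hE'' => hcomm E' (Finset.mem_insert_of_mem hE') E''
      (Finset.mem_insert_of_mem hE'')) hW (by
        intro E' hE'
        obtain ⟨a, ha, b, hb, u, hu, hne⟩ := hnonab E' (Finset.mem_insert_of_mem hE')
        refine ⟨a, ha, b, hb, ?_⟩
        by_contra! hcon
        have hle : E' ≤ ℰ.sup id := Finset.le_sup (f := id) hE'
        have h2 := htriv ((b * a)⁻¹ * (a * b)) (hle (E'.mul_mem (E'.inv_mem (E'.mul_mem hb ha))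
          (E'.mul_mem ha hb))) (fun w hw => by
            rw [mul_smul, hcon w hw, inv_smul_smul]) u hu
        rw [mul_smul, inv_smul_eq_iff] at h2
        exact hne h2)
    rw [Finset.card_insert_of_notMem hE, pow_succ 2 ℰ.card, pow_mul]
    exact (Nat.pow_le_pow_left h1 2).trans hcard

end Irreducible

open scoped Pointwise in
/-- A nontrivial decomposition of `V` as a direct sum of subgroups permuted by `G`. -/
structure IsImprimitivitySystem (G : Type*) {V : Type*} [Group G] [AddCommGroup V]
    [DistribMulAction G V] (ℋ : Set (AddSubgroup V)) : Prop where
  nontrivial : ℋ.Nontrivial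
  ne_bot : ∀ H ∈ ℋ, H ≠ ⊥
  sSupIndep : sSupIndep ℋ
  sSup_eq : sSup ℋ = ⊤
  smul_mem : ∀ H ∈ ℋ, ∀ g : G, g • H ∈ ℋ

section Clifford

open scoped Pointwise

variable {G V R : Type*} [Group G] [AddCommGroup V] [DistribMulAction G V] [Ring R] [Module R V]

/-- The translate of a submodule by a group element normalizing the scalars. -/
def translateSubmodule (hRG : ∀ (g : G) (r : R), ∃ r' : R, ∀ v : V, r • g • v = g • r' • v)
    (g : G) (m : Submodule R V) : Submodule R V where
  carrier := {v | g⁻¹ • v ∈ m}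
  zero_mem' := by simp
  add_mem' {a b} ha hb := by
    change g⁻¹ • (a + b) ∈ m
    rw [smul_add]
    exact m.add_mem ha hb
  smul_mem' r v hv := by
    obtain ⟨r', hr'⟩ := hRG g r
    change g⁻¹ • r • v ∈ m
    have h1 := hr' (g⁻¹ • v)
    rw [smul_inv_smul] at h1
    rw [h1, inv_smul_smul]
    exact m.smul_mem r' hv

variable (hRG : ∀ (g : G) (r : R), ∃ r' : R, ∀ v : V, r • g • v = g • r' • v)

lemma mem_translateSubmodule {g : G} {m : Submodule R V} {v : V} :
    v ∈ translateSubmodule hRG g m ↔ g⁻¹ • v ∈ m := Iff.rfl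

/-- Translation by a group element is an automorphism of the lattice of submodules. -/
def translateOrderIso (g : G) : Submodule R V ≃o Submodule R V where
  toFun := translateSubmodule hRG g
  invFun := translateSubmodule hRG g⁻¹
  left_inv m := by ext v; simp [mem_translateSubmodule]
  right_inv m := by ext v; simp [mem_translateSubmodule]
  map_rel_iff' {m m'} := by
    constructor
    · intro h v hv
      have h1 : g • v ∈ translateSubmodule hRG g m := by simpa [mem_translateSubmodule] using hv
      simpa [mem_translateSubmodule] using h h1
    · exact fun h v hv => h hv

lemma mem_translateOrderIso {g : G} {m : Submodule R V} {v : V} :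
    v ∈ translateOrderIso hRG g m ↔ g⁻¹ • v ∈ m := Iff.rfl

lemma translateOrderIso_linearEquiv (g : G) {m m' : Submodule R V} (e : m ≃ₗ[R] m') :
    Nonempty (translateOrderIso hRG g m ≃ₗ[R] translateOrderIso hRG g m') := by
  have key : ∀ (r r' : R), (∀ v : V, r • g • v = g • r' • v) → ∀ v : V,
      g⁻¹ • r • v = r' • g⁻¹ • v := by
    intro r r' h v
    have h1 := h (g⁻¹ • v)
    rw [smul_inv_smul] at h1
    rw [h1, inv_smul_smul]
  refine ⟨{
    toFun := fun x => ⟨g • (e ⟨g⁻¹ • (x : V), x.2⟩ : V), by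
      rw [mem_translateOrderIso, inv_smul_smul]; exact (e _).2⟩
    invFun := fun x => ⟨g • (e.symm ⟨g⁻¹ • (x : V), x.2⟩ : V), by
      rw [mem_translateOrderIso, inv_smul_smul]; exact (e.symm _).2⟩
    left_inv := fun x => by simp
    right_inv := fun x => by simp
    map_add' := fun x y => Subtype.ext ?_
    map_smul' := fun r x => Subtype.ext ?_ }⟩
  · have h1 : (⟨g⁻¹ • ((x + y : translateOrderIso hRG g m) : V), (x + y).2⟩ : m) =
        ⟨g⁻¹ • (x : V), x.2⟩ + ⟨g⁻¹ • (y : V), y.2⟩ := Subtype.ext (smul_add _ _ _)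
    change g • (e _ : V) = g • (e _ : V) + g • (e _ : V)
    rw [h1, map_add, Submodule.coe_add, smul_add]
  · obtain ⟨r', hr'⟩ := hRG g r
    have h1 : (⟨g⁻¹ • ((r • x : translateOrderIso hRG g m) : V), (r • x).2⟩ : m) =
        r' • ⟨g⁻¹ • (x : V), x.2⟩ := Subtype.ext (key r r' hr' x)
    change g • (e _ : V) = r • g • (e _ : V)
    rw [h1, map_smul, Submodule.coe_smul, hr']

lemma translateOrderIso_mem_isotypicComponents (g : G) {c : Submodule R V}
    (hc : c ∈ isotypicComponents R V) : translateOrderIso hRG g c ∈ isotypicComponents R V := by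
  obtain ⟨S, hS, rfl⟩ := hc
  refine ⟨translateOrderIso hRG g S, ?_, ?_⟩
  · rw [isSimpleModule_iff_isAtom] at hS ⊢
    exact (OrderIso.isAtom_iff _ _).2 hS
  · rw [isotypicComponent, OrderIso.map_sSup, isotypicComponent, ← sSup_image]
    congr 1
    ext m
    constructor
    · rintro ⟨m, ⟨e⟩, rfl⟩
      exact translateOrderIso_linearEquiv hRG g e
    · rintro ⟨e⟩
      refine ⟨translateOrderIso hRG g⁻¹ m, ?_, (translateOrderIso hRG g).apply_symm_apply m⟩
      obtain ⟨e'⟩ := translateOrderIso_linearEquiv hRG g⁻¹ e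
      have h1 : translateOrderIso hRG g⁻¹ (translateOrderIso hRG g S) = S :=
        (translateOrderIso hRG g).symm_apply_apply S
      exact ⟨e'.trans (LinearEquiv.ofEq _ _ h1)⟩

lemma Submodule.sSup_image_toAddSubgroup (s : Set (Submodule R V)) :
    sSup (Submodule.toAddSubgroup '' s) = (sSup s).toAddSubgroup := by
  apply le_antisymm
  · apply sSup_le
    rintro _ ⟨m, hm, rfl⟩
    exact fun v hv => (le_sSup hm : m ≤ sSup s) hv
  · let N : Submodule R V :=
      { sSup (Submodule.toAddSubgroup '' s) with
        smul_mem' := by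
          intro r v hv
          have h1 : sSup (Submodule.toAddSubgroup '' s) ≤
              (sSup (Submodule.toAddSubgroup '' s)).comap (DistribSMul.toAddMonoidHom V r) := by
            apply sSup_le
            rintro _ ⟨m, hm, rfl⟩ w hw
            exact (le_sSup ⟨m, hm, rfl⟩ :
              m.toAddSubgroup ≤ sSup (Submodule.toAddSubgroup '' s)) (m.smul_mem r hw)
          exact h1 hv }
    have h1 : sSup s ≤ N := sSup_le fun m hm v hv =>
      (le_sSup ⟨m, hm, rfl⟩ : m.toAddSubgroup ≤ sSup (Submodule.toAddSubgroup '' s)) hv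
    exact h1

theorem annihilator_faithful_or_exists_imprimitivitySystem [Finite V]
    (hRG : ∀ (g : G) (r : R), ∃ r' : R, ∀ v : V, r • g • v = g • r' • v)
    (hirr : ActsIrreducibly (⊤ : Subgroup G) (⊤ : AddSubgroup V)) :
    (∀ W : Submodule R V, W ≠ ⊥ → ∀ r : R, (∀ w ∈ W, r • w = 0) → ∀ v : V, r • v = 0) ∨
      ∃ ℋ : Set (AddSubgroup V), IsImprimitivitySystem G ℋ := by
  have hfin : Finite (Submodule R V) := inferInstance
  have hatom : ∀ W : Submodule R V, W ≠ ⊥ → ∃ S ≤ W, IsSimpleModule R S := by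
    intro W hW
    obtain ⟨S, hS, hSW⟩ := (eq_bot_or_exists_atom_le W).resolve_left hW
    exact ⟨S, hSW, isSimpleModule_iff_isAtom.2 hS⟩
  have htop : (⊤ : Submodule R V) ≠ ⊥ := by
    intro h
    apply hirr.ne_bot
    rw [eq_bot_iff]
    intro v _
    have : v ∈ (⊤ : Submodule R V) := trivial
    rw [h] at this
    exact this
  obtain ⟨S₀, -, hS₀⟩ := hatom ⊤ htop
  have hsimp : sSup {m : Submodule R V | IsSimpleModule R m} = ⊤ := by
    have h1 : (sSup {m : Submodule R V | IsSimpleModule R m}).toAddSubgroup = ⊤ := by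
      apply hirr.eq_of_le _ le_top
      · intro h
        have h2 : S₀ = ⊥ := by
          rw [eq_bot_iff]
          intro v hv
          have h3 : v ∈ (sSup {m : Submodule R V | IsSimpleModule R m}).toAddSubgroup :=
            (le_sSup hS₀ : S₀ ≤ sSup {m : Submodule R V | IsSimpleModule R m}) hv
          rw [h] at h3
          exact h3
        exact (isSimpleModule_iff_isAtom.1 hS₀).1 h2
      · intro g _ w hw
        have h2 : sSup {m : Submodule R V | IsSimpleModule R m} ≤
            translateOrderIso hRG g⁻¹ (sSup {m : Submodule R V | IsSimpleModule R m}) := by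
          apply sSup_le
          intro m hm
          have h3 : IsSimpleModule R (translateOrderIso hRG g m) := by
            rw [isSimpleModule_iff_isAtom]
            exact (OrderIso.isAtom_iff _ _).2 (isSimpleModule_iff_isAtom.1 hm)
          intro v hv
          rw [mem_translateOrderIso, inv_inv]
          refine (le_sSup h3 : translateOrderIso hRG g m ≤ _) ?_
          rw [mem_translateOrderIso, inv_smul_smul]
          exact hv
        have h3 := h2 hw
        rwa [mem_translateOrderIso, inv_inv] at h3
    rw [eq_top_iff]
    intro v _
    have : v ∈ (⊤ : AddSubgroup V) := trivial
    rw [← h1] at this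
    exact this
  have hss : IsSemisimpleModule R V := .of_sSup_simples_eq_top hsimp
  by_cases hnt : (isotypicComponents R V).Nontrivial
  · right
    have hinj : Function.Injective (Submodule.toAddSubgroup : Submodule R V → AddSubgroup V) :=
      Submodule.toAddSubgroup_injective
    refine ⟨Submodule.toAddSubgroup '' isotypicComponents R V, hnt.image hinj, ?_, ?_, ?_, ?_⟩
    · rintro _ ⟨c, hc, rfl⟩ h
      exact (bot_lt_isotypicComponents hc).ne' (hinj (h.trans Submodule.bot_toAddSubgroup.symm))
    · rintro _ ⟨c, hc, rfl⟩
      rw [← Set.image_singleton, ← Set.image_sdiff hinj, Submodule.sSup_image_toAddSubgroup]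
      have h1 := (sSupIndep_isotypicComponents R V) hc
      rw [Submodule.disjoint_def] at h1
      rw [AddSubgroup.disjoint_def]
      exact fun {v} hv hv' => h1 v hv hv'
    · rw [Submodule.sSup_image_toAddSubgroup, sSup_isotypicComponents]
      rfl
    · rintro _ ⟨c, hc, rfl⟩ g
      refine ⟨translateOrderIso hRG g c, translateOrderIso_mem_isotypicComponents hRG g hc, ?_⟩
      ext v
      rw [AddSubgroup.mem_pointwise_smul_iff_inv_smul_mem]
      rfl
  · left
    rw [Set.not_nontrivial_iff] at hnt
    have hcomp : ∀ S : Submodule R V, IsSimpleModule R S → isotypicComponent R V S = ⊤ := by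
      intro S hS
      rw [← sSup_isotypicComponents R V]
      apply le_antisymm
      · exact le_sSup ⟨S, hS, rfl⟩
      · exact sSup_le fun c hc => (hnt hc ⟨S, hS, rfl⟩).le
    intro W hW r hr v
    obtain ⟨S, hSW, hS⟩ := hatom W hW
    let Z : Submodule R V :=
      { carrier := {v | ∀ r : R, (∀ w ∈ S, r • w = 0) → r • v = 0}
        zero_mem' := fun r _ => smul_zero r
        add_mem' := fun {a b} ha hb r h => by rw [smul_add, ha r h, hb r h, add_zero]
        smul_mem' := fun t v hv r h => by
          rw [smul_smul]
          exact hv (r * t) fun w hw => by rw [mul_smul]; exact h _ (S.smul_mem t hw) }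
    have hZ : (⊤ : Submodule R V) ≤ Z := by
      rw [← hcomp S hS, isotypicComponent]
      apply sSup_le
      rintro m ⟨e⟩ v hv t ht
      have h1 : e (t • ⟨v, hv⟩) = 0 := by
        rw [map_smul]
        exact Subtype.ext (ht _ (e ⟨v, hv⟩).2)
      rw [LinearEquiv.map_eq_zero_iff] at h1
      exact congrArg Subtype.val h1
    exact hZ (x := v) trivial r fun w hw => hr w (hSW hw)

end Clifford

section Imprimitive

open scoped Pointwise

variable {G V : Type*} [Group G] [AddCommGroup V] [DistribMulAction G V]

lemma exists_smul_ne_of_sSup_eq_top {ℋ : Set (AddSubgroup V)} (hℋ : sSup ℋ = ⊤) {g : G}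
    (hg : ∀ H ∈ ℋ, ∀ v ∈ H, g • v = v) (v : V) : g • v = v := by
  let Z : AddSubgroup V :=
    { carrier := {v | g • v = v}
      zero_mem' := smul_zero g
      add_mem' := fun {a b} ha hb => by
        change g • (a + b) = a + b
        rw [smul_add, show g • a = a from ha, show g • b = b from hb]
      neg_mem' := fun {a} ha => by
        change g • (-a) = -a
        rw [smul_neg, show g • a = a from ha] }
  have h1 : (⊤ : AddSubgroup V) ≤ Z := hℋ ▸ sSup_le fun H hH v hv => hg H hH v hv
  exact h1 (x := v) trivial

namespace IsImprimitivitySystem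

variable {ℋ : Set (AddSubgroup V)}

lemma actsIrreducibly (h : IsImprimitivitySystem G ℋ)
    (hirr : ActsIrreducibly (⊤ : Subgroup G) (⊤ : AddSubgroup V)) {H : AddSubgroup V}
    (hH : H ∈ ℋ) : ActsIrreducibly (MulAction.stabilizer G H) H := by
  have hst : ∀ x ∈ MulAction.stabilizer G H, ∀ u ∈ H, x • u ∈ H := by
    intro x hx u hu
    have h1 : x • u ∈ x • H := AddSubgroup.smul_mem_pointwise_smul u x H hu
    rwa [MulAction.mem_stabilizer_iff.1 hx] at h1
  refine ⟨h.ne_bot H hH, hst, fun W hW hWb hWinv => ?_⟩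
  have h1 : (⨆ g : G, g • W) = ⊤ := by
    refine hirr.eq_of_le _ le_top ?_ ?_
    · intro hb
      apply hWb
      rw [eq_bot_iff, ← hb]
      exact (one_smul G W).symm.le.trans (le_iSup (fun g : G => g • W) 1)
    · intro x _ w hw
      have h2 : (⨆ g : G, g • W) ≤
          (⨆ g : G, g • W).comap (DistribSMul.toAddMonoidHom V x) := by
        refine iSup_le fun g v hv => ?_
        have h3 : x • v ∈ (x * g) • W := by
          rw [mul_smul]
          exact AddSubgroup.smul_mem_pointwise_smul v x _ hv
        exact (le_iSup (fun g : G => g • W) (x * g)) h3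
      exact h2 hw
  have h2 : (⊤ : AddSubgroup V) ≤ W ⊔ sSup (ℋ \ {H}) := by
    rw [← h1]
    refine iSup_le fun g => ?_
    by_cases hg : g • H = H
    · refine le_trans (fun v hv => ?_) le_sup_left
      rw [AddSubgroup.mem_pointwise_smul_iff_inv_smul_mem] at hv
      have := hWinv g hg _ hv
      rwa [smul_inv_smul] at this
    · refine le_trans ?_ le_sup_right
      refine le_trans ?_ (le_sSup (a := g • H) ⟨h.smul_mem H hH g, hg⟩)
      exact AddSubgroup.pointwise_smul_le_pointwise_smul_iff.2 hW
  apply le_antisymm hW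
  intro v hv
  obtain ⟨w, hw, z, hz, hwz⟩ := AddSubgroup.mem_sup.1 (h2 (x := v) trivial)
  have hzH : z ∈ H := by
    have : z = v - w := by rw [← hwz]; abel
    rw [this]
    exact H.sub_mem hv (hW hw)
  have hz0 := AddSubgroup.disjoint_def.1 (h.sSupIndep hH) hzH hz
  rw [← hwz, hz0, add_zero]
  exact hw

lemma card_lt [Finite V] (h : IsImprimitivitySystem G ℋ) {H : AddSubgroup V} (hH : H ∈ ℋ) :
    Nat.card H < Nat.card V := by
  refine lt_of_le_of_ne (AddSubgroup.card_le_card_addGroup H) fun hcard => ?_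
  have htop := AddSubgroup.eq_top_of_card_eq H hcard
  obtain ⟨H', hH', hne⟩ := h.nontrivial.exists_ne H
  have h1 := (h.sSupIndep hH).mono_right (le_sSup (s := ℋ \ {H}) (a := H') ⟨hH', hne⟩)
  rw [htop, top_disjoint] at h1
  exact h.ne_bot H' hH' h1

lemma prod_card_le [Finite V] [Fintype ℋ] (h : IsImprimitivitySystem G ℋ) :
    ∏ H : ℋ, Nat.card H.1 ≤ Nat.card V := by
  classical
  have h1 := iSupIndep.dfinsuppSumAddHom_injective ((sSupIndep_iff ℋ).1 h.sSupIndep)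
  rw [← Nat.card_pi, ← Nat.card_congr (DFinsupp.equivFunOnFintype (β := fun H : ℋ => H.1))]
  exact Nat.card_le_card_of_injective _ h1

theorem card_le [Finite G] [Finite V] (h : IsImprimitivitySystem G ℋ) {d c : ℕ}
    (hsec : SectionsHaveSmallIndex d G) (hfaith : ∀ g : G, (∀ v : V, g • v = v) → g = 1)
    (hirr : ActsIrreducibly (⊤ : Subgroup G) (⊤ : AddSubgroup V))
    (ih : ∀ (S : Subgroup G) (H : AddSubgroup V) (hS : ActsIrreducibly S H),
      Nat.card H < Nat.card V →
      Nat.card (restrictHom S H hS.smul_mem).range * 2 ^ d ≤ Nat.card H ^ c) :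
    Nat.card G * 2 ^ d ≤ Nat.card V ^ c := by
  have hfin : Fintype ℋ := Fintype.ofFinite ℋ
  have hne : Nonempty ℋ := h.nontrivial.nonempty.to_subtype
  have hst : ∀ H : ℋ, ActsIrreducibly (MulAction.stabilizer G H.1) H.1 :=
    fun H => h.actsIrreducibly hirr H.2
  let act : MulAction G ℋ :=
    { smul := fun g H => ⟨g • H.1, h.smul_mem H.1 H.2 g⟩
      one_smul := fun H => Subtype.ext (one_smul G H.1)
      mul_smul := fun g g' H => Subtype.ext (mul_smul g g' H.1) }
  let P : G →* Equiv.Perm ℋ := MulAction.toPermHom G ℋ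
  have hPker : ∀ g ∈ P.ker, ∀ H : ℋ, g ∈ MulAction.stabilizer G H.1 := by
    intro g hg H
    have h1 : P g H = H := by rw [MonoidHom.mem_ker.1 hg]; rfl
    exact congrArg Subtype.val h1
  let r : ℋ → ℕ := fun H => Nat.card (restrictHom _ H.1 (hst H).smul_mem).range
  have hker : Nat.card P.ker ≤ ∏ H, r H := by
    rw [← Nat.card_pi]
    refine Nat.card_le_card_of_injective
      (fun (q : P.ker) (H : ℋ) => (⟨restrictHom _ H.1 (hst H).smul_mem ⟨q, hPker q q.2 H⟩, ⟨_, rfl⟩⟩ :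
        (restrictHom _ H.1 (hst H).smul_mem).range)) ?_
    intro q q' hqq
    have h1 : (q' : G)⁻¹ * q = 1 := by
      refine hfaith _ (exists_smul_ne_of_sSup_eq_top h.sSup_eq fun H hH v hv => ?_)
      have h2 := congrArg Subtype.val (congrFun hqq ⟨H, hH⟩)
      have h3 := congrArg (fun f : (AddMonoid.End H)ˣ => ((f : AddMonoid.End H) ⟨v, hv⟩ : V)) h2
      have h4 : (q : G) • v = (q' : G) • v := h3
      rw [mul_smul, h4, inv_smul_smul]
    exact Subtype.ext (inv_mul_eq_one.1 h1).symm
  have hG : Nat.card G = Nat.card P.range * Nat.card P.ker := by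
    rw [Subgroup.card_eq_card_quotient_mul_card_subgroup P.ker,
      Nat.card_congr (QuotientGroup.quotientKerEquivRange P).toEquiv]
  have hrange := hsec.card_range_perm_le P
  have hpos : 0 < Nat.card ℋ := Nat.card_pos
  calc Nat.card G * 2 ^ d ≤ (2 ^ (d * (Nat.card ℋ - 1)) * ∏ H, r H) * 2 ^ d := by
        rw [hG]; gcongr
    _ = (2 ^ d) ^ Nat.card ℋ * ∏ H, r H := by
        obtain ⟨m, hm⟩ : ∃ m, Nat.card ℋ = m + 1 := ⟨Nat.card ℋ - 1, by omega⟩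
        rw [hm, Nat.add_sub_cancel, pow_mul, pow_succ]
        ring
    _ = ∏ H, r H * 2 ^ d := by
        rw [Finset.prod_mul_distrib, Finset.prod_const, Finset.card_univ, Nat.card_eq_fintype_card,
          mul_comm]
    _ ≤ ∏ H : ℋ, Nat.card H.1 ^ c :=
        Finset.prod_le_prod' fun H _ => ih _ H.1 (hst H) (h.card_lt H.2)
    _ = (∏ H : ℋ, Nat.card H.1) ^ c := Finset.prod_pow _ _ _
    _ ≤ Nat.card V ^ c := Nat.pow_le_pow_left h.prod_card_le c

end IsImprimitivitySystem

end Imprimitive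

@[to_additive]
lemma Subgroup.exists_finset_card_le_log_closure_eq_top (G : Type*) [Group G] [Finite G] :
    ∃ s : Finset G, s.card ≤ Nat.log 2 (Nat.card G) ∧ Subgroup.closure (s : Set G) = ⊤ := by
  classical
  have key : ∀ n : ℕ, ∃ s : Finset G, s.card ≤ n ∧ (Subgroup.closure (s : Set G) = ⊤ ∨
      2 ^ n ≤ Nat.card (Subgroup.closure (s : Set G))) := by
    intro n
    induction n with
    | zero => exact ⟨∅, le_rfl, Or.inr Nat.card_pos⟩
    | succ n ih =>
      obtain ⟨s, hs, h | h⟩ := ih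
      · exact ⟨s, hs.trans n.le_succ, Or.inl h⟩
      · by_cases hcl : Subgroup.closure (s : Set G) = ⊤
        · exact ⟨s, hs.trans n.le_succ, Or.inl hcl⟩
        · obtain ⟨x, hx⟩ : ∃ x, x ∉ Subgroup.closure (s : Set G) := by
            by_contra! hcon
            exact hcl (by ext y; simp [hcon y])
          refine ⟨insert x s, (Finset.card_insert_le _ _).trans (by omega), Or.inr ?_⟩
          have hle : Subgroup.closure (s : Set G) ≤
              Subgroup.closure ((insert x s : Finset G) : Set G) :=
            Subgroup.closure_mono (by simp)
          have hxm : x ∈ Subgroup.closure ((insert x s : Finset G) : Set G) :=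
            Subgroup.subset_closure (by simp)
          obtain ⟨k, hk⟩ := Subgroup.card_dvd_of_le hle
          have hlt : Nat.card (Subgroup.closure (s : Set G)) <
              Nat.card (Subgroup.closure ((insert x s : Finset G) : Set G)) := by
            refine lt_of_le_of_ne (Nat.le_of_dvd Nat.card_pos ⟨k, hk⟩) fun heq => hx ?_
            rwa [Subgroup.eq_of_le_of_card_ge hle heq.ge]
          have hk2 : 2 ≤ k := by
            by_contra! hk2
            have hk1 : k ≤ 1 := by omega
            have h1 := Nat.mul_le_mul_left (Nat.card (Subgroup.closure (s : Set G))) hk1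
            omega
          rw [hk, pow_succ]
          exact Nat.mul_le_mul h hk2
  obtain ⟨s, hs, h | h⟩ := key (Nat.log 2 (Nat.card G))
  · exact ⟨s, hs, h⟩
  · refine ⟨s, hs, ?_⟩
    have h1 : Nat.card G < 2 ^ (Nat.log 2 (Nat.card G) + 1) :=
      Nat.lt_pow_succ_log_self one_lt_two _
    rw [pow_succ] at h1
    have h2 := Subgroup.card_mul_index (Subgroup.closure (s : Set G))
    have h3 : (Subgroup.closure (s : Set G)).index < 2 := by
      by_contra! hcon
      have := Nat.mul_le_mul h hcon
      omega
    have h4 : (Subgroup.closure (s : Set G)).index ≠ 0 := Subgroup.index_ne_zero_of_finite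
    exact Subgroup.index_eq_one.1 (by omega)

lemma AddMonoid.End.card_le (V : Type*) [AddCommGroup V] [Finite V] :
    Nat.card (AddMonoid.End V) ≤ Nat.card V ^ Nat.log 2 (Nat.card V) := by
  obtain ⟨s, hs, hcl⟩ := AddSubgroup.exists_finset_card_le_log_closure_eq_top V
  have hinj : Function.Injective (fun (f : AddMonoid.End V) (x : s) => f x) := by
    intro f g hfg
    refine AddMonoidHom.eq_of_eqOn_dense hcl (f := (f : V →+ V)) (g := g) fun x hx => ?_
    exact congrFun hfg ⟨x, hx⟩
  refine (Nat.card_le_card_of_injective _ hinj).trans ?_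
  rw [Nat.card_fun]
  exact Nat.pow_le_pow_right Nat.card_pos (by simpa using hs)

section Envelope

variable {G V : Type*} [Group G] [AddCommGroup V] [DistribMulAction G V]

/-- The ring of endomorphisms generated by the action of a subgroup. -/
def envelope (V : Type*) [AddCommGroup V] [DistribMulAction G V] (K : Subgroup G) :
    Subring (AddMonoid.End V) :=
  Subring.closure (DistribMulAction.toAddMonoidEnd G V '' K)

lemma toAddMonoidEnd_mem_envelope {K : Subgroup G} {k : G} (hk : k ∈ K) :
    DistribMulAction.toAddMonoidEnd G V k ∈ envelope V K :=
  Subring.subset_closure ⟨k, hk, rfl⟩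

lemma envelope_apply_mem {K : Subgroup G} {W : AddSubgroup V}
    (hW : ∀ k ∈ K, ∀ w ∈ W, k • w ∈ W) {r : AddMonoid.End V} (hr : r ∈ envelope V K) :
    ∀ w ∈ W, r w ∈ W := by
  induction hr using Subring.closure_induction with
  | mem r hr =>
    obtain ⟨k, hk, rfl⟩ := hr
    exact hW k hk
  | zero => exact fun w _ => W.zero_mem
  | one => exact fun w hw => hw
  | add r s _ _ hr hs => exact fun w hw => W.add_mem (hr w hw) (hs w hw)
  | neg r _ hr => exact fun w hw => W.neg_mem (hr w hw)
  | mul r s _ _ hr hs => exact fun w hw => hr _ (hs w hw)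

lemma exists_mem_envelope_smul_comm {K : Subgroup G} [K.Normal] (g : G) {r : AddMonoid.End V}
    (hr : r ∈ envelope V K) : ∃ r' ∈ envelope V K, ∀ v : V, r (g • v) = g • r' v := by
  induction hr using Subring.closure_induction with
  | mem r hr =>
    obtain ⟨k, hk, rfl⟩ := hr
    have hK : K.Normal := inferInstance
    have h1 := hK.conj_mem k hk g⁻¹
    rw [inv_inv] at h1
    refine ⟨_, toAddMonoidEnd_mem_envelope h1, fun v => ?_⟩
    change k • g • v = g • (g⁻¹ * k * g) • v
    simp only [smul_smul]
    group
  | zero => exact ⟨0, zero_mem _, fun v => (smul_zero g).symm⟩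
  | one => exact ⟨1, one_mem _, fun v => rfl⟩
  | add r s _ _ hr hs =>
    obtain ⟨r', hr', h⟩ := hr
    obtain ⟨s', hs', h'⟩ := hs
    refine ⟨r' + s', add_mem hr' hs', fun v => ?_⟩
    change r (g • v) + s (g • v) = g • (r' v + s' v)
    rw [h, h', smul_add]
  | neg r _ hr =>
    obtain ⟨r', hr', h⟩ := hr
    refine ⟨-r', neg_mem hr', fun v => ?_⟩
    change -(r (g • v)) = g • (-(r' v))
    rw [h, smul_neg]
  | mul r s _ _ hr hs =>
    obtain ⟨r', hr', h⟩ := hr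
    obtain ⟨s', hs', h'⟩ := hs
    refine ⟨r' * s', mul_mem hr' hs', fun v => ?_⟩
    change r (s (g • v)) = g • r' (s' v)
    rw [h', h]

/-- Every normal subgroup has an enveloping ring acting faithfully on each nonzero invariant
subgroup. -/
def HasFaithfulEnvelopes (G V : Type*) [Group G] [AddCommGroup V] [DistribMulAction G V] : Prop :=
  ∀ K : Subgroup G, K.Normal → ∀ W : AddSubgroup V, W ≠ ⊥ → (∀ k ∈ K, ∀ w ∈ W, k • w ∈ W) →
    ∀ r ∈ envelope V K, (∀ w ∈ W, r w = 0) → r = 0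

lemma hasFaithfulEnvelopes_or_exists_imprimitivitySystem [Finite V]
    (hirr : ActsIrreducibly (⊤ : Subgroup G) (⊤ : AddSubgroup V)) :
    HasFaithfulEnvelopes G V ∨ ∃ ℋ : Set (AddSubgroup V), IsImprimitivitySystem G ℋ := by
  by_contra! hcon
  apply hcon.1
  intro K hK W hW hWK r hr hrW
  have hRG : ∀ (g : G) (r : envelope V K), ∃ r' : envelope V K, ∀ v : V,
      r • g • v = g • r' • v := by
    intro g r
    obtain ⟨r', hr', h⟩ := exists_mem_envelope_smul_comm g r.2
    exact ⟨⟨r', hr'⟩, h⟩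
  rcases annihilator_faithful_or_exists_imprimitivitySystem hRG hirr with h | ⟨ℋ, hℋ⟩
  · let W' : Submodule (envelope V K) V :=
      { W with smul_mem' := fun r w hw => envelope_apply_mem hWK r.2 w hw }
    ext v
    refine h W' (fun hb => hW ?_) ⟨r, hr⟩ hrW v
    rw [eq_bot_iff]
    intro w hw
    have h1 : w ∈ W' := hw
    rw [hb] at h1
    exact h1
  · exact (hcon.2 ℋ hℋ).elim

lemma HasFaithfulEnvelopes.eq_one (h : HasFaithfulEnvelopes G V)
    (hfaith : ∀ g : G, (∀ v : V, g • v = v) → g = 1) {K : Subgroup G} (hK : K.Normal)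
    {W : AddSubgroup V} (hW : W ≠ ⊥) (hWK : ∀ k ∈ K, ∀ w ∈ W, k • w ∈ W) {k : G} (hk : k ∈ K)
    (hkW : ∀ w ∈ W, k • w = w) : k = 1 := by
  have h1 := h K hK W hW hWK (DistribMulAction.toAddMonoidEnd G V k - 1)
    (sub_mem (toAddMonoidEnd_mem_envelope hk) (one_mem _))
    (fun w hw => sub_eq_zero.2 (hkW w hw))
  exact hfaith k fun v => DFunLike.congr_fun (sub_eq_zero.1 h1) v

end Envelope

lemma Subgroup.index_centralizer_le_of_isCyclic {G : Type*} [Group G] [Finite G] {A : Subgroup G}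
    [hA : A.Normal] [hcyc : IsCyclic A] :
    (Subgroup.centralizer (A : Set G)).index ≤ Nat.card A := by
  obtain ⟨⟨a, ha⟩, hgen⟩ := hcyc.exists_generator
  have key : ∀ g h : G, g * a * g⁻¹ = h * a * h⁻¹ →
      g⁻¹ * h ∈ Subgroup.centralizer (A : Set G) := by
    intro g h hgh
    rw [Subgroup.mem_centralizer_iff]
    intro b hb
    obtain ⟨k, hk⟩ := Subgroup.mem_zpowers_iff.1 (hgen ⟨b, hb⟩)
    have hk' : a ^ k = b := congrArg Subtype.val hk
    have h1 : Commute a (g⁻¹ * h) := by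
      change a * (g⁻¹ * h) = g⁻¹ * h * a
      calc a * (g⁻¹ * h) = g⁻¹ * (g * a * g⁻¹) * h := by group
        _ = g⁻¹ * h * a := by rw [hgh]; group
    rw [← hk']
    exact (h1.zpow_left k).eq
  let f : G ⧸ Subgroup.centralizer (A : Set G) → A := fun q =>
    ⟨q.out * a * q.out⁻¹, hA.conj_mem a ha _⟩
  rw [Subgroup.index]
  refine Nat.card_le_card_of_injective f fun p q hpq => ?_
  have h1 := key _ _ (congrArg Subtype.val hpq)
  rw [← QuotientGroup.out_eq' p, ← QuotientGroup.out_eq' q]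
  exact QuotientGroup.eq.2 h1

section Envelope

variable {G V : Type*} [Group G] [AddCommGroup V] [DistribMulAction G V]

lemma envelope_commute {A : Subgroup G} (hA : ∀ x ∈ A, ∀ y ∈ A, x * y = y * x)
    {r s : AddMonoid.End V} (hr : r ∈ envelope V A) (hs : s ∈ envelope V A) : r * s = s * r := by
  have h1 : ∀ x ∈ DistribMulAction.toAddMonoidEnd G V '' A,
      ∀ y ∈ DistribMulAction.toAddMonoidEnd G V '' A, x * y = y * x := by
    rintro _ ⟨x, hx, rfl⟩ _ ⟨y, hy, rfl⟩
    rw [← map_mul, ← map_mul, hA x hx y hy]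
  exact congrArg Subtype.val ((Subring.isMulCommutative_closure h1).is_comm.comm ⟨r, hr⟩ ⟨s, hs⟩)

lemma HasFaithfulEnvelopes.eq_zero_of_apply_eq_zero (h : HasFaithfulEnvelopes G V)
    {A : Subgroup G} (hAn : A.Normal) (hA : ∀ x ∈ A, ∀ y ∈ A, x * y = y * x)
    {r : AddMonoid.End V} (hr : r ∈ envelope V A) {v : V} (hv : v ≠ 0) (hrv : r v = 0) :
    r = 0 := by
  refine h A hAn (AddMonoidHom.ker (r : V →+ V)) ?_ ?_ r hr fun w hw => hw
  · intro hb
    have h1 : v ∈ AddMonoidHom.ker (r : V →+ V) := hrv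
    rw [hb] at h1
    exact hv h1
  · intro k hk w hw
    have h1 := DFunLike.congr_fun (envelope_commute hA hr (toAddMonoidEnd_mem_envelope hk)) w
    change r (k • w) = 0
    change r (k • w) = k • r w at h1
    rw [h1, show r w = 0 from hw, smul_zero]

lemma HasFaithfulEnvelopes.isCyclic [Finite G] [Nontrivial V] (h : HasFaithfulEnvelopes G V)
    (hfaith : ∀ g : G, (∀ v : V, g • v = v) → g = 1)
    {A : Subgroup G} (hAn : A.Normal) (hA : ∀ x ∈ A, ∀ y ∈ A, x * y = y * x) : IsCyclic A := by
  let _ : CommRing (envelope V A) :=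
    { (inferInstance : Ring (envelope V A)) with
      mul_comm := fun r s => Subtype.ext (envelope_commute hA r.2 s.2) }
  obtain ⟨v₀, hv₀⟩ := exists_ne (0 : V)
  have hnt : Nontrivial (envelope V A) :=
    ⟨0, 1, fun h01 => hv₀ (DFunLike.congr_fun (congrArg Subtype.val h01) v₀).symm⟩
  have hnz : NoZeroDivisors (envelope V A) := by
    refine ⟨fun {r s} hrs => ?_⟩
    by_contra! hcon
    apply hcon.2
    apply Subtype.ext
    ext v
    by_contra hv
    exact hcon.1 (Subtype.ext (h.eq_zero_of_apply_eq_zero hAn hA r.2 hv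
      (DFunLike.congr_fun (congrArg Subtype.val hrs) v)))
  have hdom : IsDomain (envelope V A) := NoZeroDivisors.to_isDomain _
  let f : A →* envelope V A :=
    { toFun := fun a => ⟨DistribMulAction.toAddMonoidEnd G V a, toAddMonoidEnd_mem_envelope a.2⟩
      map_one' := Subtype.ext (map_one _)
      map_mul' := fun a b => Subtype.ext (map_mul _ (a : G) (b : G)) }
  refine isCyclic_of_injective_ringHom f fun a b hab => ?_
  have h1 := congrArg Subtype.val hab
  have h2 : ((b : G)⁻¹ * a : G) = 1 := hfaith _ fun v => by
    rw [mul_smul, inv_smul_eq_iff]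
    exact DFunLike.congr_fun h1 v
  exact Subtype.ext (inv_mul_eq_one.1 h2).symm

lemma HasFaithfulEnvelopes.card_le [Finite V] [Nontrivial V] (h : HasFaithfulEnvelopes G V)
    (hfaith : ∀ g : G, (∀ v : V, g • v = v) → g = 1)
    {A : Subgroup G} (hAn : A.Normal) (hA : ∀ x ∈ A, ∀ y ∈ A, x * y = y * x) :
    Nat.card A ≤ Nat.card V := by
  obtain ⟨v, hv⟩ := exists_ne (0 : V)
  refine Nat.card_le_card_of_injective (fun a : A => (a : G) • v) fun a b hab => ?_
  have h1 := h.eq_zero_of_apply_eq_zero hAn hA (sub_mem (toAddMonoidEnd_mem_envelope a.2)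
    (toAddMonoidEnd_mem_envelope b.2)) hv (sub_eq_zero.2 hab)
  have h2 : ((b : G)⁻¹ * a : G) = 1 := hfaith _ fun v => by
    rw [mul_smul, inv_smul_eq_iff]
    exact DFunLike.congr_fun (sub_eq_zero.1 h1) v
  exact Subtype.ext (inv_mul_eq_one.1 h2).symm

end Envelope

lemma Subgroup.relIndex_le_card_of_forall {G X : Type*} [Group G] [Finite X] {D C : Subgroup G}
    (f : C → X) (hf : ∀ c c' : C, f c = f c' → (c : G)⁻¹ * c' ∈ D) :
    D.relIndex C ≤ Nat.card X := by
  rw [Subgroup.relIndex, Subgroup.index]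
  refine Nat.card_le_card_of_injective (fun q : C ⧸ D.subgroupOf C => f q.out) fun p q hpq => ?_
  rw [← QuotientGroup.out_eq' p, ← QuotientGroup.out_eq' q]
  exact QuotientGroup.eq.2 (Subgroup.mem_subgroupOf.2 (hf _ _ hpq))

section Nilpotent

variable {G V : Type*} [Group G] [AddCommGroup V] [DistribMulAction G V]

lemma envelope_apply_smul {A : Subgroup G} {m : G} (hm : ∀ a ∈ A, m * a = a * m)
    {r : AddMonoid.End V} (hr : r ∈ envelope V A) : ∀ v : V, r (m • v) = m • r v := by
  induction hr using Subring.closure_induction with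
  | mem r hr =>
    obtain ⟨k, hk, rfl⟩ := hr
    intro v
    change k • m • v = m • k • v
    rw [smul_smul, smul_smul, hm k hk]
  | zero => exact fun v => (smul_zero m).symm
  | one => exact fun v => rfl
  | add r s _ _ hr hs =>
    intro v
    change r (m • v) + s (m • v) = m • (r v + s v)
    rw [hr, hs, smul_add]
  | neg r _ hr =>
    intro v
    change -(r (m • v)) = m • (-(r v))
    rw [hr, smul_neg]
  | mul r s _ _ hr hs =>
    intro v
    change r (s (m • v)) = m • r (s v)
    rw [hs, hr]

variable {A M : Subgroup G}

lemma HasFaithfulEnvelopes.coeff_eq_zero [Nontrivial V] (h : HasFaithfulEnvelopes G V)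
    (hfaith : ∀ g : G, (∀ v : V, g • v = v) → g = 1) (hAn : A.Normal)
    (hAM : ∀ m ∈ M, ∀ a ∈ A, m * a = a * m) (hA : A ≤ M)
    (hZ : ∀ x ∈ M, (∀ m ∈ M, m * x = x * m) → x ∈ A)
    (hcomm : ∀ m ∈ M, ∀ x ∈ M, m * x * m⁻¹ * x⁻¹ ∈ A)
    {ι : Type*} (x : ι → G) (hxM : ∀ i, x i ∈ M) (hx : ∀ i j, (x i)⁻¹ * x j ∈ A → i = j)
    (S : Finset ι) (r : ι → AddMonoid.End V) (hr : ∀ i, r i ∈ envelope V A)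
    (hsum : ∀ v : V, ∑ i ∈ S, r i (x i • v) = 0) : ∀ i ∈ S, r i = 0 := by
  classical
  obtain ⟨v₀, hv₀⟩ := exists_ne (0 : V)
  have hAA : ∀ a ∈ A, ∀ b ∈ A, a * b = b * a := fun a ha b hb => hAM a (hA ha) b hb
  induction S using Finset.induction_on generalizing r with
  | empty => simp
  | insert i₀ S hi₀ ih =>
    have hS : ∀ i ∈ S, r i = 0 := by
      intro i hi
      obtain ⟨m, hm, hne⟩ : ∃ m ∈ M, m * x i * m⁻¹ * (x i)⁻¹ ≠ m * x i₀ * m⁻¹ * (x i₀)⁻¹ := by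
        by_contra! hcon
        have h1 : (x i₀)⁻¹ * x i ∈ A := by
          refine hZ _ (M.mul_mem (M.inv_mem (hxM i₀)) (hxM i)) fun m hm => ?_
          set z := m * x i₀ * m⁻¹ * (x i₀)⁻¹ with hz
          have h2 : m * x i = z * x i * m := by rw [hz, ← hcon m hm]; group
          have h3 : m * x i₀ = z * x i₀ * m := by rw [hz]; group
          have h4 : x i₀ * z = z * x i₀ := hAM _ (hxM i₀) z (hcomm m hm _ (hxM i₀))
          have h5 : m * (x i₀)⁻¹ = z⁻¹ * (x i₀)⁻¹ * m := by
            rw [mul_inv_eq_iff_eq_mul, mul_assoc, h3, mul_assoc, mul_assoc, ← mul_assoc (x i₀)⁻¹,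
              ← mul_assoc ((x i₀)⁻¹ * z), mul_assoc (x i₀)⁻¹, ← h4]
            group
          calc m * ((x i₀)⁻¹ * x i) = z⁻¹ * (x i₀)⁻¹ * (m * x i) := by rw [← mul_assoc, h5]; group
            _ = z⁻¹ * ((x i₀)⁻¹ * z * x i₀) * (x i₀)⁻¹ * x i * m := by rw [h2]; group
            _ = (x i₀)⁻¹ * x i * m := by rw [mul_assoc (x i₀)⁻¹, ← h4]; group
        exact hi₀ (hx _ _ h1 ▸ hi)
      set ζ : ι → G := fun j => m * x j * m⁻¹ * (x j)⁻¹ with hζ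
      have hζA : ∀ j, ζ j ∈ A := fun j => hcomm m hm _ (hxM j)
      have hζe : ∀ j, DistribMulAction.toAddMonoidEnd G V (ζ j) -
          DistribMulAction.toAddMonoidEnd G V (ζ i₀) ∈ envelope V A := fun j =>
        sub_mem (toAddMonoidEnd_mem_envelope (hζA j)) (toAddMonoidEnd_mem_envelope (hζA i₀))
      have h1 := ih (fun j => r j * (DistribMulAction.toAddMonoidEnd G V (ζ j) -
        DistribMulAction.toAddMonoidEnd G V (ζ i₀))) (fun j => mul_mem (hr j) (hζe j)) ?_ i hi
      · have hne' : DistribMulAction.toAddMonoidEnd G V (ζ i) -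
          DistribMulAction.toAddMonoidEnd G V (ζ i₀) ≠ 0 := by
          intro h2
          apply hne
          refine (inv_mul_eq_one.1 (hfaith _ fun v => ?_)).symm
          rw [mul_smul, inv_smul_eq_iff]
          exact DFunLike.congr_fun (sub_eq_zero.1 h2) v
        by_contra hri
        refine hri (h.eq_zero_of_apply_eq_zero hAn hAA (hr i) (v := ζ i • v₀ - ζ i₀ • v₀) ?_
          (DFunLike.congr_fun h1 v₀))
        exact fun h2 => hne' (h.eq_zero_of_apply_eq_zero hAn hAA (hζe i) hv₀ h2)
      · intro v
        have h2 : ∀ j, (r j * (DistribMulAction.toAddMonoidEnd G V (ζ j) -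
            DistribMulAction.toAddMonoidEnd G V (ζ i₀))) (x j • v) =
            m • r j (x j • m⁻¹ • v) - ζ i₀ • r j (x j • v) := by
          intro j
          change r j (ζ j • x j • v - ζ i₀ • x j • v) = _
          rw [map_sub, ← envelope_apply_smul (fun a ha => hAM m hm a ha) (hr j),
            ← envelope_apply_smul (fun a ha => hAA _ (hζA i₀) a ha) (hr j)]
          congr 2
          simp only [smul_smul, hζ]
          group
        have h3 : ∑ j ∈ insert i₀ S, (r j * (DistribMulAction.toAddMonoidEnd G V (ζ j) -
            DistribMulAction.toAddMonoidEnd G V (ζ i₀))) (x j • v) = 0 := by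
          simp only [h2]
          rw [Finset.sum_sub_distrib, ← Finset.smul_sum, ← Finset.smul_sum, hsum, hsum]
          simp
        rwa [Finset.sum_insert hi₀, sub_self, mul_zero,
          show (0 : AddMonoid.End V) (x i₀ • v) = 0 from rfl, zero_add] at h3
    intro i hi
    rcases Finset.mem_insert.1 hi with rfl | hi
    · have h1 := hsum v₀
      rw [Finset.sum_insert hi₀, Finset.sum_eq_zero, add_zero] at h1
      · exact h.eq_zero_of_apply_eq_zero hAn hAA (hr i) (fun h2 => hv₀ ((smul_eq_zero_iff_eq _).1 h2)) h1
      · intro j hj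
        rw [hS j hj]
        rfl
    · exact hS i hi

lemma HasFaithfulEnvelopes.two_pow_relIndex_le [Finite G] [Finite V] [Nontrivial V]
    (h : HasFaithfulEnvelopes G V)
    (hfaith : ∀ g : G, (∀ v : V, g • v = v) → g = 1) (hAn : A.Normal)
    (hAM : ∀ m ∈ M, ∀ a ∈ A, m * a = a * m) (hA : A ≤ M)
    (hZ : ∀ x ∈ M, (∀ m ∈ M, m * x = x * m) → x ∈ A)
    (hcomm : ∀ m ∈ M, ∀ x ∈ M, m * x * m⁻¹ * x⁻¹ ∈ A) :
    2 ^ A.relIndex M ≤ Nat.card (AddMonoid.End V) := by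
  classical
  have hfin : Fintype (M ⧸ A.subgroupOf M) := Fintype.ofFinite _
  obtain ⟨v₀, hv₀⟩ := exists_ne (0 : V)
  let x : M ⧸ A.subgroupOf M → G := fun q => (q.out : M)
  have hx : ∀ i j, (x i)⁻¹ * x j ∈ A → i = j := by
    intro p q hpq
    rw [← QuotientGroup.out_eq' p, ← QuotientGroup.out_eq' q]
    exact QuotientGroup.eq.2 (Subgroup.mem_subgroupOf.2 hpq)
  have h1 : 2 ^ A.relIndex M = Nat.card (Finset (M ⧸ A.subgroupOf M)) := by
    rw [Nat.card_eq_fintype_card, Fintype.card_finset, Subgroup.relIndex, Subgroup.index,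
      Nat.card_eq_fintype_card]
  rw [h1]
  refine Nat.card_le_card_of_injective (fun s : Finset (M ⧸ A.subgroupOf M) =>
    ∑ q ∈ s, DistribMulAction.toAddMonoidEnd G V (x q)) fun s t hst => ?_
  have h2 := h.coeff_eq_zero hfaith hAn hAM hA hZ hcomm x (fun q => (q.out : M).2) hx Finset.univ
    (fun q => (if q ∈ s then 1 else 0) - (if q ∈ t then 1 else 0)) ?_ ?_
  · ext q
    have h3 := DFunLike.congr_fun (h2 q (Finset.mem_univ q)) v₀
    by_cases hs : q ∈ s <;> by_cases ht : q ∈ t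
    · simp [hs, ht]
    · simp only [hs, ht, if_true, if_false, sub_zero] at h3
      exact (hv₀ h3).elim
    · simp only [hs, ht, if_true, if_false, zero_sub] at h3
      exact (hv₀ (neg_eq_zero.1 h3)).elim
    · simp [hs, ht]
  · intro q
    refine sub_mem ?_ ?_ <;> split_ifs <;> first | exact one_mem _ | exact zero_mem _
  · intro v
    have h3 : ∀ (u : Finset (M ⧸ A.subgroupOf M)), ∑ q, (if q ∈ u then (1 : AddMonoid.End V) else 0)
        (x q • v) = (∑ q ∈ u, DistribMulAction.toAddMonoidEnd G V (x q)) v := by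
      intro u
      have h4 : (∑ q ∈ u, DistribMulAction.toAddMonoidEnd G V (x q)) v = ∑ q ∈ u, x q • v :=
        AddMonoidHom.finsetSum_apply _ _ _
      rw [h4, ← Finset.sum_filter_add_sum_filter_not Finset.univ (· ∈ u)]
      rw [Finset.sum_eq_zero (s := Finset.univ.filter (· ∉ u)), add_zero]
      · rw [Finset.filter_univ_mem]
        refine Finset.sum_congr rfl fun q hq => ?_
        rw [if_pos hq]
        rfl
      · intro q hq
        rw [if_neg (Finset.mem_filter.1 hq).2]
        rfl
    have h4 : ∀ q, ((if q ∈ s then (1 : AddMonoid.End V) else 0) - (if q ∈ t then 1 else 0))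
        (x q • v) = (if q ∈ s then (1 : AddMonoid.End V) else 0) (x q • v) -
          (if q ∈ t then (1 : AddMonoid.End V) else 0) (x q • v) := fun q => rfl
    simp only [h4]
    rw [Finset.sum_sub_distrib, h3, h3, sub_eq_zero]
    exact DFunLike.congr_fun hst v

end Nilpotent

lemma Subgroup.card_pow_eq_le {G : Type*} [Group G] [Finite G] {A M : Subgroup G}
    [hcyc : IsCyclic A] (hAM : ∀ m ∈ M, ∀ a ∈ A, m * a = a * m) {s : ℕ}
    (hs : 0 < s) (b : G) :
    Nat.card {w : M // (w : G) ^ s = b} ≤ s * A.relIndex M := by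
  classical
  have hfin : Fintype {w : M // (w : G) ^ s = b} := Fintype.ofFinite _
  have hfinA : Fintype A := Fintype.ofFinite _
  have hfinQ : Fintype (M ⧸ A.subgroupOf M) := Fintype.ofFinite _
  let f : {w : M // (w : G) ^ s = b} → M ⧸ A.subgroupOf M := fun w => (w : M)
  have h1 : ∀ q ∈ Finset.univ.image f, (Finset.univ.filter fun w => f w = q).card ≤ s := by
    intro q hq
    obtain ⟨w₀, -, rfl⟩ := Finset.mem_image.1 hq
    refine le_trans ?_ (IsCyclic.card_pow_eq_one_le (α := A) hs)
    have hmem : ∀ w, f w = f w₀ → ((w₀ : M) : G)⁻¹ * ((w : M) : G) ∈ A := fun w hw =>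
      Subgroup.mem_subgroupOf.1 (QuotientGroup.eq.1 hw.symm)
    refine Finset.card_le_card_of_injOn
      (fun w => if hw : f w = f w₀ then ⟨((w₀ : M) : G)⁻¹ * ((w : M) : G), hmem w hw⟩ else 1) ?_ ?_
    · intro w hw
      have hw' : f w = f w₀ := by simpa using hw
      simp only [hw', dif_pos, Finset.coe_filter, Finset.mem_univ, true_and, Set.mem_ofPred_eq]
      apply Subtype.ext
      change (((w₀ : M) : G)⁻¹ * ((w : M) : G)) ^ s = 1
      have h2 : Commute ((w₀ : M) : G) (((w₀ : M) : G)⁻¹ * ((w : M) : G)) :=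
        hAM _ (w₀ : M).2 _ (hmem w hw')
      have h3 := h2.mul_pow s
      rw [mul_inv_cancel_left, w.2, w₀.2] at h3
      exact (left_eq_mul.1 h3)
    · intro w hw w' hw' heq
      have h2 : f w = f w₀ := by simpa using hw
      have h3 : f w' = f w₀ := by simpa using hw'
      simp only [h2, h3, dif_pos] at heq
      have h4 := mul_left_cancel (congrArg Subtype.val heq)
      exact Subtype.ext (Subtype.ext h4)
  have h2 := Finset.card_le_mul_card_image Finset.univ s h1
  rw [Nat.card_eq_fintype_card, Subgroup.relIndex, Subgroup.index, Nat.card_eq_fintype_card]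
  exact h2.trans (Nat.mul_le_mul_left _ (Finset.card_le_univ _))

lemma Subgroup.relIndex_centralizer_le {G : Type*} [Group G] [Finite G] {A M : Subgroup G}
    [hAn : A.Normal] [hcyc : IsCyclic A] (hM : M.Normal)
    (hAM : ∀ m ∈ M, ∀ a ∈ A, m * a = a * m) :
    (Subgroup.centralizer (M : Set G)).relIndex (Subgroup.centralizer (A : Set G)) ≤
      (A.relIndex M * A.relIndex M) ^ Nat.log 2 (A.relIndex M) := by
  classical
  obtain ⟨s, hs, hcl⟩ := Subgroup.exists_finset_card_le_log_closure_eq_top (M ⧸ A.subgroupOf M)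
  set y := A.relIndex M with hy
  have hy' : Nat.card (M ⧸ A.subgroupOf M) = y := rfl
  have hy0 : 0 < y := by rw [← hy']; exact Nat.card_pos
  rw [hy'] at hs
  have hpow : ∀ m : M, ((m : G)) ^ y ∈ A := by
    intro m
    have h1 : ((m : M ⧸ A.subgroupOf M)) ^ y = 1 := pow_card_eq_one'
    rw [← QuotientGroup.mk_pow, QuotientGroup.eq_one_iff] at h1
    exact h1
  let f : Subgroup.centralizer (A : Set G) →
      ∀ q : s, {w : M // (w : G) ^ y = ((q : M ⧸ A.subgroupOf M).out : G) ^ y} := fun c q =>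
    ⟨⟨c * ((q : M ⧸ A.subgroupOf M).out : G) * (c : G)⁻¹, hM.conj_mem _ (Subtype.prop _) _⟩, by
      change ((c : G) * ((q : M ⧸ A.subgroupOf M).out : G) * (c : G)⁻¹) ^ y = _
      rw [conj_pow, mul_inv_eq_iff_eq_mul]
      exact (Subgroup.mem_centralizer_iff.1 c.2 _ (hpow _)).symm⟩
  refine (Subgroup.relIndex_le_card_of_forall f ?_).trans ?_
  · intro c c' hcc
    have h1 : ∀ q ∈ s, (q.out : G) ∈ Subgroup.centralizer {(c : G)⁻¹ * (c' : G)} := by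
      intro q hq
      have h2 : (c : G) * (q.out : G) * (c : G)⁻¹ = (c' : G) * (q.out : G) * (c' : G)⁻¹ :=
        congrArg (fun w => ((w.1 : M) : G)) (congrFun hcc ⟨q, hq⟩)
      rw [Subgroup.mem_centralizer_singleton_iff]
      calc (q.out : G) * ((c : G)⁻¹ * (c' : G)) =
          (c : G)⁻¹ * ((c : G) * (q.out : G) * (c : G)⁻¹) * (c' : G) := by group
        _ = (c : G)⁻¹ * (c' : G) * (q.out : G) := by rw [h2]; group
    have h2 : ∀ a ∈ A, a ∈ Subgroup.centralizer {(c : G)⁻¹ * (c' : G)} := by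
      intro a ha
      rw [Subgroup.mem_centralizer_singleton_iff]
      exact Subgroup.mem_centralizer_iff.1
        (Subgroup.mul_mem _ (Subgroup.inv_mem _ c.2) c'.2) a ha
    have h3 : (Subgroup.closure (s : Set (M ⧸ A.subgroupOf M))) ≤
        ((Subgroup.centralizer {(c : G)⁻¹ * (c' : G)}).subgroupOf M).map
          (QuotientGroup.mk' (A.subgroupOf M)) := by
      rw [Subgroup.closure_le]
      intro q hq
      exact ⟨q.out, h1 q hq, QuotientGroup.out_eq' q⟩
    rw [Subgroup.mem_centralizer_iff]
    intro m hm
    have h4 : ((⟨m, hm⟩ : M) : M ⧸ A.subgroupOf M) ∈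
        ((Subgroup.centralizer {(c : G)⁻¹ * (c' : G)}).subgroupOf M).map
          (QuotientGroup.mk' (A.subgroupOf M)) := h3 (by rw [hcl]; trivial)
    obtain ⟨p, hp, hpm⟩ := h4
    have h5 : (p : G)⁻¹ * m ∈ A := Subgroup.mem_subgroupOf.1 (QuotientGroup.eq.1 hpm)
    have h6 : m ∈ Subgroup.centralizer {(c : G)⁻¹ * (c' : G)} := by
      have h7 := Subgroup.mul_mem _ (show (p : G) ∈ _ from hp) (h2 _ h5)
      rwa [mul_inv_cancel_left] at h7
    exact Subgroup.mem_centralizer_singleton_iff.1 h6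
  · rw [Nat.card_pi]
    calc ∏ q : s, Nat.card {w : M // (w : G) ^ y = ((q : M ⧸ A.subgroupOf M).out : G) ^ y}
        ≤ ∏ q : s, y * y := Finset.prod_le_prod' fun q _ => Subgroup.card_pow_eq_le hAM hy0 _
      _ = (y * y) ^ s.card := by simp
      _ ≤ _ := Nat.pow_le_pow_right (Nat.mul_pos hy0 hy0) hs

lemma Nat.mul_succ_sq_le_two_pow (l : ℕ) : (l * (l + 1)) ^ 2 ≤ 36 * 2 ^ l := by
  rcases Nat.lt_or_ge l 5 with h | h
  · interval_cases l <;> norm_num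
  · induction l, h using Nat.le_induction with
    | base => norm_num
    | succ n hn ih =>
      have h1 : ((n + 1) * (n + 1 + 1)) ^ 2 ≤ 2 * (n * (n + 1)) ^ 2 := by
        have h2 : (n + 1 + 1) ^ 2 ≤ 2 * n ^ 2 := by nlinarith
        calc ((n + 1) * (n + 1 + 1)) ^ 2 = (n + 1) ^ 2 * (n + 1 + 1) ^ 2 := by ring
          _ ≤ (n + 1) ^ 2 * (2 * n ^ 2) := Nat.mul_le_mul_left _ h2
          _ = _ := by ring
      rw [pow_succ 2 n]
      omega

lemma Nat.sq_pow_log_le {v y : ℕ} (hv : 2 ≤ v) (hy : 0 < y) (h : 2 ^ y ≤ v ^ Nat.log 2 v) :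
    (y * y) ^ Nat.log 2 y ≤ v ^ 18 := by
  set x := Nat.log 2 v with hx
  set l := Nat.log 2 y with hl
  have hx1 : 1 ≤ x := Nat.le_log_of_pow_le one_lt_two (by simpa using hv)
  have hvx : v < 2 ^ (x + 1) := Nat.lt_pow_succ_log_self one_lt_two v
  have hxv : 2 ^ x ≤ v := Nat.pow_log_le_self 2 (by omega)
  have hyl : y < 2 ^ (l + 1) := Nat.lt_pow_succ_log_self one_lt_two y
  have hly : 2 ^ l ≤ y := Nat.pow_log_le_self 2 (by omega)
  have h1 : 2 ^ y ≤ 2 ^ ((x + 1) * x) := by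
    rw [pow_mul]
    exact h.trans (Nat.pow_le_pow_left hvx.le _)
  have h2 : y ≤ (x + 1) * x := (Nat.pow_le_pow_iff_right one_lt_two).1 h1
  have h3 := Nat.mul_succ_sq_le_two_pow l
  have h4 : (l * (l + 1)) ^ 2 ≤ (9 * x) ^ 2 := by nlinarith
  have h5 : l * (l + 1) ≤ 9 * x := by
    by_contra! hcon
    have := Nat.pow_lt_pow_left hcon (two_ne_zero)
    omega
  calc (y * y) ^ l ≤ (2 ^ (l + 1) * 2 ^ (l + 1)) ^ l :=
        Nat.pow_le_pow_left (Nat.mul_le_mul hyl.le hyl.le) _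
    _ = 2 ^ (2 * (l * (l + 1))) := by rw [← pow_add, ← pow_mul]; congr 1; ring
    _ ≤ 2 ^ (x * 18) := Nat.pow_le_pow_right two_pos (by omega)
    _ ≤ v ^ 18 := by rw [pow_mul]; exact Nat.pow_le_pow_left hxv _

lemma HasFaithfulEnvelopes.relIndex_centralizer_le {G V : Type*} [Group G] [AddCommGroup V]
    [DistribMulAction G V] [Finite G] [Finite V] [Nontrivial V]
    {A M : Subgroup G} (h : HasFaithfulEnvelopes G V)
    (hfaith : ∀ g : G, (∀ v : V, g • v = v) → g = 1) (hAn : A.Normal) (hM : M.Normal)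
    (hAM : ∀ m ∈ M, ∀ a ∈ A, m * a = a * m) (hA : A ≤ M)
    (hZ : ∀ x ∈ M, (∀ m ∈ M, m * x = x * m) → x ∈ A)
    (hcomm : ∀ m ∈ M, ∀ x ∈ M, m * x * m⁻¹ * x⁻¹ ∈ A) :
    (Subgroup.centralizer (M : Set G)).relIndex (Subgroup.centralizer (A : Set G)) ≤
      Nat.card V ^ 18 := by
  have hcyc := h.isCyclic hfaith hAn fun x hx y hy => hAM x (hA hx) y hy
  refine (Subgroup.relIndex_centralizer_le hM hAM).trans (Nat.sq_pow_log_le ?_ ?_ ?_)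
  · exact Finite.one_lt_card
  · exact Nat.pos_of_ne_zero Subgroup.relIndex_ne_zero_of_finite
  · exact (h.two_pow_relIndex_le hfaith hAn hAM hA hZ hcomm).trans (AddMonoid.End.card_le V)

lemma Subgroup.mul_comm_of_le_commutator_sup {G : Type*} [Group G] {A H : Subgroup G} {u : G}
    (hAA : ∀ a ∈ A, ∀ b ∈ A, a * b = b * a) (hH : ∀ h ∈ H, ∀ a ∈ A, h * a = a * h)
    (hu : ∀ a ∈ A, u * a = a * u) (huH : ∀ h ∈ H, h * u * h⁻¹ * u⁻¹ ∈ A)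
    (hperf : H ≤ ⁅H, H⁆ ⊔ A) : ∀ h ∈ H, h * u = u * h := by
  have key : ∀ g ∈ H, ∀ z ∈ A, g * (z * u) * g⁻¹ = z * (g * u * g⁻¹ * u⁻¹) * u := by
    intro g hg z hz
    rw [← mul_assoc, hH g hg z hz]
    group
  have hinv : ∀ g ∈ H, g⁻¹ * u * g⁻¹⁻¹ * u⁻¹ = (g * u * g⁻¹ * u⁻¹)⁻¹ := by
    intro g hg
    have h1 := key g⁻¹ (H.inv_mem hg) _ (huH g hg)
    have h2 : g⁻¹ * (g * u * g⁻¹ * u⁻¹ * u) * g⁻¹⁻¹ = u := by group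
    rw [h2] at h1
    exact (inv_eq_of_mul_eq_one_right (right_eq_mul.1 h1)).symm
  have hle : ⁅H, H⁆ ⊔ A ≤ Subgroup.centralizer {u} := by
    refine sup_le (Subgroup.commutator_le.2 fun g hg h hh => ?_) fun a ha => ?_
    · rw [Subgroup.mem_centralizer_singleton_iff, ← mul_inv_eq_iff_eq_mul, commutatorElement_def]
      have hg' := huH g hg
      have hh' := huH h hh
      set y := g * u * g⁻¹ * u⁻¹ with hy
      set z := h * u * h⁻¹ * u⁻¹ with hz
      have e1 : h⁻¹ * u * h⁻¹⁻¹ = z⁻¹ * u := by rw [← hinv h hh]; group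
      have e2 := key g⁻¹ (H.inv_mem hg) z⁻¹ (A.inv_mem hh')
      rw [hinv g hg, ← hy] at e2
      have e3 := key h hh (z⁻¹ * y⁻¹) (A.mul_mem (A.inv_mem hh') (A.inv_mem hg'))
      rw [← hz] at e3
      have e3' : z⁻¹ * y⁻¹ * z = y⁻¹ := by
        rw [mul_assoc, hAA _ (A.inv_mem hg') z hh', inv_mul_cancel_left]
      rw [e3'] at e3
      have e4 := key g hg y⁻¹ (A.inv_mem hg')
      rw [← hy, inv_mul_cancel, one_mul] at e4
      calc g * h * g⁻¹ * h⁻¹ * u * (g * h * g⁻¹ * h⁻¹)⁻¹ =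
          g * (h * (g⁻¹ * (h⁻¹ * u * h⁻¹⁻¹) * g⁻¹⁻¹) * h⁻¹) * g⁻¹ := by group
        _ = u := by rw [e1, e2, e3, e4]
    · rw [Subgroup.mem_centralizer_singleton_iff]
      exact (hu a ha).symm
  exact fun h hh => Subgroup.mem_centralizer_singleton_iff.1 (hle (hperf hh))

section Nonsolvable

variable {G : Type*} [Group G]

namespace IsSimpleDecomposition

lemma le_commutator {N : Subgroup G} {𝒯 : Set (Subgroup G)} (h : IsSimpleDecomposition N 𝒯)
    {T : Subgroup G} (hT : T ∈ 𝒯) : T ≤ ⁅T, T⁆ := by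
  have hle : ⁅T, T⁆ ≤ T := Subgroup.commutator_le.2 fun x hx y hy => by
    rw [commutatorElement_def]
    exact T.mul_mem (T.mul_mem (T.mul_mem hx hy) (T.inv_mem hx)) (T.inv_mem hy)
  refine (h.eq_bot_or_le hT hle fun t ht y hy => ?_).resolve_left fun hb => ?_
  · have h1 := Subgroup.mul_mem _ (Subgroup.commutator_mem_commutator ht (hle hy)) hy
    rwa [commutatorElement_def, inv_mul_cancel_right] at h1
  · obtain ⟨x, hx, y, hy, hne⟩ := h.nonabelian T hT
    have h1 := Subgroup.commutator_mem_commutator hx hy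
    rw [hb, Subgroup.mem_bot, commutatorElement_eq_one_iff_mul_comm] at h1
    exact hne h1

variable {A M : Subgroup G} [A.Normal] {𝒯 : Set (Subgroup (G ⧸ A))}

lemma comap_le (h : IsSimpleDecomposition (M.map (QuotientGroup.mk' A)) 𝒯) (hA : A ≤ M)
    {T : Subgroup (G ⧸ A)} (hT : T ∈ 𝒯) : T.comap (QuotientGroup.mk' A) ≤ M := by
  refine (Subgroup.comap_mono (h.le T hT)).trans ?_
  rw [Subgroup.comap_map_eq, QuotientGroup.ker_mk', sup_eq_left.2 hA]

lemma le_comap (T : Subgroup (G ⧸ A)) : A ≤ T.comap (QuotientGroup.mk' A) := by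
  intro a ha
  rw [Subgroup.mem_comap, QuotientGroup.mk'_apply, (QuotientGroup.eq_one_iff a).2 ha]
  exact T.one_mem

lemma comap_le_commutator_sup (h : IsSimpleDecomposition (M.map (QuotientGroup.mk' A)) 𝒯)
    {T : Subgroup (G ⧸ A)} (hT : T ∈ 𝒯) : T.comap (QuotientGroup.mk' A) ≤
      ⁅T.comap (QuotientGroup.mk' A), T.comap (QuotientGroup.mk' A)⁆ ⊔ A := by
  have h1 : (⁅T.comap (QuotientGroup.mk' A), T.comap (QuotientGroup.mk' A)⁆).map
      (QuotientGroup.mk' A) = ⁅T, T⁆ := by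
    rw [Subgroup.map_commutator, Subgroup.map_comap_eq_self_of_surjective
      (QuotientGroup.mk'_surjective A)]
  have h2 := Subgroup.comap_mono (f := QuotientGroup.mk' A) (h.le_commutator hT)
  rwa [← h1, Subgroup.comap_map_eq, QuotientGroup.ker_mk'] at h2

lemma le_of_forall_comap_le (h : IsSimpleDecomposition (M.map (QuotientGroup.mk' A)) 𝒯)
    {P : Subgroup G} (hP : ∀ T ∈ 𝒯, T.comap (QuotientGroup.mk' A) ≤ P) : M ≤ P := by
  obtain ⟨T₀, hT₀⟩ := h.nonempty
  have hAP : A ≤ P := (le_comap T₀).trans (hP T₀ hT₀)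
  have h1 : M.map (QuotientGroup.mk' A) ≤ P.map (QuotientGroup.mk' A) := by
    rw [← h.sSup_eq]
    refine sSup_le fun T hT => ?_
    rw [← Subgroup.map_comap_eq_self_of_surjective (QuotientGroup.mk'_surjective A) T]
    exact Subgroup.map_mono (hP T hT)
  have h2 := Subgroup.map_le_iff_le_comap.1 h1
  rwa [Subgroup.comap_map_eq, QuotientGroup.ker_mk', sup_eq_left.2 hAP] at h2

lemma comap_mul_comm (h : IsSimpleDecomposition (M.map (QuotientGroup.mk' A)) 𝒯)
    (hAM : ∀ m ∈ M, ∀ a ∈ A, m * a = a * m) (hA : A ≤ M) {T : Subgroup (G ⧸ A)} (hT : T ∈ 𝒯)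
    {u : G} (hu : ∀ a ∈ A, u * a = a * u)
    (huT : ∀ t ∈ T, t * (u : G ⧸ A) = (u : G ⧸ A) * t) :
    ∀ x ∈ T.comap (QuotientGroup.mk' A), x * u = u * x := by
  refine Subgroup.mul_comm_of_le_commutator_sup (fun a ha b hb => hAM a (hA ha) b hb)
    (fun x hx => hAM x (h.comap_le hA hT hx)) hu (fun x hx => ?_) (h.comap_le_commutator_sup hT)
  rw [← QuotientGroup.eq_one_iff]
  have h1 : (x : G ⧸ A) * (u : G ⧸ A) = (u : G ⧸ A) * (x : G ⧸ A) := huT _ hx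
  simp only [QuotientGroup.mk_mul, QuotientGroup.mk_inv]
  rw [h1]
  group

lemma two_pow_two_pow_card_le {V : Type*} [AddCommGroup V] [DistribMulAction G V] [Finite G]
    [Finite V] [Nontrivial V] (hM : M.Normal)
    (h : IsSimpleDecomposition (M.map (QuotientGroup.mk' A)) 𝒯)
    (hAM : ∀ m ∈ M, ∀ a ∈ A, m * a = a * m) (hA : A ≤ M) (hE : HasFaithfulEnvelopes G V)
    (hfaith : ∀ g : G, (∀ v : V, g • v = v) → g = 1) :
    2 ^ 2 ^ Nat.card 𝒯 ≤ Nat.card V := by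
  classical
  have hfin : Fintype 𝒯 := Fintype.ofFinite _
  obtain ⟨U, -, hU⟩ := exists_actsIrreducibly (X := M) (U := (⊤ : AddSubgroup V)) top_ne_bot
    fun _ _ _ _ => trivial
  let ℰ : Finset (Subgroup G) := 𝒯.toFinset.image (Subgroup.comap (QuotientGroup.mk' A))
  have hcard : ℰ.card = Nat.card 𝒯 := by
    rw [Finset.card_image_of_injective _
      (Subgroup.comap_injective (QuotientGroup.mk'_surjective A)), Set.toFinset_card,
      Nat.card_eq_fintype_card]
  have hmem : ∀ E ∈ ℰ, ∃ T ∈ 𝒯, T.comap (QuotientGroup.mk' A) = E := by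
    intro E hE
    obtain ⟨T, hT, rfl⟩ := Finset.mem_image.1 hE
    exact ⟨T, Set.mem_toFinset.1 hT, rfl⟩
  have hsup : ℰ.sup id = M := by
    apply le_antisymm
    · refine Finset.sup_le fun E hE => ?_
      obtain ⟨T, hT, rfl⟩ := hmem E hE
      exact h.comap_le hA hT
    · refine h.le_of_forall_comap_le fun T hT => ?_
      exact Finset.le_sup (f := id) (Finset.mem_image_of_mem _ (Set.mem_toFinset.2 hT))
  rw [← hcard]
  refine (two_pow_two_pow_le_card ℰ U ?_ (hsup ▸ hU) ?_).trans
    (Nat.card_le_card_of_injective U.subtype Subtype.val_injective)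
  · intro E hE E' hE' hne x hx y hy
    obtain ⟨T, hT, rfl⟩ := hmem E hE
    obtain ⟨T', hT', rfl⟩ := hmem E' hE'
    have hTT : T ≠ T' := fun heq => hne (by rw [heq])
    exact h.comap_mul_comm hAM hA hT (hAM y (h.comap_le hA hT' hy))
      (fun t ht => h.commute T hT T' hT' hTT t ht _ hy) x hx
  · intro E hE'
    obtain ⟨T, hT, rfl⟩ := hmem E hE'
    obtain ⟨s, hs, t, ht, hne⟩ := h.nonabelian T hT
    obtain ⟨a, rfl⟩ := QuotientGroup.mk'_surjective A s
    obtain ⟨b, rfl⟩ := QuotientGroup.mk'_surjective A t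
    refine ⟨a, hs, b, ht, ?_⟩
    by_contra! hcon
    apply hne
    rw [← map_mul, ← map_mul]
    congr 1
    have haM := h.comap_le hA hT hs
    have hbM := h.comap_le hA hT ht
    refine (inv_mul_eq_one.1 (hE.eq_one hfaith hM hU.ne_bot hU.smul_mem
      (M.mul_mem (M.inv_mem (M.mul_mem hbM haM)) (M.mul_mem haM hbM)) fun w hw => ?_)).symm
    rw [mul_smul, inv_smul_eq_iff]
    exact hcon w hw

lemma exists_card_le_centralizer [Finite G] {d : ℕ}
    (h : IsSimpleDecomposition (M.map (QuotientGroup.mk' A)) 𝒯)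
    (hAM : ∀ m ∈ M, ∀ a ∈ A, m * a = a * m) (hA : A ≤ M) (hsec : SectionsHaveSmallIndex d G) :
    ∃ e, 2 ≤ e ∧ e ≤ d ∧ Nat.card G ≤ (Subgroup.centralizer (A : Set G)).index *
      Nat.card (Subgroup.centralizer (M : Set G)) *
        (2 ^ (d * (Nat.card 𝒯 - 1)) * (e ^ (4 * e)) ^ Nat.card 𝒯) := by
  obtain ⟨e, he, hed, -, hcard⟩ := h.exists_bound
    (hsec.of_surjective (QuotientGroup.mk' A) (QuotientGroup.mk'_surjective A))
  refine ⟨e, he, hed, ?_⟩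
  set C := Subgroup.centralizer (A : Set G) with hC
  set Z := Subgroup.centralizer ((M.map (QuotientGroup.mk' A) : Subgroup (G ⧸ A)) : Set (G ⧸ A))
    with hZ
  set Y := Z.comap (QuotientGroup.mk' A) with hY
  have hYC : Y ⊓ C ≤ Subgroup.centralizer (M : Set G) := by
    rintro u ⟨huY, huC⟩
    rw [Subgroup.mem_centralizer_iff]
    have h1 : M ≤ Subgroup.centralizer {u} := by
      refine h.le_of_forall_comap_le fun T hT x hx => ?_
      rw [Subgroup.mem_centralizer_singleton_iff]
      refine h.comap_mul_comm hAM hA hT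
        (fun a ha => (Subgroup.mem_centralizer_iff.1 huC a ha).symm) (fun t ht => ?_) x hx
      exact Subgroup.mem_centralizer_iff.1 huY t (h.le T hT ht)
    exact fun m hm => Subgroup.mem_centralizer_singleton_iff.1 (h1 hm)
  have h1 : Nat.card Y ≤ C.index * Nat.card (Subgroup.centralizer (M : Set G)) := by
    have h2 : Nat.card (Y ⊓ C : Subgroup G) * C.relIndex Y = Nat.card Y := by
      rw [← Subgroup.inf_relIndex_left]
      rw [← Subgroup.relIndex_bot_left, ← Subgroup.relIndex_bot_left Y]
      exact Subgroup.relIndex_mul_relIndex _ _ _ bot_le inf_le_left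
    rw [← h2, mul_comm]
    refine Nat.mul_le_mul ?_ (Nat.card_le_card_of_injective _ (Subgroup.inclusion_injective hYC))
    rw [← Subgroup.relIndex_top_right]
    exact Subgroup.relIndex_le_of_le_right le_top Subgroup.relIndex_ne_zero_of_finite
  have h3 : Nat.card Y = Nat.card A * Nat.card Z := by
    have h4 : A.relIndex Y = Nat.card Z := by
      have h5 := Subgroup.relIndex_comap (⊥ : Subgroup (G ⧸ A)) (QuotientGroup.mk' A) Y
      rwa [MonoidHom.comap_bot, QuotientGroup.ker_mk', hY,
        Subgroup.map_comap_eq_self_of_surjective (QuotientGroup.mk'_surjective A),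
        Subgroup.relIndex_bot_left] at h5
    rw [← h4, ← Subgroup.relIndex_bot_left A, ← Subgroup.relIndex_bot_left Y]
    exact (Subgroup.relIndex_mul_relIndex _ _ _ bot_le (le_comap Z)).symm
  rw [Subgroup.card_eq_card_quotient_mul_card_subgroup A, mul_comm]
  calc Nat.card A * Nat.card (G ⧸ A) ≤ Nat.card A * (Nat.card Z * _) :=
        Nat.mul_le_mul_left _ hcard
    _ = Nat.card Y * (2 ^ (d * (Nat.card 𝒯 - 1)) * (e ^ (4 * e)) ^ Nat.card 𝒯) := by
        rw [h3, mul_assoc]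
    _ ≤ _ := Nat.mul_le_mul_right _ h1

end IsSimpleDecomposition

end Nonsolvable

lemma Nat.pow_mul_pow_le_of_le_log {v d e k : ℕ} (hv : 2 ≤ v) (he : 2 ≤ e) (hed : e ≤ d)
    (hd : d ≤ Nat.log 2 v) (hk : 2 ^ 2 ^ k ≤ v) :
    2 ^ (d * (k - 1)) * (e ^ (4 * e)) ^ k ≤ v ^ (25 * d) := by
  set x := Nat.log 2 v with hx
  set l := Nat.log 2 x with hl
  have hx0 : x ≠ 0 := by omega
  have hkx : 2 ^ k ≤ x := Nat.le_log_of_pow_le one_lt_two hk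
  have hkl : k ≤ l := Nat.le_log_of_pow_le one_lt_two hkx
  have hxv : 2 ^ x ≤ v := Nat.pow_log_le_self 2 (by omega)
  have hxl : x < 2 ^ (l + 1) := Nat.lt_pow_succ_log_self one_lt_two x
  have hlx : 2 ^ l ≤ x := Nat.pow_log_le_self 2 hx0
  have h1 : 2 ^ (d * (k - 1)) ≤ v ^ d := by
    calc 2 ^ (d * (k - 1)) ≤ 2 ^ (x * d) := by
          refine Nat.pow_le_pow_right two_pos ?_
          rw [mul_comm x]
          refine Nat.mul_le_mul_left _ ?_
          have := Nat.lt_two_pow_self (n := k)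
          omega
      _ ≤ v ^ d := by rw [pow_mul]; exact Nat.pow_le_pow_left hxv _
  have h2 : l * (l + 1) ≤ 6 * x := by
    have h3 := Nat.mul_succ_sq_le_two_pow l
    have h4 : (l * (l + 1)) ^ 2 ≤ (6 * x) ^ 2 := by nlinarith
    by_contra! hcon
    have := Nat.pow_lt_pow_left hcon two_ne_zero
    omega
  have h3 : x ^ k ≤ v ^ 6 := by
    calc x ^ k ≤ (2 ^ (l + 1)) ^ l :=
          (Nat.pow_le_pow_left hxl.le _).trans (Nat.pow_le_pow_right (by positivity) hkl)
      _ = 2 ^ (l * (l + 1)) := by rw [← pow_mul, mul_comm]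
      _ ≤ 2 ^ (x * 6) := Nat.pow_le_pow_right two_pos (by omega)
      _ ≤ v ^ 6 := by rw [pow_mul]; exact Nat.pow_le_pow_left hxv _
  have h4 : (e ^ (4 * e)) ^ k ≤ v ^ (24 * d) := by
    calc (e ^ (4 * e)) ^ k = (e ^ k) ^ (4 * e) := by rw [← pow_mul, ← pow_mul, mul_comm]
      _ ≤ (x ^ k) ^ (4 * e) := Nat.pow_le_pow_left (Nat.pow_le_pow_left (by omega) _) _
      _ ≤ (v ^ 6) ^ (4 * e) := Nat.pow_le_pow_left h3 _
      _ = v ^ (24 * e) := by rw [← pow_mul]; congr 1; ring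
      _ ≤ _ := Nat.pow_le_pow_right (by omega) (by omega)
  calc _ ≤ v ^ d * v ^ (24 * d) := Nat.mul_le_mul h1 h4
    _ = _ := by rw [← pow_add]; congr 1; ring

section Linear

universe u

variable {G V : Type u} [Group G] [AddCommGroup V] [DistribMulAction G V]

lemma ActsIrreducibly.range_restrictHom {S : Subgroup G} {H : AddSubgroup V}
    (hS : ActsIrreducibly S H) : ActsIrreducibly
      (⊤ : Subgroup (restrictHom S H hS.smul_mem).range) (⊤ : AddSubgroup H) := by
  have hnt : Nontrivial H := (AddSubgroup.nontrivial_iff_ne_bot H).2 hS.ne_bot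
  refine ⟨top_ne_bot, fun _ _ _ _ => trivial, fun W _ hW hWinv => ?_⟩
  have h1 := hS.eq_of_le (W.map H.subtype) (AddSubgroup.map_subtype_le _) ?_ ?_
  · rw [eq_top_iff]
    intro w _
    have h2 : (w : V) ∈ W.map H.subtype := by rw [h1]; exact w.2
    obtain ⟨w', hw', h3⟩ := h2
    rwa [← Subtype.ext h3]
  · intro hb
    exact hW ((AddSubgroup.map_eq_bot_iff_of_injective _ Subtype.val_injective).1 hb)
  · rintro x hx _ ⟨w, hw, rfl⟩
    exact ⟨_, hWinv ⟨restrictHom S H hS.smul_mem ⟨x, hx⟩, ⟨x, hx⟩, rfl⟩ trivial w hw, rfl⟩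

lemma exists_maximal_abelian_normal (G : Type*) [Group G] [Finite G] :
    ∃ A : Subgroup G, A.Normal ∧ (∀ x ∈ A, ∀ y ∈ A, x * y = y * x) ∧
      ∀ B : Subgroup G, B.Normal → (∀ x ∈ B, ∀ y ∈ B, x * y = y * x) → A ≤ B → B ≤ A := by
  obtain ⟨A, ⟨hAn, hA⟩, hmax⟩ := (Set.toFinite {A : Subgroup G | A.Normal ∧
    ∀ x ∈ A, ∀ y ∈ A, x * y = y * x}).exists_maximal ⟨⊥, inferInstance, fun x hx y hy => by
      rw [Subgroup.mem_bot] at hx hy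
      rw [hx, hy]⟩
  exact ⟨A, hAn, hA, fun B hBn hB hAB => hmax ⟨hBn, hB⟩ hAB⟩

lemma exists_minimal_normal_between {G : Type*} [Group G] [Finite G] {A C : Subgroup G}
    (hC : C.Normal) (hAC : A ≤ C) (hCA : ¬ C ≤ A) :
    ∃ M : Subgroup G, M.Normal ∧ A < M ∧ M ≤ C ∧
      ∀ K : Subgroup G, K.Normal → A < K → K ≤ M → K = M := by
  obtain ⟨M, ⟨hMn, hAM, hMC⟩, hmin⟩ := (Set.toFinite {M : Subgroup G | M.Normal ∧ A < M ∧
    M ≤ C}).exists_minimal ⟨C, hC, lt_of_le_not_ge hAC hCA, le_rfl⟩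
  exact ⟨M, hMn, hAM, hMC, fun K hKn hAK hKM =>
    le_antisymm hKM (hmin ⟨hKn, hAK, hKM.trans hMC⟩ hKM)⟩

/-- In the quasiprimitive case, `G` is controlled by the centralizer of a minimal nonabelian
normal subgroup. -/
lemma HasFaithfulEnvelopes.card_le_or_exists [Finite G] [Finite V] [Nontrivial V]
    (h : HasFaithfulEnvelopes G V) (hfaith : ∀ g : G, (∀ v : V, g • v = v) → g = 1) {d : ℕ}
    (hd : 1 ≤ d) (hdV : d ≤ Nat.log 2 (Nat.card V)) (hsec : SectionsHaveSmallIndex d G) :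
    Nat.card G ≤ Nat.card V ^ 2 ∨ ∃ M : Subgroup G, M.Normal ∧ (∃ x ∈ M, ∃ y ∈ M, x * y ≠ y * x) ∧
      Nat.card G ≤ Nat.card V ^ (25 * d + 1) * Nat.card (Subgroup.centralizer (M : Set G)) := by
  have hV : 2 ≤ Nat.card V := Finite.one_lt_card
  obtain ⟨A, hAn, hA, hmax⟩ := exists_maximal_abelian_normal G
  have hcyc := h.isCyclic hfaith hAn hA
  have hcardA := h.card_le hfaith hAn hA
  set C := Subgroup.centralizer (A : Set G) with hC
  have hindex : C.index ≤ Nat.card V := Subgroup.index_centralizer_le_of_isCyclic.trans hcardA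
  have hAC : A ≤ C := fun a ha => Subgroup.mem_centralizer_iff.2 fun b hb => hA b hb a ha
  by_cases hCA : C ≤ A
  · left
    rw [← Subgroup.card_mul_index C, sq]
    exact Nat.mul_le_mul ((Nat.card_le_card_of_injective _
      (Subgroup.inclusion_injective hCA)).trans hcardA) hindex
  right
  obtain ⟨M, hMn, hAM, hMC, hmin⟩ := exists_minimal_normal_between
    (show C.Normal from inferInstance) hAC hCA
  have hMA : ∀ m ∈ M, ∀ a ∈ A, m * a = a * m := fun m hm a ha =>
    (Subgroup.mem_centralizer_iff.1 (hMC hm) a ha).symm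
  refine ⟨M, hMn, ?_, ?_⟩
  · by_contra! hcon
    exact hAM.not_ge (hmax M hMn hcon hAM.le)
  have hZ : ∀ x ∈ M, (∀ m ∈ M, m * x = x * m) → x ∈ A := by
    intro x hx hxM
    refine hmax (M ⊓ Subgroup.centralizer (M : Set G)) inferInstance ?_ ?_ ⟨hx, hxM⟩
    · exact fun y hy z hz => Subgroup.mem_centralizer_iff.1 hz.2 y hy.1
    · exact fun a ha => ⟨hAM.le ha, fun m hm => hMA m hm a ha⟩
  by_cases hab : ∃ x ∈ M.map (QuotientGroup.mk' A), ∃ y ∈ M.map (QuotientGroup.mk' A),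
      x * y ≠ y * x
  · have hNn : (M.map (QuotientGroup.mk' A)).Normal :=
      hMn.map _ (QuotientGroup.mk'_surjective A)
    obtain ⟨𝒯, h𝒯⟩ := exists_isSimpleDecomposition (M.map (QuotientGroup.mk' A)) (by
      intro K hK hKM hKb
      have h1 := hmin (K.comap (QuotientGroup.mk' A)) inferInstance ?_ ?_
      · rw [← h1, Subgroup.map_comap_eq_self_of_surjective (QuotientGroup.mk'_surjective A)]
      · refine lt_of_le_not_ge (IsSimpleDecomposition.le_comap K) fun hle => hKb ?_
        rw [← Subgroup.map_comap_eq_self_of_surjective (QuotientGroup.mk'_surjective A) K,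
          Subgroup.map_eq_bot_iff, QuotientGroup.ker_mk']
        exact hle
      · refine (Subgroup.comap_mono hKM).trans ?_
        rw [Subgroup.comap_map_eq, QuotientGroup.ker_mk', sup_eq_left.2 hAM.le]) hab
    obtain ⟨e, he, hed, hcard⟩ := h𝒯.exists_card_le_centralizer hMA hAM.le hsec
    have h1 := Nat.pow_mul_pow_le_of_le_log hV he hed hdV
      (h𝒯.two_pow_two_pow_card_le hMn hMA hAM.le h hfaith)
    calc Nat.card G ≤ _ := hcard
      _ ≤ Nat.card V * Nat.card (Subgroup.centralizer (M : Set G)) * Nat.card V ^ (25 * d) :=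
        Nat.mul_le_mul (Nat.mul_le_mul_right _ hindex) h1
      _ = _ := by ring
  · push Not at hab
    have hcomm : ∀ m ∈ M, ∀ x ∈ M, m * x * m⁻¹ * x⁻¹ ∈ A := by
      intro m hm x hx
      rw [← QuotientGroup.eq_one_iff]
      have h1 : (m : G ⧸ A) * (x : G ⧸ A) = (x : G ⧸ A) * (m : G ⧸ A) :=
        hab _ ⟨m, hm, rfl⟩ _ ⟨x, hx, rfl⟩
      simp only [QuotientGroup.mk_mul, QuotientGroup.mk_inv]
      rw [h1]
      group
    have h1 := h.relIndex_centralizer_le hfaith hAn hMn hMA hAM.le hZ hcomm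
    have h2 : Nat.card (Subgroup.centralizer (M : Set G)) *
        (Subgroup.centralizer (M : Set G)).relIndex C = Nat.card C := by
      rw [← Subgroup.relIndex_bot_left, ← Subgroup.relIndex_bot_left C]
      exact Subgroup.relIndex_mul_relIndex _ _ _ bot_le (Subgroup.centralizer_le hAM.le)
    calc Nat.card G = Nat.card C * C.index := (Subgroup.card_mul_index C).symm
      _ ≤ Nat.card (Subgroup.centralizer (M : Set G)) * Nat.card V ^ 18 * Nat.card V := by
        rw [← h2]
        exact Nat.mul_le_mul (Nat.mul_le_mul_left _ h1) hindex
      _ = Nat.card V ^ 19 * Nat.card (Subgroup.centralizer (M : Set G)) := by ring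
      _ ≤ _ := Nat.mul_le_mul_right _ (Nat.pow_le_pow_right (by omega) (by omega))

theorem ActsIrreducibly.card_mul_two_pow_le {d : ℕ} (hd : 2 ≤ d) (n : ℕ) :
    ∀ (V : Type u) [AddCommGroup V] [Finite V] (G : Type u) [Group G] [Finite G]
      [DistribMulAction G V], Nat.card V = n → (∀ g : G, (∀ v : V, g • v = v) → g = 1) →
      ActsIrreducibly (⊤ : Subgroup G) (⊤ : AddSubgroup V) → SectionsHaveSmallIndex d G →
      Nat.card G * 2 ^ d ≤ Nat.card V ^ (60 * d) := by
  induction n using Nat.strong_induction_on with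
  | _ n ih =>
  intro V _ _ G _ _ _ hn hfaith hirr hsec
  have hnt : Nontrivial V := by
    by_contra hcon
    rw [not_nontrivial_iff_subsingleton] at hcon
    exact hirr.ne_bot (Subsingleton.elim _ _)
  have hV : 2 ≤ Nat.card V := Finite.one_lt_card
  have h2d : 2 ^ d ≤ Nat.card V ^ d := Nat.pow_le_pow_left hV d
  have ih' : ∀ (S : Subgroup G) (H : AddSubgroup V) (hS : ActsIrreducibly S H),
      Nat.card H < Nat.card V →
        Nat.card (restrictHom S H hS.smul_mem).range * 2 ^ d ≤ Nat.card H ^ (60 * d) := by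
    intro S H hS hlt
    refine ih _ (hn ▸ hlt) H _ rfl (fun g hg => ?_) hS.range_restrictHom
      ((hsec.of_injective S.subtype Subtype.val_injective).of_surjective
        (restrictHom S H hS.smul_mem).rangeRestrict (MonoidHom.rangeRestrict_surjective _))
    apply Subtype.ext
    apply Units.ext
    ext v
    exact congrArg Subtype.val (hg v)
  rcases Nat.le_total (Nat.log 2 (Nat.card V)) d with hx | hx
  · have h1 : Nat.card G ≤ Nat.card V ^ d := by
      refine (Nat.card_le_card_of_injective (DistribMulAction.toAddMonoidEnd G V) ?_).trans
        ((AddMonoid.End.card_le V).trans (Nat.pow_le_pow_right (by omega) hx))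
      intro a b hab
      refine (inv_mul_eq_one.1 (hfaith _ fun v => ?_)).symm
      rw [mul_smul, inv_smul_eq_iff]
      exact DFunLike.congr_fun hab v
    calc _ ≤ Nat.card V ^ d * Nat.card V ^ d := Nat.mul_le_mul h1 h2d
      _ = Nat.card V ^ (2 * d) := by ring
      _ ≤ _ := Nat.pow_le_pow_right (by omega) (by omega)
  rcases hasFaithfulEnvelopes_or_exists_imprimitivitySystem hirr with hE | ⟨ℋ, hℋ⟩
  · rcases hE.card_le_or_exists hfaith (by omega) hx hsec with h1 | ⟨M, hMn, ⟨a, ha, b, hb, hne⟩, h1⟩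
    · calc _ ≤ Nat.card V ^ 2 * Nat.card V ^ d := Nat.mul_le_mul h1 h2d
        _ = Nat.card V ^ (2 + d) := by ring
        _ ≤ _ := Nat.pow_le_pow_right (by omega) (by omega)
    · set D := Subgroup.centralizer (M : Set G) with hD
      have hDn : D.Normal := inferInstance
      obtain ⟨U, -, hU⟩ := exists_actsIrreducibly (X := D ⊔ M) (U := (⊤ : AddSubgroup V))
        top_ne_bot fun _ _ _ _ => trivial
      obtain ⟨W, -, hW, hWU, -⟩ := hU.exists_sq_card_le
        (fun x hx y hy => (Subgroup.mem_centralizer_iff.1 hx y hy).symm) (by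
          refine ⟨a, ha, b, hb, ?_⟩
          by_contra! hcon
          refine hne (inv_mul_eq_one.1 (hE.eq_one hfaith hMn hU.ne_bot
            (fun m hm => hU.smul_mem m ((le_sup_right : M ≤ D ⊔ M) hm))
            (M.mul_mem (M.inv_mem (M.mul_mem hb ha)) (M.mul_mem ha hb)) fun w hw => ?_)).symm
          rw [mul_smul, inv_smul_eq_iff]
          exact hcon w hw)
      have hUV : Nat.card U ≤ Nat.card V :=
        Nat.card_le_card_of_injective U.subtype Subtype.val_injective
      have hWnt : Nontrivial W := (AddSubgroup.nontrivial_iff_ne_bot W).2 hW.ne_bot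
      have hW2 : 2 ≤ Nat.card W := Finite.one_lt_card
      have hDW : Nat.card D ≤ Nat.card (restrictHom D W hW.smul_mem).range := by
        refine Nat.card_le_card_of_injective (restrictHom D W hW.smul_mem).rangeRestrict ?_
        rw [MonoidHom.rangeRestrict_injective_iff, injective_iff_map_eq_one]
        intro x hx
        refine Subtype.ext (hE.eq_one hfaith hDn hW.ne_bot hW.smul_mem x.2 fun w hw => ?_)
        rw [← restrictHom_apply D W hW.smul_mem x ⟨w, hw⟩, hx]
        rfl
      have h2 := ih' D W hW (by nlinarith)
      calc Nat.card G * 2 ^ d ≤ Nat.card V ^ (25 * d + 1) * (Nat.card D * 2 ^ d) := by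
            rw [← mul_assoc]; exact Nat.mul_le_mul_right _ h1
        _ ≤ Nat.card V ^ (25 * d + 1) * Nat.card W ^ (60 * d) :=
            Nat.mul_le_mul_left _ ((Nat.mul_le_mul_right _ hDW).trans h2)
        _ = Nat.card V ^ (25 * d + 1) * (Nat.card W ^ 2) ^ (30 * d) := by
            rw [← pow_mul]; congr 2; ring
        _ ≤ Nat.card V ^ (25 * d + 1) * Nat.card V ^ (30 * d) :=
            Nat.mul_le_mul_left _ (Nat.pow_le_pow_left (hWU.trans hUV) _)
        _ = Nat.card V ^ (55 * d + 1) := by rw [← pow_add]; congr 1; ring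
        _ ≤ _ := Nat.pow_le_pow_right (by omega) (by omega)
  · exact hℋ.card_le hsec hfaith hirr ih'

end Linear

section Conjugation

variable {G : Type*} [Group G] {N : Subgroup G}

/-- A commutative subgroup, as a type with its additive structure. -/
abbrev addCommGroupOfComm (hN : ∀ x ∈ N, ∀ y ∈ N, x * y = y * x) : AddCommGroup (Additive N) :=
  { (inferInstance : AddGroup (Additive N)) with
    add_comm := fun x y => congrArg Additive.ofMul
      (Subtype.ext (hN x.toMul x.toMul.2 y.toMul y.toMul.2) : x.toMul * y.toMul = y.toMul * x.toMul) }

lemma card_le_centralizer_mul_of_comm {G : Type} [Group G] [Finite G] {N : Subgroup G}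
    (hNn : N.Normal) (hN : ∀ x ∈ N, ∀ y ∈ N, x * y = y * x) (hbot : N ≠ ⊥)
    (hmin : ∀ K : Subgroup G, K.Normal → K ≤ N → K ≠ ⊥ → K = N) {d : ℕ} (hd : 2 ≤ d)
    (hsec : SectionsHaveSmallIndex d G) :
    Nat.card G ≤ Nat.card (Subgroup.centralizer (N : Set G)) * Nat.card N ^ (60 * d) := by
  let _ : AddCommGroup (Additive N) := addCommGroupOfComm hN
  let φ : G →* AddMonoid.End (Additive N) :=
    { toFun := fun g => AddMonoidHom.mk' (fun x => Additive.ofMul (MulAut.conjNormal g x.toMul))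
        (fun x y => congrArg Additive.ofMul (map_mul (MulAut.conjNormal g) x.toMul y.toMul))
      map_one' := by
        refine DFunLike.ext _ _ fun x => ?_
        change Additive.ofMul (MulAut.conjNormal (1 : G) x.toMul) = x
        rw [map_one]
        rfl
      map_mul' := fun g h => by
        refine DFunLike.ext _ _ fun x => ?_
        change Additive.ofMul (MulAut.conjNormal (g * h) x.toMul) =
          Additive.ofMul (MulAut.conjNormal g (MulAut.conjNormal h x.toMul))
        rw [map_mul]
        rfl }
  have hφ : ∀ g (x : N), ((Additive.toMul (φ g (Additive.ofMul x)) : N) : G) = g * x * g⁻¹ :=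
    fun g x => MulAut.conjNormal_apply g x
  have hker : φ.toHomUnits.ker ≤ Subgroup.centralizer (N : Set G) := by
    intro g hg
    rw [Subgroup.mem_centralizer_iff]
    intro x hx
    have h1 := hφ g ⟨x, hx⟩
    have h2 : φ g = 1 := congrArg Units.val hg
    rw [h2] at h1
    have h3 : x = g * x * g⁻¹ := h1
    exact (eq_mul_inv_iff_mul_eq.1 h3)
  have hnt : Nontrivial N := (Subgroup.nontrivial_iff_ne_bot N).2 hbot
  have hirr : ActsIrreducibly (⊤ : Subgroup φ.toHomUnits.range)
      (⊤ : AddSubgroup (Additive N)) := by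
    refine ⟨top_ne_bot, fun _ _ _ _ => trivial, fun W _ hW hWinv => ?_⟩
    let K : Subgroup G :=
      { carrier := {x | ∃ y : N, (y : G) = x ∧ Additive.ofMul y ∈ W}
        one_mem' := ⟨1, rfl, W.zero_mem⟩
        mul_mem' := by
          rintro _ _ ⟨x, rfl, hx⟩ ⟨y, rfl, hy⟩
          exact ⟨x * y, rfl, W.add_mem hx hy⟩
        inv_mem' := by
          rintro _ ⟨x, rfl, hx⟩
          exact ⟨x⁻¹, rfl, W.neg_mem hx⟩ }
    have hKN : K = N := by
      refine hmin K ⟨?_⟩ ?_ ?_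
      · rintro _ ⟨x, rfl, hx⟩ g
        exact ⟨_, hφ g x, hWinv ⟨φ.toHomUnits g, ⟨g, rfl⟩⟩ trivial _ hx⟩
      · rintro _ ⟨x, rfl, hx⟩
        exact x.2
      · intro hb
        apply hW
        rw [eq_bot_iff]
        intro w hw
        have h1 : ((Additive.toMul w : N) : G) ∈ K := ⟨_, rfl, hw⟩
        rw [hb, Subgroup.mem_bot] at h1
        exact congrArg Additive.ofMul (Subtype.ext h1 : Additive.toMul w = 1)
    rw [eq_top_iff]
    intro w _
    have h1 : ((Additive.toMul w : N) : G) ∈ K := by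
      rw [hKN]
      exact (Additive.toMul w).2
    obtain ⟨y, hy, hyW⟩ := h1
    have h2 : y = Additive.toMul w := Subtype.ext hy
    rwa [h2] at hyW
  have h1 := ActsIrreducibly.card_mul_two_pow_le hd _ (Additive N) φ.toHomUnits.range rfl
    (fun g hg => Subtype.ext (Units.ext (DFunLike.ext _ _ hg))) hirr
    (hsec.of_surjective φ.toHomUnits.rangeRestrict (MonoidHom.rangeRestrict_surjective _))
  have h2 : Nat.card φ.toHomUnits.ker * Nat.card φ.toHomUnits.range = Nat.card G := by
    rw [← Subgroup.index_ker, Subgroup.card_mul_index]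
  rw [← h2]
  refine Nat.mul_le_mul (Nat.card_le_card_of_injective _ (Subgroup.inclusion_injective hker)) ?_
  exact (Nat.le_mul_of_pos_right _ (by positivity)).trans h1

end Conjugation

section Primitive

variable {Ω : Type} {Γ : Subgroup (Equiv.Perm Ω)}

lemma IsPrimitivePermGroup.exists_mem_apply_eq (h : IsPrimitivePermGroup Γ) {N : Subgroup Γ}
    (hN : N.Normal) (hbot : N ≠ ⊥) (β γ : Ω) : ∃ g ∈ N, (g : Equiv.Perm Ω) β = γ := by
  obtain ⟨⟨g₀, hg₀⟩, hg₁⟩ := Subgroup.ne_bot_iff_exists_ne_one.1 hbot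
  have hne : g₀ ≠ 1 := fun h1 => hg₁ (Subtype.ext h1)
  obtain ⟨α, hα⟩ : ∃ α, (g₀ : Equiv.Perm Ω) α ≠ α := by
    by_contra! hcon
    exact hne (Subtype.ext (Equiv.ext hcon))
  have horb : {x | ∃ g ∈ N, (g : Equiv.Perm Ω) α = x} = Set.univ := by
    refine (h.2 {x | ∃ g ∈ N, (g : Equiv.Perm Ω) α = x} ⟨α, 1, N.one_mem, rfl⟩
      ?_).resolve_right ?_
    · intro δ hδ
      rw [or_iff_not_imp_right, Set.not_disjoint_iff]
      rintro ⟨_, ⟨_, ⟨g, hg, rfl⟩, rfl⟩, ⟨k, hk, hkg⟩⟩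
      have hconj : ∀ x ∈ N, (⟨δ, hδ⟩ : Γ) * x * (⟨δ, hδ⟩ : Γ)⁻¹ ∈ N := fun x hx =>
        hN.conj_mem x hx _
      have hconj' : ∀ x ∈ N, (⟨δ, hδ⟩ : Γ)⁻¹ * x * (⟨δ, hδ⟩ : Γ) ∈ N := fun x hx => by
        simpa using hN.conj_mem x hx (⟨δ, hδ⟩ : Γ)⁻¹
      have hδα : δ α = δ ((g : Equiv.Perm Ω)⁻¹ (δ⁻¹ ((k : Equiv.Perm Ω) α))) := by
        rw [hkg]
        simp
      ext x
      constructor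
      · rintro ⟨_, ⟨l, hl, rfl⟩, rfl⟩
        refine ⟨(⟨δ, hδ⟩ * (l * g⁻¹) * (⟨δ, hδ⟩ : Γ)⁻¹) * k,
          N.mul_mem (hconj _ (N.mul_mem hl (N.inv_mem hg))) hk, ?_⟩
        change δ ((l : Equiv.Perm Ω) ((g : Equiv.Perm Ω)⁻¹ (δ⁻¹ ((k : Equiv.Perm Ω) α)))) = _
        rw [← δ.injective hδα]
      · rintro ⟨l, hl, rfl⟩
        refine ⟨δ⁻¹ ((l : Equiv.Perm Ω) α), ⟨(⟨δ, hδ⟩ : Γ)⁻¹ * (l * k⁻¹) * ⟨δ, hδ⟩ * g,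
          N.mul_mem (hconj' _ (N.mul_mem hl (N.inv_mem hk))) hg, ?_⟩, by simp⟩
        change δ⁻¹ ((l : Equiv.Perm Ω) ((k : Equiv.Perm Ω)⁻¹ (δ ((g : Equiv.Perm Ω) α)))) = _
        rw [← hkg]
        simp
    · rintro ⟨β, hβ⟩
      have h1 : α ∈ {x | ∃ g ∈ N, (g : Equiv.Perm Ω) α = x} := ⟨1, N.one_mem, rfl⟩
      have h2 : (g₀ : Equiv.Perm Ω) α ∈ {x | ∃ g ∈ N, (g : Equiv.Perm Ω) α = x} := ⟨g₀, hg₀, rfl⟩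
      rw [hβ, Set.mem_singleton_iff] at h1 h2
      exact hα (h2.trans h1.symm)
  have horb' : ∀ x, ∃ g ∈ N, (g : Equiv.Perm Ω) α = x := fun x => by
    have h1 : x ∈ {x | ∃ g ∈ N, (g : Equiv.Perm Ω) α = x} := by rw [horb]; trivial
    exact h1
  obtain ⟨b, hb, rfl⟩ := horb' β
  obtain ⟨c, hc, rfl⟩ := horb' γ
  refine ⟨c * b⁻¹, N.mul_mem hc (N.inv_mem hb), ?_⟩
  change (c : Equiv.Perm Ω) ((b : Equiv.Perm Ω)⁻¹ ((b : Equiv.Perm Ω) α)) = _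
  simp

lemma card_centralizer_le_of_transitive [Finite Ω] {N : Subgroup Γ}
    (hN : ∀ β γ, ∃ g ∈ N, (g : Equiv.Perm Ω) β = γ) (α : Ω) :
    Nat.card (Subgroup.centralizer (N : Set Γ)) ≤ Nat.card Ω := by
  refine Nat.card_le_card_of_injective
    (fun c : Subgroup.centralizer (N : Set Γ) => ((c : Γ) : Equiv.Perm Ω) α) fun c c' hcc => ?_
  refine Subtype.ext (Subtype.ext (Equiv.ext fun β => ?_))
  obtain ⟨g, hg, rfl⟩ := hN α β
  have key : ∀ b : Subgroup.centralizer (N : Set Γ), ((b : Γ) : Equiv.Perm Ω)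
      ((g : Equiv.Perm Ω) α) = (g : Equiv.Perm Ω) (((b : Γ) : Equiv.Perm Ω) α) := by
    intro b
    have h1 := Subgroup.mem_centralizer_iff.1 b.2 g hg
    exact (DFunLike.congr_fun (congrArg Subtype.val h1) α).symm
  rw [key, key]
  exact congrArg _ hcc

lemma IsSimpleDecomposition.pow_card_le_of_transitive [Finite Ω] {N : Subgroup Γ} [N.Normal]
    {𝒯 : Set (Subgroup Γ)} (h : IsSimpleDecomposition N 𝒯)
    (hN : ∀ β γ, ∃ g ∈ N, (g : Equiv.Perm Ω) β = γ) (α : Ω) {e : ℕ}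
    (he : ∀ T ∈ 𝒯, ∀ P : Subgroup Γ, ¬ T ≤ P → e ≤ P.relIndex T) :
    e ^ Nat.card 𝒯 ≤ Nat.card Ω ^ 2 := by
  have hmem : ∀ x : Γ, x ∈ MulAction.stabilizer Γ α ↔ (x : Equiv.Perm Ω) α = α := fun _ => Iff.rfl
  refine (h.pow_card_le_sq he (MulAction.stabilizer Γ α) ?_ ?_).trans (Nat.pow_le_pow_left ?_ 2)
  · intro g
    obtain ⟨m, hm, hmα⟩ := hN α ((g : Equiv.Perm Ω)⁻¹ α)
    refine ⟨g * m, ?_, m⁻¹, N.inv_mem hm, by group⟩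
    rw [hmem]
    change (g : Equiv.Perm Ω) ((m : Equiv.Perm Ω) α) = α
    rw [hmα]
    simp
  · intro x _ _ hx
    refine Subtype.ext (Equiv.ext fun β => ?_)
    obtain ⟨m, hm, rfl⟩ := hN α β
    have h1 : (m : Equiv.Perm Ω)⁻¹ ((x : Equiv.Perm Ω) ((m : Equiv.Perm Ω) α)) = α :=
      (hmem _).1 (hx m hm)
    have h2 := Equiv.Perm.inv_eq_iff_eq.1 h1
    exact h2
  · refine Subgroup.relIndex_le_card_of_forall (fun c : N => ((c : Γ) : Equiv.Perm Ω) α)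
      fun c c' hcc => ?_
    rw [hmem]
    change ((c : Γ) : Equiv.Perm Ω)⁻¹ (((c' : Γ) : Equiv.Perm Ω) α) = α
    exact Equiv.Perm.inv_eq_iff_eq.2 hcc.symm

end Primitive

/-- There is a constant `c` such that every primitive permutation group
`Γ ≤ Sym(Ω)` of degree `n = |Ω|` belonging to `Γ̂_d` (for `d ≥ 2`) satisfies `|Γ| ≤ n^(c·d)`. -/
theorem primitive_gammaHat_order_bound :
    ∃ c : ℕ, ∀ (d : ℕ), 2 ≤ d → ∀ (Ω : Type) [Fintype Ω] (Γ : Subgroup (Equiv.Perm Ω)),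
      IsPrimitivePermGroup Γ → InGammaHat d ↥Γ →
      Nat.card ↥Γ ≤ (Fintype.card Ω) ^ (c * d) := by
  refine ⟨61, fun d hd Ω _ Γ hΓ hsec' => ?_⟩
  have hsec := hsec'.sectionsHaveSmallIndex
  obtain ⟨α, -⟩ := hΓ.1
  have hne : Nonempty Ω := ⟨α⟩
  rw [← Nat.card_eq_fintype_card]
  have hn : 0 < Nat.card Ω := Nat.card_pos
  rcases subsingleton_or_nontrivial Γ with hss | hnt
  · rw [Nat.card_unique]
    exact Nat.one_le_pow _ _ hn
  obtain ⟨N, hNn, hNbot, -, hmin'⟩ := exists_minimal_normal_between (G := Γ) (A := ⊥) (C := ⊤)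
    inferInstance bot_le (fun h => bot_ne_top (le_antisymm bot_le h))
  have hmin : ∀ K : Subgroup Γ, K.Normal → K ≤ N → K ≠ ⊥ → K = N := fun K hK hKN hKb =>
    hmin' K hK (bot_lt_iff_ne_bot.2 hKb) hKN
  have htrans := hΓ.exists_mem_apply_eq hNn hNbot.ne'
  have hC := card_centralizer_le_of_transitive htrans α
  by_cases hab : ∃ x ∈ N, ∃ y ∈ N, x * y ≠ y * x
  · obtain ⟨𝒯, h𝒯⟩ := exists_isSimpleDecomposition N hmin hab
    obtain ⟨e, he, hed, hindex, hcard⟩ := h𝒯.exists_bound hsec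
    have h1 := h𝒯.pow_card_le_of_transitive htrans α hindex
    have h2 : 2 ^ (d * (Nat.card 𝒯 - 1)) ≤ Nat.card Ω ^ (2 * d) := by
      calc 2 ^ (d * (Nat.card 𝒯 - 1)) ≤ 2 ^ (Nat.card 𝒯 * d) := by
            rw [mul_comm _ d]
            exact Nat.pow_le_pow_right two_pos (Nat.mul_le_mul_left _ (Nat.sub_le _ _))
        _ ≤ (e ^ Nat.card 𝒯) ^ d := by
            rw [pow_mul]
            exact Nat.pow_le_pow_left (Nat.pow_le_pow_left he _) _
        _ ≤ (Nat.card Ω ^ 2) ^ d := Nat.pow_le_pow_left h1 _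
        _ = _ := (pow_mul _ _ _).symm
    have h3 : (e ^ (4 * e)) ^ Nat.card 𝒯 ≤ Nat.card Ω ^ (8 * d) := by
      calc (e ^ (4 * e)) ^ Nat.card 𝒯 = (e ^ Nat.card 𝒯) ^ (4 * e) := by
            rw [← pow_mul, ← pow_mul, mul_comm]
        _ ≤ (Nat.card Ω ^ 2) ^ (4 * e) := Nat.pow_le_pow_left h1 _
        _ = Nat.card Ω ^ (8 * e) := by rw [← pow_mul]; congr 1; ring
        _ ≤ _ := Nat.pow_le_pow_right hn (by omega)
    calc Nat.card Γ ≤ _ := hcard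
      _ ≤ Nat.card Ω * (Nat.card Ω ^ (2 * d) * Nat.card Ω ^ (8 * d)) :=
        Nat.mul_le_mul hC (Nat.mul_le_mul h2 h3)
      _ = Nat.card Ω ^ (10 * d + 1) := by rw [← pow_add, ← pow_succ']; congr 1; ring
      _ ≤ _ := Nat.pow_le_pow_right hn (by omega)
  · push Not at hab
    have hNC : N ≤ Subgroup.centralizer (N : Set Γ) := fun x hx =>
      Subgroup.mem_centralizer_iff.2 fun y hy => hab y hy x hx
    have hNcard : Nat.card N ≤ Nat.card Ω :=
      (Nat.card_le_card_of_injective _ (Subgroup.inclusion_injective hNC)).trans hC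
    calc Nat.card Γ ≤ _ := card_le_centralizer_mul_of_comm hNn hab hNbot.ne' hmin hd hsec
      _ ≤ Nat.card Ω * Nat.card Ω ^ (60 * d) :=
        Nat.mul_le_mul hC (Nat.pow_le_pow_left hNcard _)
      _ = Nat.card Ω ^ (60 * d + 1) := by rw [← pow_succ']
      _ ≤ _ := Nat.pow_le_pow_right hn (by omega)
end

section
/- Let Γ ≤ Sym(Ω) be a permutation group on a finite set Ω and let φ : Γ → S_k be a giant representation with k ≥ 5. Suppose A ⊆ Ω is an orbit of Γ all of whose points are affected by φ. Then every orbit of the kernel ker(φ) that is contained in A has size at most |A|/k. -/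
/-- `φ : Γ → S_k` is a giant representation: its image contains the alternating group `A_k`. -/
def IsGiantRep {Ω : Type*} (Γ : Subgroup (Equiv.Perm Ω)) {k : ℕ}
    (φ : ↥Γ →* Equiv.Perm (Fin k)) : Prop :=
  alternatingGroup (Fin k) ≤ φ.range

/-- A point `α ∈ Ω` is affected by `φ` if the image of its stabilizer under `φ`
does not contain `A_k`. -/
def AffectedBy {Ω : Type*} (Γ : Subgroup (Equiv.Perm Ω)) {k : ℕ}
    (φ : ↥Γ →* Equiv.Perm (Fin k)) (α : Ω) : Prop :=
  ¬ alternatingGroup (Fin k) ≤ (MulAction.stabilizer ↥Γ α).map φ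

/-- A subgroup of a finite simple group whose order exceeds `m!` is either everything or has
index greater than `m`. -/
theorem Subgroup.lt_index_of_factorial_lt_card {G : Type*} [Group G] [Finite G] [IsSimpleGroup G]
    {H : Subgroup G} (hH : H ≠ ⊤) {m : ℕ} (hm : m.factorial < Nat.card G) : m < H.index := by
  by_contra! hle
  have hcore : H.normalCore = ⊥ :=
    (H.normalCore_normal.eq_bot_or_eq_top).resolve_right fun h =>
      hH (top_le_iff.mp (h ▸ H.normalCore_le))
  have hinj : Function.Injective (MulAction.toPermHom G (G ⧸ H)) := by
    rw [← MonoidHom.ker_eq_bot_iff, ← Subgroup.normalCore_eq_ker, hcore]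
  have hcard := Nat.card_le_card_of_injective _ hinj
  rw [Nat.card_perm] at hcard
  exact absurd (hcard.trans (Nat.factorial_le hle)) hm.not_ge

/-- For `k ≥ 5`, every proper subgroup of the alternating group `A_k` has index at least `k`. -/
theorem alternatingGroup.le_index {k : ℕ} (hk : 5 ≤ k) {H : Subgroup (alternatingGroup (Fin k))}
    (hH : H ≠ ⊤) : k ≤ H.index := by
  have : IsSimpleGroup (alternatingGroup (Fin k)) := alternatingGroup.isSimpleGroup (by simpa)
  have : Nontrivial (Fin k) := Fin.nontrivial_iff_two_le.mpr (by omega)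
  obtain ⟨m, rfl⟩ : ∃ m, k = m + 1 := ⟨k - 1, by omega⟩
  refine Subgroup.lt_index_of_factorial_lt_card hH ?_
  have hcard := two_mul_nat_card_alternatingGroup (α := Fin (m + 1))
  rw [Nat.card_perm, Nat.card_fin, Nat.factorial_succ] at hcard
  nlinarith [m.factorial_pos]

/-- In a finite group, `[NH : H] = [N : N ∩ H]` for a normal subgroup `N` and any subgroup `H`. -/
theorem Subgroup.relIndex_sup_of_normal {G : Type*} [Group G] [Finite G] (N H : Subgroup G)
    [N.Normal] : H.relIndex (N ⊔ H) = H.relIndex N := by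
  have h₁ := Subgroup.relIndex_mul_relIndex (N ⊓ H) N (N ⊔ H) inf_le_left le_sup_left
  have h₂ := Subgroup.relIndex_mul_relIndex (N ⊓ H) H (N ⊔ H) inf_le_right le_sup_right
  rw [Subgroup.inf_relIndex_left, Subgroup.relIndex_sup_left] at h₁
  rw [Subgroup.inf_relIndex_right, mul_comm] at h₂
  exact Nat.eq_of_mul_eq_mul_right
    (Nat.pos_of_ne_zero Subgroup.index_ne_zero_of_finite) (h₂.trans h₁.symm)

/-- The length of an orbit is the length of the orbit of the kernel times an index in the image. -/
theorem MonoidHom.ncard_orbit_ker_mul_relIndex {G G' X : Type*} [Group G] [Finite G] [Group G']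
    [MulAction G X] (φ : G →* G') (x : X) :
    (MulAction.orbit φ.ker x).ncard * ((MulAction.stabilizer G x).map φ).relIndex φ.range =
      (MulAction.orbit G x).ncard := by
  have hker : MulAction.stabilizer φ.ker x = (MulAction.stabilizer G x).subgroupOf φ.ker := rfl
  rw [← MulAction.index_stabilizer, ← MulAction.index_stabilizer, hker, ← Subgroup.index_comap,
    Subgroup.comap_map_eq, ← Subgroup.relIndex, sup_comm,
    ← Subgroup.relIndex_mul_index (le_sup_right : _ ≤ φ.ker ⊔ MulAction.stabilizer G x)]
  rw [Subgroup.relIndex_sup_of_normal]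

/-- **Affected Orbit Lemma, Babai.**
Let `φ : Γ → S_k` be a giant representation with `k ≥ 5`, and let `A` be an orbit of `Γ`
all of whose points are affected by `φ`. Then every orbit of `ker φ` contained in `A`
has size at most `|A| / k`. -/
theorem affected_orbit_lemma (Ω : Type) [Fintype Ω]
    (Γ : Subgroup (Equiv.Perm Ω)) (k : ℕ)
    (φ : ↥Γ →* Equiv.Perm (Fin k)) (hgiant : IsGiantRep Γ φ) (hk : 5 ≤ k)
    (A : Set Ω) (a : Ω) (hA : A = MulAction.orbit ↥Γ a)
    (haff : ∀ α ∈ A, AffectedBy Γ φ α)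
    (β : Ω) (hβ : MulAction.orbit ↥φ.ker β ⊆ A) :
    ((MulAction.orbit ↥φ.ker β).ncard : ℝ) ≤ (A.ncard : ℝ) / k := by
  have hβA : β ∈ A := hβ (MulAction.mem_orbit_self β)
  have horb : A = MulAction.orbit ↥Γ β := by
    rw [hA] at hβA ⊢
    exact (MulAction.orbit_eq_iff.mpr hβA).symm
  set H := (MulAction.stabilizer ↥Γ β).map φ
  have hH : H.subgroupOf (alternatingGroup (Fin k)) ≠ ⊤ := fun h =>
    haff β hβA (Subgroup.subgroupOf_eq_top.mp h)
  have hindex : k ≤ H.relIndex φ.range :=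
    (alternatingGroup.le_index hk hH).trans
      (Subgroup.relIndex_le_of_le_right hgiant Subgroup.index_ne_zero_of_finite)
  rw [le_div_iff₀ (by positivity), horb, ← φ.ncard_orbit_ker_mul_relIndex β]
  exact_mod_cast Nat.mul_le_mul_left _ hindex
end
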